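/- There exists a constant C > 0, depending only on T, α, β, K and δ, such that for every classical solution (v,u,θ,w,b) of the planar compressible MHD system on ℝ × [0,T] with (K,δ)-admissible initial data, the transverse magnetic field is uniformly bounded: |b(x,t)| ≤ C for all (x,t) ∈ ℝ × [0,T]. -/

import Mathlib

open MeasureTheory Set Filter

noncomputable section

/-- Viscosity function `μ(z) = 1 + α z^(−α)` (here `μ̃₁ = 1`, `μ̃₂ = α`). -/
def visc (α z : ℝ) : ℝ := 1 + α * z ^ (-α)

/-- Squared Euclidean norm on `ℝ × ℝ` (used for the transverse fields `w, b ∈ ℝ²`). -/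
def sq2 (p : ℝ × ℝ) : ℝ := p.1 ^ 2 + p.2 ^ 2

/-- Partial derivative with respect to the first (spatial) variable. -/
def pdx {E : Type*} [NormedAddCommGroup E] [NormedSpace ℝ E]
    (f : ℝ → ℝ → E) (x t : ℝ) : E := deriv (fun y => f y t) x

/-- Partial derivative with respect to the second (time) variable, taken within `[0, T]`
(so it is one-sided at the endpoints). -/
def pdt (T : ℝ) {E : Type*} [NormedAddCommGroup E] [NormedSpace ℝ E]
    (f : ℝ → ℝ → E) (x t : ℝ) : E := derivWithin (fun s => f x s) (Icc 0 T) t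

/-- A classical solution of the planar compressible MHD system (in Lagrangian coordinates,
with all physical constants normalized to `1` and `μ̃₂ = α`) on `ℝ × [0,T]`:
all the derivatives appearing in the equations exist and are continuous, `v, θ > 0`,
the five equations hold pointwise, the solution tends to `(1,0,1,0,0)` as `|x| → ∞`
uniformly in `t ∈ [0,T]`, and `v−1, u, θ−1, b, w` and their first spatial derivatives
are square-integrable in `x` for each `t ∈ [0,T]`. -/
structure IsClassicalSolution (α β T : ℝ) (v u θ : ℝ → ℝ → ℝ)
    (w b : ℝ → ℝ → ℝ × ℝ) : Prop where
  v_pos : ∀ x : ℝ, ∀ t ∈ Icc (0:ℝ) T, 0 < v x t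
  θ_pos : ∀ x : ℝ, ∀ t ∈ Icc (0:ℝ) T, 0 < θ x t
  diff_x : ∀ x : ℝ, ∀ t ∈ Icc (0:ℝ) T,
    DifferentiableAt ℝ (fun y => v y t) x ∧ DifferentiableAt ℝ (fun y => u y t) x ∧
    DifferentiableAt ℝ (fun y => θ y t) x ∧ DifferentiableAt ℝ (fun y => w y t) x ∧
    DifferentiableAt ℝ (fun y => b y t) x
  diff_xx : ∀ x : ℝ, ∀ t ∈ Icc (0:ℝ) T,
    DifferentiableAt ℝ (fun y => pdx u y t) x ∧ DifferentiableAt ℝ (fun y => pdx θ y t) x ∧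
    DifferentiableAt ℝ (fun y => pdx w y t) x ∧ DifferentiableAt ℝ (fun y => pdx b y t) x
  diff_t : ∀ x : ℝ, ∀ t ∈ Icc (0:ℝ) T,
    DifferentiableWithinAt ℝ (fun s => v x s) (Icc 0 T) t ∧
    DifferentiableWithinAt ℝ (fun s => u x s) (Icc 0 T) t ∧
    DifferentiableWithinAt ℝ (fun s => θ x s) (Icc 0 T) t ∧
    DifferentiableWithinAt ℝ (fun s => w x s) (Icc 0 T) t ∧
    DifferentiableWithinAt ℝ (fun s => b x s) (Icc 0 T) t
  cont : ContinuousOn (fun p : ℝ × ℝ =>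
      (v p.1 p.2, u p.1 p.2, θ p.1 p.2, w p.1 p.2, b p.1 p.2)) (univ ×ˢ Icc 0 T)
  cont_dx : ContinuousOn (fun p : ℝ × ℝ =>
      (pdx v p.1 p.2, pdx u p.1 p.2, pdx θ p.1 p.2, pdx w p.1 p.2, pdx b p.1 p.2))
      (univ ×ˢ Icc 0 T)
  cont_dxx : ContinuousOn (fun p : ℝ × ℝ =>
      (pdx (pdx u) p.1 p.2, pdx (pdx θ) p.1 p.2, pdx (pdx w) p.1 p.2, pdx (pdx b) p.1 p.2))
      (univ ×ˢ Icc 0 T)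
  cont_dt : ContinuousOn (fun p : ℝ × ℝ =>
      (pdt T v p.1 p.2, pdt T u p.1 p.2, pdt T θ p.1 p.2, pdt T w p.1 p.2, pdt T b p.1 p.2))
      (univ ×ˢ Icc 0 T)
  eq_mass : ∀ x : ℝ, ∀ t ∈ Icc (0:ℝ) T, pdt T v x t = pdx u x t
  eq_mom : ∀ x : ℝ, ∀ t ∈ Icc (0:ℝ) T,
    pdt T u x t + pdx (fun y s => θ y s / v y s + sq2 (b y s) / 2) x t
      = pdx (fun y s => visc α (v y s) * pdx u y s / v y s) x t
  eq_w : ∀ x : ℝ, ∀ t ∈ Icc (0:ℝ) T,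
    pdt T w x t - pdx b x t = pdx (fun y s => (v y s)⁻¹ • pdx w y s) x t
  eq_b : ∀ x : ℝ, ∀ t ∈ Icc (0:ℝ) T,
    pdt T (fun y s => v y s • b y s) x t - pdx w x t
      = pdx (fun y s => (v y s)⁻¹ • pdx b y s) x t
  eq_temp : ∀ x : ℝ, ∀ t ∈ Icc (0:ℝ) T,
    pdt T θ x t + θ x t / v x t * pdx u x t
      = pdx (fun y s => θ y s ^ β * pdx θ y s / v y s) x t
        + (visc α (v x t) * pdx u x t ^ 2 + sq2 (pdx w x t) + sq2 (pdx b x t)) / v x t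
  farfield : ∀ ε > (0:ℝ), ∃ M : ℝ, ∀ x : ℝ, ∀ t ∈ Icc (0:ℝ) T, M ≤ |x| →
    |v x t - 1| < ε ∧ |u x t| < ε ∧ |θ x t - 1| < ε ∧
    Real.sqrt (sq2 (b x t)) < ε ∧ Real.sqrt (sq2 (w x t)) < ε
  sq_int : ∀ t ∈ Icc (0:ℝ) T,
    Integrable (fun x => (v x t - 1) ^ 2) ∧ Integrable (fun x => (u x t) ^ 2) ∧
    Integrable (fun x => (θ x t - 1) ^ 2) ∧ Integrable (fun x => sq2 (b x t)) ∧
    Integrable (fun x => sq2 (w x t)) ∧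
    Integrable (fun x => (pdx v x t) ^ 2) ∧ Integrable (fun x => (pdx u x t) ^ 2) ∧
    Integrable (fun x => (pdx θ x t) ^ 2) ∧ Integrable (fun x => sq2 (pdx b x t)) ∧
    Integrable (fun x => sq2 (pdx w x t))

/-- The initial data of a solution are `(K, δ)`-admissible: the `H¹`-type norm of
`(v₀−1, u₀, θ₀−1, b₀, w₀)` is at most `K²` and `v₀ ≥ δ`, `θ₀ ≥ δ`. -/
def Admissible (K δ : ℝ) (v u θ : ℝ → ℝ → ℝ) (w b : ℝ → ℝ → ℝ × ℝ) : Prop :=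
  (∫ x : ℝ, ((v x 0 - 1) ^ 2 + (u x 0) ^ 2 + (θ x 0 - 1) ^ 2 + sq2 (b x 0) + sq2 (w x 0)
      + (pdx v x 0) ^ 2 + (pdx u x 0) ^ 2 + (pdx θ x 0) ^ 2
      + sq2 (pdx b x 0) + sq2 (pdx w x 0))) ≤ K ^ 2 ∧
  (∀ x : ℝ, δ ≤ v x 0) ∧ (∀ x : ℝ, δ ≤ θ x 0)

section Calculus

/-- Monotonicity of the interval integral for continuous integrands. -/
theorem integral_mono_of_continuous {f g : ℝ → ℝ} {a b : ℝ} (hab : a ≤ b) (hf : Continuous f)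
    (hg : Continuous g) (h : ∀ x ∈ Icc a b, f x ≤ g x) :
    ∫ x in a..b, f x ≤ ∫ x in a..b, g x :=
  intervalIntegral.integral_mono_on hab (hf.intervalIntegrable _ _) (hg.intervalIntegrable _ _) h

theorem integral_add_of_continuous {f g : ℝ → ℝ} {a b : ℝ} (hf : Continuous f)
    (hg : Continuous g) :
    ∫ x in a..b, (f x + g x) = (∫ x in a..b, f x) + ∫ x in a..b, g x :=
  intervalIntegral.integral_add (hf.intervalIntegrable _ _) (hg.intervalIntegrable _ _)

/-- Monotonicity of the integral of a nonnegative function in the interval. -/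
theorem integral_mono_interval_of_continuous {f : ℝ → ℝ} {a b c d : ℝ} (hca : c ≤ a) (hab : a ≤ b)
    (hbd : b ≤ d) (hf : Continuous f) (h : ∀ x, 0 ≤ f x) :
    ∫ x in a..b, f x ≤ ∫ x in c..d, f x :=
  intervalIntegral.integral_mono_interval hca hab hbd (Eventually.of_forall h)
    (hf.intervalIntegrable _ _)

/-- Difference in time of a spatial integral. -/
theorem integral_sub_integral_zero {T a b : ℝ} {f ft : ℝ → ℝ → ℝ}
    (cf : Continuous (Function.uncurry f)) (cft : Continuous (Function.uncurry ft))
    (hf : ∀ x, ∀ t ∈ Icc (0:ℝ) T, HasDerivWithinAt (fun s => f x s) (ft x t) (Icc 0 T) t)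
    {t : ℝ} (ht : t ∈ Icc (0:ℝ) T) :
    (∫ x in a..b, f x t) - ∫ x in a..b, f x 0 = ∫ s in (0:ℝ)..t, ∫ x in a..b, ft x s := by
  have h1 : ∀ x, f x t - f x 0 = ∫ s in (0:ℝ)..t, ft x s := fun x => by
    rw [intervalIntegral.integral_eq_sub_of_hasDerivAt_of_le ht.1]
    · fun_prop
    · intro s hs
      exact (hf x s ⟨hs.1.le, hs.2.le.trans ht.2⟩).hasDerivAt
        (Icc_mem_nhds hs.1 (hs.2.trans_le ht.2))
    · exact Continuous.intervalIntegrable (by fun_prop) _ _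
  rw [← intervalIntegral.integral_sub (Continuous.intervalIntegrable (by fun_prop) _ _)
    (Continuous.intervalIntegrable (by fun_prop) _ _)]
  simp_rw [h1]
  apply intervalIntegral_intervalIntegral_swap
  exact (cft.continuousOn.integrableOn_compact (isCompact_uIcc.prod isCompact_uIcc)).mono_set
    (prod_mono uIoc_subset_uIcc uIoc_subset_uIcc)

/-- Polynomial cut-off on `[-L, L]`. -/
def cutoff (L x : ℝ) : ℝ := (1 - (x / L) ^ 2) ^ 2

@[fun_prop]
theorem continuous_cutoff (L : ℝ) : Continuous (cutoff L) := by unfold cutoff; fun_prop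

theorem cutoff_nonneg (L x : ℝ) : 0 ≤ cutoff L x := sq_nonneg _

theorem div_sq_le_one {L x : ℝ} (hL : 0 < L) (hx : x ∈ Icc (-L) L) : (x / L) ^ 2 ≤ 1 := by
  rw [div_pow, div_le_one (by positivity)]
  nlinarith [hx.1, hx.2]

theorem cutoff_le_one {L x : ℝ} (hL : 0 < L) (hx : x ∈ Icc (-L) L) : cutoff L x ≤ 1 := by
  have := div_sq_le_one hL hx
  unfold cutoff
  nlinarith [sq_nonneg (x / L)]

theorem half_le_cutoff {L R x : ℝ} (hL : 0 < L) (hR : 2 * R ≤ L) (hx : x ∈ Icc (-R) R) :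
    1 / 2 ≤ cutoff L x := by
  have h : (x / L) ^ 2 ≤ 1 / 4 := by
    rw [div_pow, div_le_iff₀ (by positivity)]
    nlinarith [hx.1, hx.2]
  unfold cutoff
  nlinarith [sq_nonneg (x / L)]

theorem hasDerivAt_cutoff {L : ℝ} (x : ℝ) :
    HasDerivAt (cutoff L) (-(4 * x / L ^ 2) * (1 - (x / L) ^ 2)) x := by
  have h := ((((hasDerivAt_id x).div_const L).pow 2).const_sub 1).pow 2
  refine HasDerivAt.congr_deriv h ?_
  simp only [id, Pi.pow_apply]
  push_cast
  ring

/-- The integral against the cut-off controls half of the integral over a smaller interval. -/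
theorem integral_le_two_mul_cutoff {f : ℝ → ℝ} {L R : ℝ} (hR0 : 0 ≤ R) (hL : 0 < L)
    (hR : 2 * R ≤ L) (hf : Continuous f) (h : ∀ x, 0 ≤ f x) :
    ∫ x in (-R)..R, f x ≤ 2 * ∫ x in (-L)..L, cutoff L x * f x := by
  rw [← intervalIntegral.integral_const_mul]
  refine (integral_mono_of_continuous (g := fun x => 2 * (cutoff L x * f x)) (by linarith) hf
    (by fun_prop) fun x hx => ?_).trans (integral_mono_interval_of_continuous (by linarith)
      (by linarith) (by linarith) (by fun_prop) fun x => ?_)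
  · nlinarith [half_le_cutoff hL hR hx, h x]
  · have := mul_nonneg (cutoff_nonneg L x) (h x)
    positivity

/-- Pointwise cut-off estimate: the flux terms are absorbed by the dissipation. -/
theorem cutoff_pointwise {L x B e F A d q r ηt : ℝ} (hL : 0 < L) (hx : x ∈ Icc (-L) L)
    (hB : 0 < B) (hA : |A| ≤ e) (hJ : (F - A) ^ 2 ≤ B * d) (hq : d / 2 - r ≤ q) :
    cutoff L x * ηt ≤ (-(4 * x / L ^ 2) * (1 - (x / L) ^ 2) * F + cutoff L x * (ηt + q))
      - 1 / 4 * (cutoff L x * d) + cutoff L x * r + (4 / L * e + 16 * B / L ^ 2) := by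
  have hψ := div_sq_le_one hL hx
  have h0 := sq_nonneg (x / L)
  set ψ := 1 - (x / L) ^ 2 with hψd
  have hc : cutoff L x = ψ ^ 2 := rfl
  rw [hc]
  have hk : |4 * x / L ^ 2| ≤ 4 / L := by
    rw [abs_div, abs_mul, abs_of_pos (by positivity : (0:ℝ) < L ^ 2), div_le_div_iff₀ (by positivity)
      hL]
    have : |x| ≤ L := abs_le.2 hx
    norm_num
    nlinarith
  set k := 4 * x / L ^ 2 with hkd
  have h1 : k * ψ * A ≤ 4 / L * e := by
    refine (le_abs_self _).trans ?_
    rw [abs_mul, abs_mul]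
    refine mul_le_mul ?_ hA (abs_nonneg _) (by positivity)
    calc |k| * |ψ| ≤ |k| * 1 := by
          apply mul_le_mul_of_nonneg_left _ (abs_nonneg _)
          rw [abs_le]; constructor <;> linarith
      _ ≤ _ := by linarith
  have h2 : k * ψ * (F - A) ≤ 1 / 4 * (ψ ^ 2 * d) + 16 * B / L ^ 2 := by
    have hk2 : k ^ 2 * B ≤ 16 * B / L ^ 2 := by
      have : k ^ 2 ≤ (4 / L) ^ 2 := sq_le_sq' (by linarith [neg_abs_le k]) ((le_abs_self k).trans hk)
      calc k ^ 2 * B ≤ (4 / L) ^ 2 * B := by gcongr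
        _ = _ := by ring
    have h3 : ψ ^ 2 * (F - A) ^ 2 / (4 * B) ≤ 1 / 4 * (ψ ^ 2 * d) := by
      rw [div_le_iff₀ (by positivity)]
      nlinarith [mul_le_mul_of_nonneg_left hJ (sq_nonneg ψ)]
    have h4 : k * ψ * (F - A) ≤ ψ ^ 2 * (F - A) ^ 2 / (4 * B) + k ^ 2 * B := by
      have : ψ ^ 2 * (F - A) ^ 2 / (4 * B) + k ^ 2 * B - k * ψ * (F - A)
          = (ψ * (F - A) - 2 * B * k) ^ 2 / (4 * B) := by field_simp; ring
      have : 0 ≤ (ψ * (F - A) - 2 * B * k) ^ 2 / (4 * B) := by positivity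
      linarith
    linarith
  nlinarith [mul_le_mul_of_nonneg_left hq (sq_nonneg ψ)]

/-- Integrated cut-off estimate. -/
theorem cutoff_integral {L M B ε : ℝ} {F A d q r ηt : ℝ → ℝ} (hL : 0 < L) (hB : 0 < B)
    (hε : 0 < ε) (cηt : Continuous ηt) (cq : Continuous q) (cd : Continuous d) (cr : Continuous r)
    (hF : ∀ x, HasDerivAt F (ηt x + q x) x) (hq : ∀ x, d x / 2 - r x ≤ q x)
    (hJ : ∀ x, (F x - A x) ^ 2 ≤ B * d x) (hA : ∀ x, |A x| ≤ B)
    (hA' : ∀ x, M ≤ |x| → |A x| ≤ ε) :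
    ∫ x in (-L)..L, cutoff L x * ηt x ≤
      -(1 / 4) * (∫ x in (-L)..L, cutoff L x * d x) + (∫ x in (-L)..L, cutoff L x * r x)
        + (8 * ε + (16 * B * (1 + M ^ 2) + 32 * B) / L) := by
  have cF : Continuous F := continuous_iff_continuousAt.2 fun x => (hF x).continuousAt
  have hA2 : ∀ x, |A x| ≤ ε + B * (1 + M ^ 2) * (1 + x ^ 2)⁻¹ := by
    intro x
    have h0 : (0:ℝ) < 1 + x ^ 2 := by positivity
    rcases le_or_gt M |x| with h | h
    · have : 0 ≤ B * (1 + M ^ 2) * (1 + x ^ 2)⁻¹ := by positivity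
      linarith [hA' x h]
    · have hx : x ^ 2 ≤ M ^ 2 := by
        rw [← sq_abs]; exact pow_le_pow_left₀ (abs_nonneg _) h.le 2
      have : 1 ≤ (1 + M ^ 2) * (1 + x ^ 2)⁻¹ := by
        rw [← div_eq_mul_inv, le_div_iff₀ h0]; linarith
      nlinarith [hA x]
  have c1 : Continuous fun x : ℝ => (1 + x ^ 2)⁻¹ :=
    Continuous.inv₀ (by fun_prop) fun x => by positivity
  have key : ∫ x in (-L)..L, cutoff L x * ηt x ≤ ∫ x in (-L)..L,
      ((-(4 * x / L ^ 2) * (1 - (x / L) ^ 2) * F x + cutoff L x * (ηt x + q x))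
      + (-(1 / 4) * (cutoff L x * d x) + cutoff L x * r x
        + (4 / L * (ε + B * (1 + M ^ 2) * (1 + x ^ 2)⁻¹) + 16 * B / L ^ 2))) := by
    refine integral_mono_of_continuous (by linarith) (by fun_prop) (by fun_prop) fun x hx => ?_
    have := cutoff_pointwise hL hx hB (hA2 x) (hJ x) (hq x) (ηt := ηt x)
    linarith
  rw [integral_add_of_continuous
      (f := fun x => -(4 * x / L ^ 2) * (1 - (x / L) ^ 2) * F x + cutoff L x * (ηt x + q x))
      (by fun_prop) (by fun_prop),
    integral_add_of_continuous (f := fun x => -(1 / 4) * (cutoff L x * d x) + cutoff L x * r x)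
      (by fun_prop) (by fun_prop),
    integral_add_of_continuous (f := fun x => -(1 / 4) * (cutoff L x * d x))
      (by fun_prop) (by fun_prop),
    intervalIntegral.integral_const_mul,
    intervalIntegral.integral_eq_sub_of_hasDerivAt
      (fun x _ => (hasDerivAt_cutoff (L := L) x).mul (hF x))
      (Continuous.intervalIntegrable (by fun_prop) _ _)] at key
  have e1 : cutoff L L = 0 := by unfold cutoff; field_simp; ring
  have e2 : cutoff L (-L) = 0 := by unfold cutoff; field_simp; ring
  have e3 : ∫ x in (-L)..L, (4 / L * (ε + B * (1 + M ^ 2) * (1 + x ^ 2)⁻¹) + 16 * B / L ^ 2)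
      ≤ 8 * ε + (16 * B * (1 + M ^ 2) + 32 * B) / L := by
    have i1 : ∫ x in (-L)..L, (1 + x ^ 2)⁻¹ ≤ 4 := by
      rw [integral_inv_one_add_sq]
      have := Real.arctan_lt_pi_div_two L
      have := Real.neg_pi_div_two_lt_arctan (-L)
      have := Real.pi_lt_d2
      linarith
    rw [intervalIntegral.integral_add (Continuous.intervalIntegrable (by fun_prop) _ _)
      (Continuous.intervalIntegrable (by fun_prop) _ _), intervalIntegral.integral_const_mul,
      intervalIntegral.integral_add (Continuous.intervalIntegrable (by fun_prop) _ _)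
      (Continuous.intervalIntegrable (by fun_prop) _ _), intervalIntegral.integral_const_mul,
      intervalIntegral.integral_const, intervalIntegral.integral_const]
    simp only [smul_eq_mul]
    have : 4 / L * (B * (1 + M ^ 2) * ∫ x in (-L)..L, (1 + x ^ 2)⁻¹)
        ≤ 4 / L * (B * (1 + M ^ 2) * 4) := by gcongr
    have e : 8 * ε + (16 * B * (1 + M ^ 2) + 32 * B) / L = 4 / L * ((L - -L) * ε)
      + 4 / L * (B * (1 + M ^ 2) * 4) + (L - -L) * (16 * B / L ^ 2) := by
      field_simp; ring
    rw [e, mul_add]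
    linarith
  simp only [Pi.mul_apply, e1, e2] at key
  linarith

/-- Abstract energy estimate on the line, for an energy density `η` with flux `F = A + J`,
dissipation `d` and remainder `r`, where `A` vanishes at infinity and `J` is controlled by `d`. -/
theorem energy_bound {T : ℝ} (hT : 0 < T) {η ηt F A d q r : ℝ → ℝ → ℝ}
    (cη : Continuous (Function.uncurry η)) (cηt : Continuous (Function.uncurry ηt))
    (cq : Continuous (Function.uncurry q)) (cd : Continuous (Function.uncurry d))
    (cr : Continuous (Function.uncurry r))
    (hη : ∀ x, ∀ t ∈ Icc (0:ℝ) T, HasDerivWithinAt (fun s => η x s) (ηt x t) (Icc 0 T) t)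
    (hF : ∀ x t, HasDerivAt (fun y => F y t) (ηt x t + q x t) x)
    (hq : ∀ x t, d x t / 2 - r x t ≤ q x t) (hη0 : ∀ x t, 0 ≤ η x t) (hd0 : ∀ x t, 0 ≤ d x t)
    (hJ : ∃ B, ∀ x t, (F x t - A x t) ^ 2 ≤ B * d x t) (hA : ∃ B, ∀ x t, |A x t| ≤ B)
    (hA' : ∀ ε > 0, ∃ M, ∀ x t, M ≤ |x| → |A x t| ≤ ε) {E₀ Cr : ℝ} (hCr : 0 ≤ Cr)
    (hE₀ : ∀ R, 0 ≤ R → ∫ x in (-R)..R, η x 0 ≤ E₀)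
    (hr : ∃ L₀, ∀ L ≥ L₀, ∀ t ∈ Icc (0:ℝ) T,
      ∫ x in (-L)..L, cutoff L x * r x t ≤ Cr + 1 / 8 * ∫ x in (-L)..L, cutoff L x * d x t)
    {R : ℝ} (hR : 0 ≤ R) :
    (∀ t ∈ Icc (0:ℝ) T, ∫ x in (-R)..R, η x t ≤ 2 * (E₀ + Cr * T + 1)) ∧
      ∫ s in (0:ℝ)..T, ∫ x in (-R)..R, d x s ≤ 16 * (E₀ + Cr * T + 1) := by
  obtain ⟨B₁, hJ⟩ := hJ
  obtain ⟨B₂, hA⟩ := hA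
  obtain ⟨L₀, hr⟩ := hr
  set B := max (max B₁ B₂) 1
  have hB : 0 < B := lt_of_lt_of_le one_pos (le_max_right _ _)
  have hJ : ∀ x t, (F x t - A x t) ^ 2 ≤ B * d x t := fun x t =>
    (hJ x t).trans (mul_le_mul_of_nonneg_right ((le_max_left _ _).trans (le_max_left _ _))
      (hd0 x t))
  have hA : ∀ x t, |A x t| ≤ B := fun x t =>
    (hA x t).trans ((le_max_right _ _).trans (le_max_left _ _))
  obtain ⟨M, hM⟩ := hA' (1 / (16 * T)) (by positivity)
  set N := 16 * B * (1 + M ^ 2) + 32 * B with hN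
  have hN0 : 0 < N := by positivity
  obtain ⟨L, hLR, hL₀, hL1⟩ : ∃ L, 2 * R ≤ L ∧ L₀ ≤ L ∧ 2 * N * T + 1 ≤ L :=
    ⟨max (2 * R) (max L₀ (2 * N * T + 1)), le_max_left _ _, (le_max_left _ _).trans
      (le_max_right _ _), (le_max_right _ _).trans (le_max_right _ _)⟩
  have hL : 0 < L := by nlinarith [mul_pos hN0 hT]
  have hNL : N / L ≤ 1 / (2 * T) := by
    rw [div_le_div_iff₀ hL (by positivity)]; nlinarith
  have main : ∀ t ∈ Icc (0:ℝ) T, (∫ x in (-L)..L, cutoff L x * η x t)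
      + 1 / 8 * (∫ s in (0:ℝ)..t, ∫ x in (-L)..L, cutoff L x * d x s) ≤ E₀ + Cr * T + 1 := by
    intro t ht
    have h1 := integral_sub_integral_zero (a := -L) (b := L) (f := fun x t => cutoff L x * η x t)
      (ft := fun x t => cutoff L x * ηt x t) (T := T) (by fun_prop) (by fun_prop)
      (fun x t ht => (hη x t ht).const_mul _) ht
    have h2 : ∫ s in (0:ℝ)..t, ∫ x in (-L)..L, cutoff L x * ηt x s ≤
        ∫ s in (0:ℝ)..t, (-(1 / 8) * (∫ x in (-L)..L, cutoff L x * d x s) + (Cr + 1 / T)) := by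
      refine integral_mono_of_continuous ht.1 (by fun_prop) (by fun_prop) fun s hs => ?_
      have hs' : s ∈ Icc (0:ℝ) T := ⟨hs.1, hs.2.trans ht.2⟩
      have h3 := cutoff_integral (L := L) (F := fun x => F x s) (A := fun x => A x s)
        (d := fun x => d x s) (q := fun x => q x s) (r := fun x => r x s) (ηt := fun x => ηt x s)
        (M := M) (B := B) (ε := 1 / (16 * T)) hL hB (by positivity) (by fun_prop) (by fun_prop)
        (by fun_prop) (by fun_prop)
        (fun x => hF x s) (fun x => hq x s) (fun x => hJ x s) (fun x => hA x s)
        (fun x hx => hM x s hx)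
      have h4 := hr L hL₀ s hs'
      have h5 : 8 * (1 / (16 * T)) + 1 / (2 * T) = 1 / T := by field_simp; norm_num
      linarith
    rw [intervalIntegral.integral_add (Continuous.intervalIntegrable (by fun_prop) _ _)
      (Continuous.intervalIntegrable (by fun_prop) _ _), intervalIntegral.integral_const_mul,
      intervalIntegral.integral_const, smul_eq_mul] at h2
    have h6 : ∫ x in (-L)..L, cutoff L x * η x 0 ≤ E₀ := by
      refine le_trans (integral_mono_of_continuous (by linarith) (by fun_prop) (by fun_prop)
        fun x hx => ?_) (hE₀ L hL.le)
      exact mul_le_of_le_one_left (hη0 x 0) (cutoff_le_one hL hx)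
    have h7 : (t - 0) * (Cr + 1 / T) ≤ Cr * T + 1 := by
      calc (t - 0) * (Cr + 1 / T) ≤ T * (Cr + 1 / T) := by
            apply mul_le_mul_of_nonneg_right (by linarith [ht.2]) (by positivity)
        _ = _ := by field_simp
    linarith
  have hdn : ∀ s, 0 ≤ ∫ x in (-L)..L, cutoff L x * d x s := fun s =>
    intervalIntegral.integral_nonneg (by linarith) fun x _ =>
      mul_nonneg (cutoff_nonneg L x) (hd0 x s)
  constructor
  · intro t ht
    have h1 := integral_le_two_mul_cutoff (f := fun x => η x t) hR hL hLR (by fun_prop)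
      fun x => hη0 x t
    have h2 : 0 ≤ ∫ s in (0:ℝ)..t, ∫ x in (-L)..L, cutoff L x * d x s :=
      intervalIntegral.integral_nonneg ht.1 fun s _ => hdn s
    linarith [main t ht]
  · have h1 : ∫ s in (0:ℝ)..T, ∫ x in (-R)..R, d x s ≤
        ∫ s in (0:ℝ)..T, 2 * ∫ x in (-L)..L, cutoff L x * d x s :=
      integral_mono_of_continuous hT.le (by fun_prop) (by fun_prop) fun s _ =>
        integral_le_two_mul_cutoff (f := fun x => d x s) hR hL hLR (by fun_prop)
          fun x => hd0 x s
    rw [intervalIntegral.integral_const_mul] at h1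
    have h2 : 0 ≤ ∫ x in (-L)..L, cutoff L x * η x T :=
      intervalIntegral.integral_nonneg (by linarith) fun x _ =>
        mul_nonneg (cutoff_nonneg L x) (hη0 x T)
    linarith [main T ⟨hT.le, le_rfl⟩]

end Calculus

/-- A solution of the system in scalar components, extended continuously to all times, together
with its first derivatives. -/
structure MHDFlow (α β T : ℝ) where
  (v u θ w₁ w₂ b₁ b₂ : ℝ → ℝ → ℝ)
  (ux θx w₁x w₂x b₁x b₂x : ℝ → ℝ → ℝ)
  (ut θt w₁t w₂t b₁t b₂t : ℝ → ℝ → ℝ)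
  cont_v : Continuous (Function.uncurry v)
  cont_u : Continuous (Function.uncurry u)
  cont_θ : Continuous (Function.uncurry θ)
  cont_w₁ : Continuous (Function.uncurry w₁)
  cont_w₂ : Continuous (Function.uncurry w₂)
  cont_b₁ : Continuous (Function.uncurry b₁)
  cont_b₂ : Continuous (Function.uncurry b₂)
  cont_ux : Continuous (Function.uncurry ux)
  cont_θx : Continuous (Function.uncurry θx)
  cont_w₁x : Continuous (Function.uncurry w₁x)
  cont_w₂x : Continuous (Function.uncurry w₂x)
  cont_b₁x : Continuous (Function.uncurry b₁x)
  cont_b₂x : Continuous (Function.uncurry b₂x)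
  cont_ut : Continuous (Function.uncurry ut)
  cont_θt : Continuous (Function.uncurry θt)
  cont_w₁t : Continuous (Function.uncurry w₁t)
  cont_w₂t : Continuous (Function.uncurry w₂t)
  cont_b₁t : Continuous (Function.uncurry b₁t)
  cont_b₂t : Continuous (Function.uncurry b₂t)
  deriv_u : ∀ x t, HasDerivAt (fun y => u y t) (ux x t) x
  deriv_θ : ∀ x t, HasDerivAt (fun y => θ y t) (θx x t) x
  deriv_w₁ : ∀ x t, HasDerivAt (fun y => w₁ y t) (w₁x x t) x
  deriv_w₂ : ∀ x t, HasDerivAt (fun y => w₂ y t) (w₂x x t) x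
  deriv_b₁ : ∀ x t, HasDerivAt (fun y => b₁ y t) (b₁x x t) x
  deriv_b₂ : ∀ x t, HasDerivAt (fun y => b₂ y t) (b₂x x t) x
  time_v : ∀ x, ∀ t ∈ Icc (0:ℝ) T, HasDerivWithinAt (fun s => v x s) (ux x t) (Icc 0 T) t
  time_u : ∀ x, ∀ t ∈ Icc (0:ℝ) T, HasDerivWithinAt (fun s => u x s) (ut x t) (Icc 0 T) t
  time_θ : ∀ x, ∀ t ∈ Icc (0:ℝ) T, HasDerivWithinAt (fun s => θ x s) (θt x t) (Icc 0 T) t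
  time_w₁ : ∀ x, ∀ t ∈ Icc (0:ℝ) T, HasDerivWithinAt (fun s => w₁ x s) (w₁t x t) (Icc 0 T) t
  time_w₂ : ∀ x, ∀ t ∈ Icc (0:ℝ) T, HasDerivWithinAt (fun s => w₂ x s) (w₂t x t) (Icc 0 T) t
  time_b₁ : ∀ x, ∀ t ∈ Icc (0:ℝ) T, HasDerivWithinAt (fun s => b₁ x s) (b₁t x t) (Icc 0 T) t
  time_b₂ : ∀ x, ∀ t ∈ Icc (0:ℝ) T, HasDerivWithinAt (fun s => b₂ x s) (b₂t x t) (Icc 0 T) t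
  momentum : ∀ x t, HasDerivAt (fun y => visc α (v y t) * ux y t / v y t
    - (θ y t / v y t + (b₁ y t ^ 2 + b₂ y t ^ 2) / 2)) (ut x t) x
  flux_w₁ : ∀ x t, HasDerivAt (fun y => w₁x y t / v y t) (w₁t x t - b₁x x t) x
  flux_w₂ : ∀ x t, HasDerivAt (fun y => w₂x y t / v y t) (w₂t x t - b₂x x t) x
  flux_b₁ : ∀ x t, HasDerivAt (fun y => b₁x y t / v y t)
    (ux x t * b₁ x t + v x t * b₁t x t - w₁x x t) x
  flux_b₂ : ∀ x t, HasDerivAt (fun y => b₂x y t / v y t)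
    (ux x t * b₂ x t + v x t * b₂t x t - w₂x x t) x
  heat : ∀ x t, HasDerivAt (fun y => θ y t ^ β * θx y t / v y t)
    (θt x t + θ x t / v x t * ux x t - (visc α (v x t) * ux x t ^ 2
      + (w₁x x t ^ 2 + w₂x x t ^ 2) + (b₁x x t ^ 2 + b₂x x t ^ 2)) / v x t) x
  lower : ∃ m > 0, ∀ x t, m ≤ v x t ∧ m ≤ θ x t
  upper : ∃ B, ∀ x t, v x t ≤ B ∧ θ x t ≤ B ∧ |u x t| ≤ B ∧ |w₁ x t| ≤ B ∧ |w₂ x t| ≤ B ∧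
    |b₁ x t| ≤ B ∧ |b₂ x t| ≤ B
  far : ∀ ε > 0, ∃ M, ∀ x t, M ≤ |x| → |θ x t - 1| < ε ∧ |u x t| < ε ∧ |w₁ x t| < ε ∧
    |w₂ x t| < ε ∧ |b₁ x t| < ε ∧ |b₂ x t| < ε

namespace MHDFlow

variable {α β T : ℝ} (s : MHDFlow α β T)

@[fun_prop]
theorem continuous_v {X : Type*} [TopologicalSpace X] {f g : X → ℝ} (hf : Continuous f)
    (hg : Continuous g) : Continuous fun z => s.v (f z) (g z) :=
  s.cont_v.comp (hf.prodMk hg)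

@[fun_prop]
theorem continuous_u {X : Type*} [TopologicalSpace X] {f g : X → ℝ} (hf : Continuous f)
    (hg : Continuous g) : Continuous fun z => s.u (f z) (g z) :=
  s.cont_u.comp (hf.prodMk hg)

@[fun_prop]
theorem continuous_θ {X : Type*} [TopologicalSpace X] {f g : X → ℝ} (hf : Continuous f)
    (hg : Continuous g) : Continuous fun z => s.θ (f z) (g z) :=
  s.cont_θ.comp (hf.prodMk hg)

@[fun_prop]
theorem continuous_w₁ {X : Type*} [TopologicalSpace X] {f g : X → ℝ} (hf : Continuous f)
    (hg : Continuous g) : Continuous fun z => s.w₁ (f z) (g z) :=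
  s.cont_w₁.comp (hf.prodMk hg)

@[fun_prop]
theorem continuous_w₂ {X : Type*} [TopologicalSpace X] {f g : X → ℝ} (hf : Continuous f)
    (hg : Continuous g) : Continuous fun z => s.w₂ (f z) (g z) :=
  s.cont_w₂.comp (hf.prodMk hg)

@[fun_prop]
theorem continuous_b₁ {X : Type*} [TopologicalSpace X] {f g : X → ℝ} (hf : Continuous f)
    (hg : Continuous g) : Continuous fun z => s.b₁ (f z) (g z) :=
  s.cont_b₁.comp (hf.prodMk hg)

@[fun_prop]
theorem continuous_b₂ {X : Type*} [TopologicalSpace X] {f g : X → ℝ} (hf : Continuous f)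
    (hg : Continuous g) : Continuous fun z => s.b₂ (f z) (g z) :=
  s.cont_b₂.comp (hf.prodMk hg)

@[fun_prop]
theorem continuous_ux {X : Type*} [TopologicalSpace X] {f g : X → ℝ} (hf : Continuous f)
    (hg : Continuous g) : Continuous fun z => s.ux (f z) (g z) :=
  s.cont_ux.comp (hf.prodMk hg)

@[fun_prop]
theorem continuous_θx {X : Type*} [TopologicalSpace X] {f g : X → ℝ} (hf : Continuous f)
    (hg : Continuous g) : Continuous fun z => s.θx (f z) (g z) :=
  s.cont_θx.comp (hf.prodMk hg)

@[fun_prop]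
theorem continuous_w₁x {X : Type*} [TopologicalSpace X] {f g : X → ℝ} (hf : Continuous f)
    (hg : Continuous g) : Continuous fun z => s.w₁x (f z) (g z) :=
  s.cont_w₁x.comp (hf.prodMk hg)

@[fun_prop]
theorem continuous_w₂x {X : Type*} [TopologicalSpace X] {f g : X → ℝ} (hf : Continuous f)
    (hg : Continuous g) : Continuous fun z => s.w₂x (f z) (g z) :=
  s.cont_w₂x.comp (hf.prodMk hg)

@[fun_prop]
theorem continuous_b₁x {X : Type*} [TopologicalSpace X] {f g : X → ℝ} (hf : Continuous f)
    (hg : Continuous g) : Continuous fun z => s.b₁x (f z) (g z) :=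
  s.cont_b₁x.comp (hf.prodMk hg)

@[fun_prop]
theorem continuous_b₂x {X : Type*} [TopologicalSpace X] {f g : X → ℝ} (hf : Continuous f)
    (hg : Continuous g) : Continuous fun z => s.b₂x (f z) (g z) :=
  s.cont_b₂x.comp (hf.prodMk hg)

@[fun_prop]
theorem continuous_ut {X : Type*} [TopologicalSpace X] {f g : X → ℝ} (hf : Continuous f)
    (hg : Continuous g) : Continuous fun z => s.ut (f z) (g z) :=
  s.cont_ut.comp (hf.prodMk hg)

@[fun_prop]
theorem continuous_θt {X : Type*} [TopologicalSpace X] {f g : X → ℝ} (hf : Continuous f)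
    (hg : Continuous g) : Continuous fun z => s.θt (f z) (g z) :=
  s.cont_θt.comp (hf.prodMk hg)

@[fun_prop]
theorem continuous_w₁t {X : Type*} [TopologicalSpace X] {f g : X → ℝ} (hf : Continuous f)
    (hg : Continuous g) : Continuous fun z => s.w₁t (f z) (g z) :=
  s.cont_w₁t.comp (hf.prodMk hg)

@[fun_prop]
theorem continuous_w₂t {X : Type*} [TopologicalSpace X] {f g : X → ℝ} (hf : Continuous f)
    (hg : Continuous g) : Continuous fun z => s.w₂t (f z) (g z) :=
  s.cont_w₂t.comp (hf.prodMk hg)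

@[fun_prop]
theorem continuous_b₁t {X : Type*} [TopologicalSpace X] {f g : X → ℝ} (hf : Continuous f)
    (hg : Continuous g) : Continuous fun z => s.b₁t (f z) (g z) :=
  s.cont_b₁t.comp (hf.prodMk hg)

@[fun_prop]
theorem continuous_b₂t {X : Type*} [TopologicalSpace X] {f g : X → ℝ} (hf : Continuous f)
    (hg : Continuous g) : Continuous fun z => s.b₂t (f z) (g z) :=
  s.cont_b₂t.comp (hf.prodMk hg)

theorem v_pos (x t : ℝ) : 0 < s.v x t := by
  obtain ⟨m, hm, h⟩ := s.lower
  exact hm.trans_le (h x t).1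

theorem θ_pos (x t : ℝ) : 0 < s.θ x t := by
  obtain ⟨m, hm, h⟩ := s.lower
  exact hm.trans_le (h x t).2

@[fun_prop]
theorem continuous_rpow_θ (q : ℝ) {X : Type*} [TopologicalSpace X] {f g : X → ℝ}
    (hf : Continuous f) (hg : Continuous g) : Continuous fun z => s.θ (f z) (g z) ^ q :=
  Continuous.rpow_const (by fun_prop) fun z => Or.inl (s.θ_pos _ _).ne'

@[fun_prop]
theorem continuous_rpow_v (q : ℝ) {X : Type*} [TopologicalSpace X] {f g : X → ℝ}
    (hf : Continuous f) (hg : Continuous g) : Continuous fun z => s.v (f z) (g z) ^ q :=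
  Continuous.rpow_const (by fun_prop) fun z => Or.inl (s.v_pos _ _).ne'

@[fun_prop]
theorem continuous_inv_v {X : Type*} [TopologicalSpace X] {f g : X → ℝ}
    (hf : Continuous f) (hg : Continuous g) : Continuous fun z => (s.v (f z) (g z))⁻¹ :=
  Continuous.inv₀ (by fun_prop) fun z => (s.v_pos _ _).ne'

@[fun_prop]
theorem continuous_log_v {X : Type*} [TopologicalSpace X] {f g : X → ℝ}
    (hf : Continuous f) (hg : Continuous g) : Continuous fun z => Real.log (s.v (f z) (g z)) :=
  Continuous.log (by fun_prop) fun z => (s.v_pos _ _).ne'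

@[fun_prop]
theorem continuous_div_v {X : Type*} [TopologicalSpace X] {f g h : X → ℝ}
    (hf : Continuous f) (hg : Continuous g) (hh : Continuous h) :
    Continuous fun z => h z / s.v (f z) (g z) :=
  Continuous.div hh (by fun_prop) fun z => (s.v_pos _ _).ne'

/-- The squared norm of the magnetic field. -/
def S (x t : ℝ) : ℝ := s.b₁ x t ^ 2 + s.b₂ x t ^ 2

/-- The total dissipation in the temperature equation. -/
def D (x t : ℝ) : ℝ := (visc α (s.v x t) * s.ux x t ^ 2
      + (s.w₁x x t ^ 2 + s.w₂x x t ^ 2) + (s.b₁x x t ^ 2 + s.b₂x x t ^ 2)) / s.v x t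

/-- The dissipation rate of the energy with weight `θ ^ (-p)`. -/
def diss (p x t : ℝ) : ℝ := s.θ x t ^ (-p) * s.D x t
  + p * (s.θ x t ^ (-p - 1) * s.θ x t ^ β) * s.θx x t ^ 2 / s.v x t

/-- The remainder in the energy estimate with weight `θ ^ (-p)`. -/
def rem (p x t : ℝ) : ℝ :=
  1 / 2 * s.θ x t ^ p * (s.θ x t * s.θ x t ^ (-p) - 1) ^ 2 / s.v x t

/-- The energy density for a thermal energy function `G`. -/
def energy (G : ℝ → ℝ) (x t : ℝ) : ℝ := G (s.θ x t) + (s.v x t - Real.log (s.v x t) - 1)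
  + (s.u x t ^ 2 + (s.w₁ x t ^ 2 + s.w₂ x t ^ 2) + s.v x t * s.S x t) / 2

@[fun_prop]
theorem continuous_S {X : Type*} [TopologicalSpace X] {f g : X → ℝ} (hf : Continuous f)
    (hg : Continuous g) : Continuous fun z => s.S (f z) (g z) := by
  unfold S
  fun_prop

@[fun_prop]
theorem continuous_D {X : Type*} [TopologicalSpace X] {f g : X → ℝ} (hf : Continuous f)
    (hg : Continuous g) : Continuous fun z => s.D (f z) (g z) := by
  unfold D visc
  fun_prop

@[fun_prop]
theorem continuous_diss (p : ℝ) {X : Type*} [TopologicalSpace X] {f g : X → ℝ} (hf : Continuous f)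
    (hg : Continuous g) : Continuous fun z => s.diss p (f z) (g z) := by
  unfold diss
  fun_prop

@[fun_prop]
theorem continuous_rem (p : ℝ) {X : Type*} [TopologicalSpace X] {f g : X → ℝ} (hf : Continuous f)
    (hg : Continuous g) : Continuous fun z => s.rem p (f z) (g z) := by
  unfold rem
  fun_prop

end MHDFlow

section Bounded

/-- Boundedness of a function of two variables. -/
def Bdd (f : ℝ → ℝ → ℝ) : Prop := ∃ B, ∀ x t, |f x t| ≤ B

/-- Decay at spatial infinity, uniformly in the second variable. -/
def Decays (f : ℝ → ℝ → ℝ) : Prop := ∀ ε > 0, ∃ M, ∀ x t, M ≤ |x| → |f x t| ≤ ε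

variable {f g : ℝ → ℝ → ℝ}

theorem Bdd.add (hf : Bdd f) (hg : Bdd g) : Bdd fun x t => f x t + g x t := by
  obtain ⟨A, hA⟩ := hf
  obtain ⟨B, hB⟩ := hg
  exact ⟨A + B, fun x t => (abs_add_le _ _).trans (add_le_add (hA x t) (hB x t))⟩

theorem Bdd.neg (hf : Bdd f) : Bdd fun x t => -f x t := by
  obtain ⟨A, hA⟩ := hf
  exact ⟨A, fun x t => by rw [abs_neg]; exact hA x t⟩

theorem Bdd.sub (hf : Bdd f) (hg : Bdd g) : Bdd fun x t => f x t - g x t := by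
  simpa only [sub_eq_add_neg] using hf.add hg.neg

theorem Bdd.mul (hf : Bdd f) (hg : Bdd g) : Bdd fun x t => f x t * g x t := by
  obtain ⟨A, hA⟩ := hf
  obtain ⟨B, hB⟩ := hg
  refine ⟨A * B, fun x t => ?_⟩
  rw [abs_mul]
  exact mul_le_mul (hA x t) (hB x t) (abs_nonneg _) ((abs_nonneg _).trans (hA x t))

theorem bdd_const (c : ℝ) : Bdd fun _ _ => c := ⟨|c|, fun _ _ => le_rfl⟩

theorem Decays.add (hf : Decays f) (hg : Decays g) : Decays fun x t => f x t + g x t := by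
  intro ε hε
  obtain ⟨A, hA⟩ := hf (ε / 2) (by positivity)
  obtain ⟨B, hB⟩ := hg (ε / 2) (by positivity)
  refine ⟨max A B, fun x t hx => (abs_add_le _ _).trans ?_⟩
  linarith [hA x t ((le_max_left _ _).trans hx), hB x t ((le_max_right _ _).trans hx)]

theorem Decays.mul_bdd (hf : Decays f) (hg : Bdd g) : Decays fun x t => f x t * g x t := by
  intro ε hε
  obtain ⟨B, hB⟩ := hg
  have hB0 : 0 ≤ B := (abs_nonneg _).trans (hB 0 0)
  obtain ⟨A, hA⟩ := hf (ε / (B + 1)) (by positivity)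
  refine ⟨A, fun x t hx => ?_⟩
  rw [abs_mul]
  calc |f x t| * |g x t| ≤ ε / (B + 1) * B :=
        mul_le_mul (hA x t hx) (hB x t) (abs_nonneg _) (by positivity)
    _ ≤ ε := by rw [div_mul_eq_mul_div, div_le_iff₀ (by positivity)]; nlinarith

theorem Decays.mono (hf : Decays f) (h : ∀ x t, |g x t| ≤ |f x t|) : Decays g := by
  intro ε hε
  obtain ⟨M, hM⟩ := hf ε hε
  exact ⟨M, fun x t hx => (h x t).trans (hM x t hx)⟩

theorem bdd_rpow {m B : ℝ} (hm : 0 < m) (h : ∀ x t, m ≤ f x t ∧ f x t ≤ B) (q : ℝ) :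
    Bdd fun x t => f x t ^ q := by
  have hc : ContinuousOn (fun z : ℝ => z ^ q) (Icc m B) := fun z hz =>
    (Real.continuousAt_rpow_const _ _ (Or.inl (hm.trans_le hz.1).ne')).continuousWithinAt
  obtain ⟨C, hC⟩ := isCompact_Icc.exists_bound_of_continuousOn hc
  exact ⟨C, fun x t => hC _ (h x t)⟩

end Bounded

namespace MHDFlow

variable {α β T : ℝ} (s : MHDFlow α β T)

theorem bdd_rpow_θ (q : ℝ) : Bdd fun x t => s.θ x t ^ q := by
  obtain ⟨m, hm, h⟩ := s.lower
  obtain ⟨B, hB⟩ := s.upper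
  exact bdd_rpow hm (fun x t => ⟨(h x t).2, (hB x t).2.1⟩) q

theorem bdd_rpow_v (q : ℝ) : Bdd fun x t => s.v x t ^ q := by
  obtain ⟨m, hm, h⟩ := s.lower
  obtain ⟨B, hB⟩ := s.upper
  exact bdd_rpow hm (fun x t => ⟨(h x t).1, (hB x t).1⟩) q

theorem bdd_θ : Bdd s.θ := by simpa using s.bdd_rpow_θ 1

theorem bdd_inv_v : Bdd fun x t => (s.v x t)⁻¹ := by
  simpa [Real.rpow_neg_one] using s.bdd_rpow_v (-1)

theorem bdd_visc : Bdd fun x t => visc α (s.v x t) :=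
  (bdd_const 1).add ((bdd_const α).mul (s.bdd_rpow_v (-α)))

theorem bdd_u : Bdd s.u := by
  obtain ⟨B, hB⟩ := s.upper
  exact ⟨B, fun x t => (hB x t).2.2.1⟩

theorem bdd_w₁ : Bdd s.w₁ := by
  obtain ⟨B, hB⟩ := s.upper
  exact ⟨B, fun x t => (hB x t).2.2.2.1⟩

theorem bdd_w₂ : Bdd s.w₂ := by
  obtain ⟨B, hB⟩ := s.upper
  exact ⟨B, fun x t => (hB x t).2.2.2.2.1⟩

theorem bdd_b₁ : Bdd s.b₁ := by
  obtain ⟨B, hB⟩ := s.upper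
  exact ⟨B, fun x t => (hB x t).2.2.2.2.2.1⟩

theorem bdd_b₂ : Bdd s.b₂ := by
  obtain ⟨B, hB⟩ := s.upper
  exact ⟨B, fun x t => (hB x t).2.2.2.2.2.2⟩

theorem bdd_S : Bdd s.S := by
  change Bdd fun x t => s.S x t
  simpa only [S, sq] using (s.bdd_b₁.mul s.bdd_b₁).add (s.bdd_b₂.mul s.bdd_b₂)

theorem decays_u : Decays s.u := fun ε hε => by
  obtain ⟨M, hM⟩ := s.far ε hε
  exact ⟨M, fun x t hx => (hM x t hx).2.1.le⟩

theorem decays_w₁ : Decays s.w₁ := fun ε hε => by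
  obtain ⟨M, hM⟩ := s.far ε hε
  exact ⟨M, fun x t hx => (hM x t hx).2.2.1.le⟩

theorem decays_w₂ : Decays s.w₂ := fun ε hε => by
  obtain ⟨M, hM⟩ := s.far ε hε
  exact ⟨M, fun x t hx => (hM x t hx).2.2.2.1.le⟩

theorem decays_b₁ : Decays s.b₁ := fun ε hε => by
  obtain ⟨M, hM⟩ := s.far ε hε
  exact ⟨M, fun x t hx => (hM x t hx).2.2.2.2.1.le⟩

theorem decays_b₂ : Decays s.b₂ := fun ε hε => by
  obtain ⟨M, hM⟩ := s.far ε hε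
  exact ⟨M, fun x t hx => (hM x t hx).2.2.2.2.2.le⟩

theorem decays_S : Decays s.S := by
  change Decays fun x t => s.S x t
  simpa only [S, sq] using (s.decays_b₁.mul_bdd s.bdd_b₁).add (s.decays_b₂.mul_bdd s.bdd_b₂)

theorem S_nonneg (x t : ℝ) : 0 ≤ s.S x t := by unfold S; positivity

theorem one_le_visc (hα : 0 ≤ α) (x t : ℝ) : 1 ≤ visc α (s.v x t) := by
  have := Real.rpow_nonneg (s.v_pos x t).le (-α)
  unfold visc
  nlinarith

theorem diss_nonneg (hα : 0 ≤ α) {p : ℝ} (hp : 0 ≤ p) (x t : ℝ) : 0 ≤ s.diss p x t := by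
  have hv := s.v_pos x t
  have hθ := s.θ_pos x t
  have := s.one_le_visc hα x t
  have : 0 ≤ visc α (s.v x t) := by linarith
  unfold diss D
  positivity

theorem rem_nonneg (p x t : ℝ) : 0 ≤ s.rem p x t := by
  have hv := s.v_pos x t
  have hθ := s.θ_pos x t
  unfold rem
  positivity

/-- The diffusive part of the energy flux. -/
def diffFlux (p x t : ℝ) : ℝ := (1 - s.θ x t ^ (-p)) * (s.θ x t ^ β * s.θx x t / s.v x t)
  + s.u x t * (visc α (s.v x t) * s.ux x t / s.v x t)
  + (s.w₁ x t * (s.w₁x x t / s.v x t) + s.b₁ x t * (s.b₁x x t / s.v x t))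
  + (s.w₂ x t * (s.w₂x x t / s.v x t) + s.b₂ x t * (s.b₂x x t / s.v x t))

set_option maxHeartbeats 1000000 in
theorem diffFlux_sq_le (hα : 0 ≤ α) {p : ℝ} (hp : 0 < p) :
    ∃ B, ∀ x t, s.diffFlux p x t ^ 2 ≤ B * s.diss p x t := by
  have e0 : Bdd fun x t => (1 - s.θ x t ^ (-p)) * (1 - s.θ x t ^ (-p)) *
      (s.θ x t ^ (p + 1) * s.θ x t ^ β) * (s.v x t)⁻¹ * p⁻¹ :=
    ((((((bdd_const 1).sub (s.bdd_rpow_θ (-p))).mul ((bdd_const 1).sub (s.bdd_rpow_θ (-p))))).mul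
      ((s.bdd_rpow_θ (p + 1)).mul (s.bdd_rpow_θ β))).mul s.bdd_inv_v).mul (bdd_const _)
  have e1 : Bdd fun x t => s.u x t * s.u x t * (visc α (s.v x t) * s.θ x t ^ p) * (s.v x t)⁻¹ :=
    ((s.bdd_u.mul s.bdd_u).mul (s.bdd_visc.mul (s.bdd_rpow_θ p))).mul s.bdd_inv_v
  have e2 : Bdd fun x t => s.w₁ x t * s.w₁ x t * s.θ x t ^ p * (s.v x t)⁻¹ :=
    ((s.bdd_w₁.mul s.bdd_w₁).mul (s.bdd_rpow_θ p)).mul s.bdd_inv_v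
  have e3 : Bdd fun x t => s.w₂ x t * s.w₂ x t * s.θ x t ^ p * (s.v x t)⁻¹ :=
    ((s.bdd_w₂.mul s.bdd_w₂).mul (s.bdd_rpow_θ p)).mul s.bdd_inv_v
  have e4 : Bdd fun x t => s.b₁ x t * s.b₁ x t * s.θ x t ^ p * (s.v x t)⁻¹ :=
    ((s.bdd_b₁.mul s.bdd_b₁).mul (s.bdd_rpow_θ p)).mul s.bdd_inv_v
  have e5 : Bdd fun x t => s.b₂ x t * s.b₂ x t * s.θ x t ^ p * (s.v x t)⁻¹ :=
    ((s.bdd_b₂.mul s.bdd_b₂).mul (s.bdd_rpow_θ p)).mul s.bdd_inv_v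
  obtain ⟨B0, h0⟩ := e0
  obtain ⟨B1, h1⟩ := e1
  obtain ⟨B2, h2⟩ := e2
  obtain ⟨B3, h3⟩ := e3
  obtain ⟨B4, h4⟩ := e4
  obtain ⟨B5, h5⟩ := e5
  refine ⟨6 * (B0 + B1 + B2 + B3 + B4 + B5), fun x t => ?_⟩
  have k0 := (abs_nonneg _).trans (h0 x t)
  have k1 := (abs_nonneg _).trans (h1 x t)
  have k2 := (abs_nonneg _).trans (h2 x t)
  have k3 := (abs_nonneg _).trans (h3 x t)
  have k4 := (abs_nonneg _).trans (h4 x t)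
  have k5 := (abs_nonneg _).trans (h5 x t)
  replace h0 := (le_abs_self _).trans (h0 x t)
  replace h1 := (le_abs_self _).trans (h1 x t)
  replace h2 := (le_abs_self _).trans (h2 x t)
  replace h3 := (le_abs_self _).trans (h3 x t)
  replace h4 := (le_abs_self _).trans (h4 x t)
  replace h5 := (le_abs_self _).trans (h5 x t)
  have hv := s.v_pos x t
  have hθ := s.θ_pos x t
  beta_reduce at h0 h1 h2 h3 h4 h5
  have hμ : 0 < visc α (s.v x t) := by linarith [s.one_le_visc hα x t]
  have i1 : s.θ x t ^ p * s.θ x t ^ (-p) = 1 := by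
    rw [← Real.rpow_add hθ]; simp
  have i2 : s.θ x t ^ (p + 1) * s.θ x t ^ (-p - 1) = 1 := by
    rw [← Real.rpow_add hθ]; simp
  have q1 := Real.rpow_pos_of_pos hθ (-p)
  have q2 := Real.rpow_pos_of_pos hθ (-p - 1)
  have q3 := Real.rpow_pos_of_pos hθ β
  have q4 := Real.rpow_pos_of_pos hθ p
  have q5 := Real.rpow_pos_of_pos hθ (p + 1)
  unfold diffFlux diss D
  generalize s.θ x t ^ (-p) = P at *
  generalize s.θ x t ^ (-p - 1) = P1 at *
  generalize s.θ x t ^ β = Θ at *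
  generalize s.θ x t ^ p = Q at *
  generalize s.θ x t ^ (p + 1) = Q1 at *
  generalize visc α (s.v x t) = μ at *
  generalize s.v x t = v at *
  generalize s.u x t = u at *
  generalize s.w₁ x t = w₁ at *
  generalize s.w₂ x t = w₂ at *
  generalize s.b₁ x t = b₁ at *
  generalize s.b₂ x t = b₂ at *
  generalize s.ux x t = ux at *
  generalize s.θx x t = θx at *
  generalize s.w₁x x t = w₁x at *
  generalize s.w₂x x t = w₂x at *
  generalize s.b₁x x t = b₁x at *
  generalize s.b₂x x t = b₂x at *
  have m0 := mul_le_mul_of_nonneg_right h0 (by positivity : 0 ≤ p * (P1 * Θ) * θx ^ 2 / v)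
  have m1 := mul_le_mul_of_nonneg_right h1 (by positivity : 0 ≤ P * (μ * ux ^ 2) / v)
  have m2 := mul_le_mul_of_nonneg_right h2 (by positivity : 0 ≤ P * w₁x ^ 2 / v)
  have m3 := mul_le_mul_of_nonneg_right h3 (by positivity : 0 ≤ P * w₂x ^ 2 / v)
  have m4 := mul_le_mul_of_nonneg_right h4 (by positivity : 0 ≤ P * b₁x ^ 2 / v)
  have m5 := mul_le_mul_of_nonneg_right h5 (by positivity : 0 ≤ P * b₂x ^ 2 / v)
  have n0 : (1 - P) * (1 - P) * (Q1 * Θ) * v⁻¹ * p⁻¹ * (p * (P1 * Θ) * θx ^ 2 / v)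
      = ((1 - P) * (Θ * θx / v)) ^ 2 := by
    calc _ = (p * p⁻¹) * (Q1 * P1) * ((1 - P) * (Θ * θx / v)) ^ 2 := by ring
      _ = _ := by rw [i2, mul_inv_cancel₀ hp.ne']; ring
  have n1 : u * u * (μ * Q) * v⁻¹ * (P * (μ * ux ^ 2) / v) = (u * (μ * ux / v)) ^ 2 := by
    calc _ = (Q * P) * (u * (μ * ux / v)) ^ 2 := by ring
      _ = _ := by rw [i1]; ring
  have n : ∀ w wx : ℝ, w * w * Q * v⁻¹ * (P * wx ^ 2 / v) = (w * (wx / v)) ^ 2 := fun w wx => by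
    calc _ = (Q * P) * (w * (wx / v)) ^ 2 := by ring
      _ = _ := by rw [i1]; ring
  rw [n0] at m0
  rw [n1] at m1
  rw [n] at m2 m3 m4 m5
  have six : ∀ a b c d e f : ℝ, (a + b + (c + d) + (e + f)) ^ 2 ≤
      6 * (a ^ 2 + b ^ 2 + c ^ 2 + d ^ 2 + e ^ 2 + f ^ 2) := fun a b c d e f => by
    nlinarith [sq_nonneg (a - b), sq_nonneg (a - c), sq_nonneg (a - d), sq_nonneg (a - e),
      sq_nonneg (a - f), sq_nonneg (b - c), sq_nonneg (b - d), sq_nonneg (b - e),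
      sq_nonneg (b - f), sq_nonneg (c - d), sq_nonneg (c - e), sq_nonneg (c - f),
      sq_nonneg (d - e), sq_nonneg (d - f), sq_nonneg (e - f)]
  refine (six _ _ _ _ _ _).trans ?_
  have d1 : P * ((μ * ux ^ 2 + (w₁x ^ 2 + w₂x ^ 2) + (b₁x ^ 2 + b₂x ^ 2)) / v)
      + p * (P1 * Θ) * θx ^ 2 / v = p * (P1 * Θ) * θx ^ 2 / v + P * (μ * ux ^ 2) / v
      + P * w₁x ^ 2 / v + P * w₂x ^ 2 / v + P * b₁x ^ 2 / v + P * b₂x ^ 2 / v := by ring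
  rw [d1]
  have p0 : 0 ≤ p * (P1 * Θ) * θx ^ 2 / v := by positivity
  have p1 : 0 ≤ P * (μ * ux ^ 2) / v := by positivity
  have p2 : 0 ≤ P * w₁x ^ 2 / v := by positivity
  have p3 : 0 ≤ P * w₂x ^ 2 / v := by positivity
  have p4 : 0 ≤ P * b₁x ^ 2 / v := by positivity
  have p5 : 0 ≤ P * b₂x ^ 2 / v := by positivity
  generalize p * (P1 * Θ) * θx ^ 2 / v = D0 at *
  generalize P * (μ * ux ^ 2) / v = D1 at *
  generalize P * w₁x ^ 2 / v = D2 at *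
  generalize P * w₂x ^ 2 / v = D3 at *
  generalize P * b₁x ^ 2 / v = D4 at *
  generalize P * b₂x ^ 2 / v = D5 at *
  have t0 : B0 * D0 ≤ (B0 + B1 + B2 + B3 + B4 + B5) * D0 := by gcongr; linarith
  have t1 : B1 * D1 ≤ (B0 + B1 + B2 + B3 + B4 + B5) * D1 := by gcongr; linarith
  have t2 : B2 * D2 ≤ (B0 + B1 + B2 + B3 + B4 + B5) * D2 := by gcongr; linarith
  have t3 : B3 * D3 ≤ (B0 + B1 + B2 + B3 + B4 + B5) * D3 := by gcongr; linarith
  have t4 : B4 * D4 ≤ (B0 + B1 + B2 + B3 + B4 + B5) * D4 := by gcongr; linarith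
  have t5 : B5 * D5 ≤ (B0 + B1 + B2 + B3 + B4 + B5) * D5 := by gcongr; linarith
  rw [mul_assoc]
  linarith

theorem continuous_energy {p : ℝ} {G : ℝ → ℝ} (hG : ∀ z > 0, HasDerivAt G (1 - z ^ (-p)) z) :
    Continuous (Function.uncurry (s.energy G)) := by
  have h : Continuous fun z : ℝ × ℝ => G (s.θ z.1 z.2) := by
    refine ContinuousOn.comp_continuous (s := Ioi 0) (fun z hz =>
      (hG z hz).continuousAt.continuousWithinAt) (by fun_prop) fun z => s.θ_pos _ _
  change Continuous fun z : ℝ × ℝ => G (s.θ z.1 z.2) + (s.v z.1 z.2 - Real.log (s.v z.1 z.2) - 1)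
    + (s.u z.1 z.2 ^ 2 + (s.w₁ z.1 z.2 ^ 2 + s.w₂ z.1 z.2 ^ 2) + s.v z.1 z.2 * s.S z.1 z.2) / 2
  refine (h.add ?_).add ?_ <;> fun_prop

/-- Energy estimate with a general thermal energy function. -/
theorem energy_estimate (hα : 0 ≤ α) (hT : 0 < T) {p : ℝ} (hp : 0 < p) {G : ℝ → ℝ}
    (hG : ∀ z > 0, HasDerivAt G (1 - z ^ (-p)) z) (hG0 : ∀ z > 0, 0 ≤ G z) {E₀ Cr : ℝ}
    (hCr : 0 ≤ Cr) (hE₀ : ∀ R, 0 ≤ R → ∫ x in (-R)..R, s.energy G x 0 ≤ E₀)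
    (hr : ∃ L₀, ∀ L ≥ L₀, ∀ t ∈ Icc (0:ℝ) T,
      ∫ x in (-L)..L, cutoff L x * s.rem p x t ≤
        Cr + 1 / 8 * ∫ x in (-L)..L, cutoff L x * s.diss p x t)
    {R : ℝ} (hR : 0 ≤ R) :
    (∀ t ∈ Icc (0:ℝ) T, ∫ x in (-R)..R, s.energy G x t ≤ 2 * (E₀ + Cr * T + 1)) ∧
      ∫ t in (0:ℝ)..T, ∫ x in (-R)..R, s.diss p x t ≤ 16 * (E₀ + Cr * T + 1) := by
  refine energy_bound hT (η := s.energy G)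
    (ηt := fun x t => (1 - s.θ x t ^ (-p)) * s.θt x t + (1 - (s.v x t)⁻¹) * s.ux x t
      + s.u x t * s.ut x t + (s.w₁ x t * s.w₁t x t + s.w₂ x t * s.w₂t x t)
      + 1 / 2 * s.ux x t * s.S x t
      + s.v x t * (s.b₁ x t * s.b₁t x t + s.b₂ x t * s.b₂t x t))
    (F := fun x t => (1 - s.θ x t ^ (-p)) * (s.θ x t ^ β * s.θx x t / s.v x t)
      + s.u x t * (visc α (s.v x t) * s.ux x t / s.v x t
        - (s.θ x t / s.v x t + (s.b₁ x t ^ 2 + s.b₂ x t ^ 2) / 2)) + s.u x t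
      + (s.w₁ x t * (s.w₁x x t / s.v x t) + s.b₁ x t * (s.b₁x x t / s.v x t)
        + s.w₁ x t * s.b₁ x t)
      + (s.w₂ x t * (s.w₂x x t / s.v x t) + s.b₂ x t * (s.b₂x x t / s.v x t)
        + s.w₂ x t * s.b₂ x t))
    (A := fun x t => s.u x t * (1 - s.θ x t * (s.v x t)⁻¹ - s.S x t * (1 / 2))
      + s.w₁ x t * s.b₁ x t + s.w₂ x t * s.b₂ x t)
    (d := s.diss p) (r := s.rem p)
    (q := fun x t => s.diss p x t - (s.θ x t * s.θ x t ^ (-p) - 1) * s.ux x t / s.v x t)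
    (s.continuous_energy hG) ?_ ?_ ?_ ?_ ?_ ?_ ?_ ?_ ?_ ?_ ?_ ?_ hCr hE₀ hr hR
  · unfold Function.uncurry; fun_prop
  · unfold Function.uncurry; fun_prop
  · unfold Function.uncurry; fun_prop
  · unfold Function.uncurry; fun_prop
  · intro x t ht
    have hv := s.v_pos x t
    have h1 := (hG _ (s.θ_pos x t)).comp_hasDerivWithinAt t (s.time_θ x t ht)
    have h2 := s.time_v x t ht
    have h3 := h2.log hv.ne'
    have h4 := (s.time_u x t ht).pow 2
    have h5 := ((s.time_w₁ x t ht).pow 2).add ((s.time_w₂ x t ht).pow 2)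
    have h6 := h2.mul (((s.time_b₁ x t ht).pow 2).add ((s.time_b₂ x t ht).pow 2))
    refine HasDerivWithinAt.congr_deriv ((h1.add ((h2.sub h3).sub_const 1)).add
      (((h4.add h5).add h6).div_const 2)) ?_
    simp only [Pi.add_apply, Pi.pow_apply, S]
    push_cast
    field_simp
    ring
  · intro x t
    have hv := s.v_pos x t
    have hθ := s.θ_pos x t
    have h1 := (((s.deriv_θ x t).rpow_const (p := -p) (Or.inl hθ.ne')).const_sub 1).mul (s.heat x t)
    have h2 := (s.deriv_u x t).mul (s.momentum x t)
    have h3 := (((s.deriv_w₁ x t).mul (s.flux_w₁ x t)).add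
      ((s.deriv_b₁ x t).mul (s.flux_b₁ x t))).add ((s.deriv_w₁ x t).mul (s.deriv_b₁ x t))
    have h4 := (((s.deriv_w₂ x t).mul (s.flux_w₂ x t)).add
      ((s.deriv_b₂ x t).mul (s.flux_b₂ x t))).add ((s.deriv_w₂ x t).mul (s.deriv_b₂ x t))
    refine HasDerivAt.congr_deriv ((((h1.add h2).add (s.deriv_u x t)).add h3).add h4) ?_
    simp only [S, diss, D]
    field_simp
    ring
  · intro x t
    have hv := s.v_pos x t
    have hθ := s.θ_pos x t
    have hμ := s.one_le_visc hα x t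
    have i1 : s.θ x t ^ p * s.θ x t ^ (-p) = 1 := by
      rw [← Real.rpow_add hθ]; simp
    have q1 := Real.rpow_pos_of_pos hθ (-p)
    have q2 := Real.rpow_pos_of_pos hθ p
    have q3 := Real.rpow_pos_of_pos hθ (-p - 1)
    have q4 := Real.rpow_pos_of_pos hθ β
    have h1 : s.θ x t ^ (-p) * (s.ux x t ^ 2 / s.v x t) ≤ s.diss p x t := by
      have : 0 ≤ p * (s.θ x t ^ (-p - 1) * s.θ x t ^ β) * s.θx x t ^ 2 / s.v x t := by positivity
      refine le_trans ?_ (le_add_of_nonneg_right this)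
      unfold D
      gcongr
      nlinarith [sq_nonneg (s.ux x t), sq_nonneg (s.w₁x x t), sq_nonneg (s.w₂x x t),
        sq_nonneg (s.b₁x x t), sq_nonneg (s.b₂x x t)]
    have h2 : (s.θ x t * s.θ x t ^ (-p) - 1) * s.ux x t / s.v x t
        ≤ 1 / 2 * (s.θ x t ^ (-p) * (s.ux x t ^ 2 / s.v x t)) + s.rem p x t := by
      unfold rem
      generalize s.θ x t * s.θ x t ^ (-p) - 1 = k
      generalize s.θ x t ^ (-p) = P at *
      generalize s.θ x t ^ p = Q at *
      rw [← mul_div_assoc, ← mul_div_assoc, ← add_div]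
      gcongr
      have e : P = Q⁻¹ := eq_inv_of_mul_eq_one_right i1
      have : 1 / 2 * (P * s.ux x t ^ 2) + 1 / 2 * Q * k ^ 2 - k * s.ux x t
        = 1 / 2 * P * (s.ux x t - Q * k) ^ 2 := by rw [e]; field_simp; ring
      have : 0 ≤ 1 / 2 * P * (s.ux x t - Q * k) ^ 2 := by positivity
      linarith
    linarith
  · intro x t
    have hv := s.v_pos x t
    have := Real.log_le_sub_one_of_pos hv
    have := hG0 _ (s.θ_pos x t)
    have := s.S_nonneg x t
    have : 0 ≤ (s.u x t ^ 2 + (s.w₁ x t ^ 2 + s.w₂ x t ^ 2) + s.v x t * s.S x t) / 2 := by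
      positivity
    unfold energy
    linarith
  · exact s.diss_nonneg hα hp.le
  · obtain ⟨B, hB⟩ := s.diffFlux_sq_le hα hp
    refine ⟨B, fun x t => (le_of_eq ?_).trans (hB x t)⟩
    unfold diffFlux S
    congr 1
    field_simp
    ring
  · exact (((s.bdd_u.mul (((bdd_const 1).sub (s.bdd_θ.mul s.bdd_inv_v)).sub
      (s.bdd_S.mul (bdd_const _)))).add (s.bdd_w₁.mul s.bdd_b₁)).add (s.bdd_w₂.mul s.bdd_b₂))
  · exact (((s.decays_u.mul_bdd (((bdd_const 1).sub (s.bdd_θ.mul s.bdd_inv_v)).sub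
      (s.bdd_S.mul (bdd_const _)))).add (s.decays_w₁.mul_bdd s.bdd_b₁)).add
      (s.decays_w₂.mul_bdd s.bdd_b₂))

end MHDFlow

/-- The relative entropy function `z - 1 - log z`. -/
def ent (z : ℝ) : ℝ := z - 1 - Real.log z

theorem ent_nonneg {z : ℝ} (hz : 0 < z) : 0 ≤ ent z := by
  unfold ent
  linarith [Real.log_le_sub_one_of_pos hz]

theorem hasDerivAt_ent {z : ℝ} (hz : 0 < z) : HasDerivAt ent (1 - z ^ (-1 : ℝ)) z := by
  rw [Real.rpow_neg_one]
  exact ((hasDerivAt_id z).sub_const 1).sub (Real.hasDerivAt_log hz.ne')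

theorem ent_le_sq_div {δ z : ℝ} (hδ : 0 < δ) (hz : δ ≤ z) : ent z ≤ (z - 1) ^ 2 / δ := by
  have h0 : 0 < z := hδ.trans_le hz
  have h := Real.log_le_sub_one_of_pos (inv_pos.2 h0)
  rw [Real.log_inv] at h
  calc ent z ≤ z - 1 + (z⁻¹ - 1) := by unfold ent; linarith
    _ = (z - 1) ^ 2 / z := by field_simp; ring
    _ ≤ (z - 1) ^ 2 / δ := by gcongr

theorem le_two_mul_ent {z : ℝ} (hz : 0 < z) : z ≤ 2 * ent z + 2 := by
  have h := Real.log_le_sub_one_of_pos (half_pos hz)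
  rw [Real.log_div hz.ne' two_ne_zero] at h
  have := Real.log_two_lt_d9
  unfold ent
  linarith

/-- The thermal energy function whose derivative is `1 - z ^ (-p)`. -/
def thermal (p z : ℝ) : ℝ := z - 1 - (z ^ (1 - p) - 1) / (1 - p)

theorem hasDerivAt_thermal {p z : ℝ} (hp : p < 1) (hz : 0 < z) :
    HasDerivAt (thermal p) (1 - z ^ (-p)) z := by
  have h := ((Real.hasDerivAt_rpow_const (x := z) (p := 1 - p) (Or.inl hz.ne')).sub_const 1).div_const
    (1 - p)
  refine HasDerivAt.congr_deriv (((hasDerivAt_id z).sub_const 1).sub h) ?_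
  have : 1 - p ≠ 0 := by linarith
  rw [show 1 - p - 1 = -p by ring]
  field_simp

theorem thermal_nonneg {p z : ℝ} (hp0 : 0 ≤ p) (hp : p < 1) (hz : 0 < z) : 0 ≤ thermal p z := by
  have h := rpow_one_add_le_one_add_mul_self (s := z - 1) (p := 1 - p) (by linarith)
    (by linarith) (by linarith)
  have h1 : (0:ℝ) < 1 - p := by linarith
  rw [show 1 + (z - 1) = z by ring] at h
  have : (z ^ (1 - p) - 1) / (1 - p) ≤ z - 1 := by
    rw [div_le_iff₀ h1]; linarith
  unfold thermal
  linarith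

theorem thermal_le_ent {p z : ℝ} (hp : p < 1) (hz : 0 < z) : thermal p z ≤ ent z := by
  have h := Real.log_le_sub_one_of_pos (Real.rpow_pos_of_pos hz (1 - p))
  have h1 : (0:ℝ) < 1 - p := by linarith
  rw [Real.log_rpow hz] at h
  have : Real.log z ≤ (z ^ (1 - p) - 1) / (1 - p) := by
    rw [le_div_iff₀ h1]; linarith
  unfold thermal ent
  linarith

namespace MHDFlow

variable {α β T : ℝ} (s : MHDFlow α β T)

/-- Quantitative bounds on the initial data. -/
structure InitialBound (K δ : ℝ) : Prop where
  integral_le : ∀ R, 0 ≤ R → ∫ x in (-R)..R, ((s.v x 0 - 1) ^ 2 + s.u x 0 ^ 2 + (s.θ x 0 - 1) ^ 2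
    + s.S x 0 + (s.w₁ x 0 ^ 2 + s.w₂ x 0 ^ 2)) ≤ K ^ 2
  v_ge : ∀ x, δ ≤ s.v x 0
  θ_ge : ∀ x, δ ≤ s.θ x 0
  v_le : ∀ x, s.v x 0 ≤ 1 + K
  S_le : ∀ x, s.S x 0 ≤ K ^ 2

/-- The constant in the entropy estimate. -/
def entBound (K δ : ℝ) : ℝ := (1 / δ + 1 + K) * K ^ 2 + 1

theorem one_le_entBound {K δ : ℝ} (hK : 0 < K) (hδ : 0 < δ) : 1 ≤ entBound K δ := by
  unfold entBound
  have : 0 ≤ (1 / δ + 1 + K) * K ^ 2 := by positivity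
  linarith

variable {K δ : ℝ} {s}

theorem InitialBound.energy_le (h : s.InitialBound K δ) (hK : 0 < K) (hδ : 0 < δ) {p : ℝ}
    {G : ℝ → ℝ} (hG : ∀ z > 0, HasDerivAt G (1 - z ^ (-p)) z) (hG1 : ∀ z > 0, G z ≤ ent z) {R : ℝ}
    (hR : 0 ≤ R) : ∫ x in (-R)..R, s.energy G x 0 ≤ (1 / δ + 1 + K) * K ^ 2 := by
  have hc := s.continuous_energy hG
  refine (integral_mono_of_continuous (g := fun x => (1 / δ + 1 + K) *
    ((s.v x 0 - 1) ^ 2 + s.u x 0 ^ 2 + (s.θ x 0 - 1) ^ 2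
    + s.S x 0 + (s.w₁ x 0 ^ 2 + s.w₂ x 0 ^ 2))) (by linarith) (by fun_prop)
    (by fun_prop) fun x _ => ?_).trans ?_
  · have h1 := ent_le_sq_div hδ (h.v_ge x)
    have h2 := (hG1 _ (s.θ_pos x 0)).trans (ent_le_sq_div hδ (h.θ_ge x))
    have h3 := s.S_nonneg x 0
    have h4 := mul_le_mul_of_nonneg_right (h.v_le x) h3
    have hd : 0 < 1 / δ := by positivity
    rw [div_eq_mul_one_div] at h1 h2
    have e0 := mul_nonneg hd.le (add_nonneg (add_nonneg (sq_nonneg (s.u x 0)) h3)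
      (add_nonneg (sq_nonneg (s.w₁ x 0)) (sq_nonneg (s.w₂ x 0))))
    have e1 := mul_nonneg hK.le (add_nonneg (add_nonneg (sq_nonneg (s.v x 0 - 1))
      (sq_nonneg (s.θ x 0 - 1))) h3)
    have e2 := mul_nonneg hK.le (add_nonneg (sq_nonneg (s.u x 0))
      (add_nonneg (sq_nonneg (s.w₁ x 0)) (sq_nonneg (s.w₂ x 0))))
    unfold ent at h1
    unfold energy
    nlinarith [sq_nonneg (s.u x 0), sq_nonneg (s.w₁ x 0), sq_nonneg (s.w₂ x 0),
      sq_nonneg (s.v x 0 - 1), sq_nonneg (s.θ x 0 - 1)]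
  · rw [intervalIntegral.integral_const_mul]
    exact mul_le_mul_of_nonneg_left (h.integral_le R hR) (by positivity)

/-- The basic entropy estimate. -/
theorem InitialBound.entropy_le (h : s.InitialBound K δ) (hα : 0 ≤ α) (hT : 0 < T) (hK : 0 < K)
    (hδ : 0 < δ) {R t : ℝ} (hR : 0 ≤ R) (ht : t ∈ Icc (0:ℝ) T) :
    ∫ x in (-R)..R, s.energy ent x t ≤ 2 * entBound K δ := by
  have h1 := (s.energy_estimate hα hT (p := 1) one_pos (G := ent) (fun z hz => hasDerivAt_ent hz)
    (fun z hz => ent_nonneg hz) (Cr := 0) le_rfl (E₀ := (1 / δ + 1 + K) * K ^ 2)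
    (fun R hR => h.energy_le hK hδ (fun z hz => hasDerivAt_ent hz) (fun z _ => le_rfl) hR)
    ⟨1, fun L hL t _ => ?_⟩ hR).1 t ht
  · unfold entBound; linarith
  · have hr : ∀ x, cutoff L x * s.rem 1 x t = 0 := fun x => by
      have := s.θ_pos x t
      unfold rem
      rw [Real.rpow_neg_one, mul_inv_cancel₀ this.ne']
      ring
    simp_rw [hr]
    rw [intervalIntegral.integral_zero]
    have : 0 ≤ ∫ x in (-L)..L, cutoff L x * s.diss 1 x t :=
      intervalIntegral.integral_nonneg (by linarith) fun x _ =>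
        mul_nonneg (cutoff_nonneg L x) (s.diss_nonneg hα zero_le_one x t)
    linarith

/-- The entropy estimate on an arbitrary interval. -/
theorem InitialBound.entropy_le_of_le (h : s.InitialBound K δ) (hα : 0 ≤ α) (hT : 0 < T)
    (hK : 0 < K) (hδ : 0 < δ) {a b t : ℝ} (hab : a ≤ b) (ht : t ∈ Icc (0:ℝ) T) {f : ℝ → ℝ}
    (hf : Continuous f) (hfe : ∀ x, f x ≤ s.energy ent x t) :
    ∫ x in a..b, f x ≤ 2 * entBound K δ := by
  have hc := s.continuous_energy (p := 1) (fun z hz => hasDerivAt_ent hz)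
  have hR : 0 ≤ max |a| |b| := (abs_nonneg a).trans (le_max_left _ _)
  refine (integral_mono_of_continuous hab hf (by fun_prop) fun x _ => hfe x).trans
    ((integral_mono_interval_of_continuous (f := fun x => s.energy ent x t)
      (c := -max |a| |b|) (d := max |a| |b|) ?_ hab ?_ (by fun_prop) fun x => ?_).trans
      (h.entropy_le hα hT hK hδ hR ht))
  · linarith [neg_abs_le a, le_max_left |a| |b|]
  · exact (le_abs_self b).trans (le_max_right _ _)
  · have hv := s.v_pos x t
    have h1 := ent_nonneg hv
    have h2 := ent_nonneg (s.θ_pos x t)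
    have := s.S_nonneg x t
    have : 0 ≤ (s.u x t ^ 2 + (s.w₁ x t ^ 2 + s.w₂ x t ^ 2) + s.v x t * s.S x t) / 2 := by
      positivity
    unfold ent at h1
    unfold energy
    linarith

/-- The parts of the entropy density are bounded by the entropy density. -/
theorem energy_parts (s : MHDFlow α β T) (x t : ℝ) :
    ent (s.θ x t) ≤ s.energy ent x t ∧ ent (s.v x t) ≤ s.energy ent x t ∧
    (s.u x t ^ 2 + (s.w₁ x t ^ 2 + s.w₂ x t ^ 2) + s.v x t * s.S x t) / 2 ≤ s.energy ent x t := by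
  have hv := s.v_pos x t
  have h1 := ent_nonneg hv
  have h2 := ent_nonneg (s.θ_pos x t)
  have := s.S_nonneg x t
  have : 0 ≤ (s.u x t ^ 2 + (s.w₁ x t ^ 2 + s.w₂ x t ^ 2) + s.v x t * s.S x t) / 2 := by
    positivity
  have e : s.energy ent x t = ent (s.θ x t) + ent (s.v x t)
    + (s.u x t ^ 2 + (s.w₁ x t ^ 2 + s.w₂ x t ^ 2) + s.v x t * s.S x t) / 2 := by
    unfold energy ent; ring
  rw [e]
  refine ⟨?_, ?_, ?_⟩ <;> linarith

end MHDFlow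

/-- Fundamental theorem of calculus for one-sided derivatives on `[0, T]`. -/
theorem integral_eq_sub_of_within {T : ℝ} {f f' : ℝ → ℝ} (cf : Continuous f) (cf' : Continuous f')
    (hf : ∀ t ∈ Icc (0:ℝ) T, HasDerivWithinAt f (f' t) (Icc 0 T) t) {t : ℝ}
    (ht : t ∈ Icc (0:ℝ) T) : ∫ s in (0:ℝ)..t, f' s = f t - f 0 := by
  refine intervalIntegral.integral_eq_sub_of_hasDerivAt_of_le ht.1 cf.continuousOn ?_
    (cf'.intervalIntegrable _ _)
  intro s hs
  exact (hf s ⟨hs.1.le, hs.2.le.trans ht.2⟩).hasDerivAt (Icc_mem_nhds hs.1 (hs.2.trans_le ht.2))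

/-- Gronwall's inequality in integral form. -/
theorem gronwall_integral {T k c : ℝ} {Φ ψ : ℝ → ℝ} (cψ : Continuous ψ)
    (hΦ : ∀ t ∈ Icc (0:ℝ) T, Φ t = c + ∫ s in (0:ℝ)..t, ψ s)
    (h : ∀ t ∈ Icc (0:ℝ) T, ψ t ≤ k * Φ t) {t : ℝ} (ht : t ∈ Icc (0:ℝ) T) :
    Φ t ≤ c * Real.exp (k * t) := by
  have hd : ∀ t, HasDerivAt (fun t => (c + ∫ s in (0:ℝ)..t, ψ s) * Real.exp (-(k * t)))
      (ψ t * Real.exp (-(k * t)) + (c + ∫ s in (0:ℝ)..t, ψ s) *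
        (Real.exp (-(k * t)) * -(k * 1))) t := fun t =>
    ((intervalIntegral.integral_hasDerivAt_right (cψ.intervalIntegrable _ _)
      (cψ.stronglyMeasurableAtFilter _ _) cψ.continuousAt).const_add c).mul
      (((hasDerivAt_id t).const_mul k).neg.exp)
  have hanti : AntitoneOn (fun t => (c + ∫ s in (0:ℝ)..t, ψ s) * Real.exp (-(k * t)))
      (Icc 0 T) := by
    refine antitoneOn_of_deriv_nonpos (convex_Icc 0 T)
      (fun t _ => (hd t).continuousAt.continuousWithinAt)
      (fun t _ => (hd t).differentiableAt.differentiableWithinAt) fun t ht => ?_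
    rw [interior_Icc] at ht
    have ht' : t ∈ Icc (0:ℝ) T := ⟨ht.1.le, ht.2.le⟩
    have h1 := h t ht'
    rw [hΦ t ht'] at h1
    rw [(hd t).deriv]
    nlinarith [Real.exp_pos (-(k * t))]
  have h1 := hanti ⟨le_rfl, ht.1.trans ht.2⟩ ht ht.1
  simp only [intervalIntegral.integral_same, mul_zero, neg_zero, Real.exp_zero] at h1
  rw [hΦ t ht]
  have h2 := mul_le_mul_of_nonneg_right h1 (Real.exp_pos (k * t)).le
  rw [mul_assoc, ← Real.exp_add] at h2
  simpa using h2

/-- The primitive of `visc α z / z`. -/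
def viscPrim (α z : ℝ) : ℝ := Real.log z - z ^ (-α)

theorem hasDerivAt_viscPrim {α z : ℝ} (hz : 0 < z) :
    HasDerivAt (viscPrim α) (visc α z / z) z := by
  refine HasDerivAt.congr_deriv ((Real.hasDerivAt_log hz.ne').sub
    (Real.hasDerivAt_rpow_const (p := -α) (Or.inl hz.ne'))) ?_
  rw [Real.rpow_sub_one hz.ne']
  unfold visc
  field_simp
  ring

theorem viscPrim_mono {α y z : ℝ} (hα : 0 ≤ α) (hy : 0 < y) (h : y ≤ z) :
    viscPrim α y ≤ viscPrim α z := by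
  have h1 := Real.log_le_log hy h
  have h2 := Real.rpow_le_rpow_of_nonpos hy h (neg_nonpos.2 hα)
  unfold viscPrim
  linarith

theorem exp_viscPrim_le {α z : ℝ} (hz : 0 < z) : Real.exp (viscPrim α z) ≤ z := by
  have := Real.rpow_nonneg hz.le (-α)
  calc Real.exp (viscPrim α z) ≤ Real.exp (Real.log z) :=
        Real.exp_le_exp.2 (by unfold viscPrim; linarith)
    _ = z := Real.exp_log hz

theorem le_exp_mul_exp_viscPrim {α z : ℝ} (hα : 0 ≤ α) (hz : 1 ≤ z) :
    z ≤ Real.exp 1 * Real.exp (viscPrim α z) := by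
  have h1 : z ^ (-α) ≤ 1 := Real.rpow_le_one_of_one_le_of_nonpos hz (neg_nonpos.2 hα)
  rw [← Real.exp_add]
  calc z = Real.exp (Real.log z) := (Real.exp_log (by linarith)).symm
    _ ≤ _ := Real.exp_le_exp.2 (by unfold viscPrim; linarith)

/-- Lower bound of `exp (viscPrim α z)` by the relative entropy. -/
theorem exp_viscPrim_ge {α E z : ℝ} (hα : 0 ≤ α) (hE : 0 < E) (hz : 0 < z) :
    Real.exp (viscPrim α (Real.exp (-1 - 4 * E))) * (1 - 1 / (4 * E) * ent z)
      ≤ Real.exp (viscPrim α z) := by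
  rcases le_or_gt (Real.exp (-1 - 4 * E)) z with h | h
  · refine le_trans (mul_le_of_le_one_right (Real.exp_pos _).le ?_)
      (Real.exp_le_exp.2 (viscPrim_mono hα (Real.exp_pos _) h))
    have := ent_nonneg hz
    have : 0 ≤ 1 / (4 * E) * ent z := by positivity
    linarith
  · refine le_trans (mul_nonpos_of_nonneg_of_nonpos (Real.exp_pos _).le ?_) (Real.exp_pos _).le
    have h1 := Real.log_le_log hz h.le
    rw [Real.log_exp] at h1
    have : 4 * E ≤ ent z := by unfold ent; linarith
    rw [one_div_mul_eq_div, sub_nonpos, le_div_iff₀ (by positivity)]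
    linarith

namespace MHDFlow

variable {α β T : ℝ} (s : MHDFlow α β T)

/-- The total pressure. -/
def press (x t : ℝ) : ℝ := s.θ x t / s.v x t + s.S x t / 2

@[fun_prop]
theorem continuous_press {X : Type*} [TopologicalSpace X] {f g : X → ℝ} (hf : Continuous f)
    (hg : Continuous g) : Continuous fun z => s.press (f z) (g z) := by
  unfold press
  fun_prop

theorem press_nonneg (x t : ℝ) : 0 ≤ s.press x t := by
  have := s.v_pos x t
  have := s.θ_pos x t
  have := s.S_nonneg x t
  unfold press
  positivity

/-- Time integral of the total pressure. -/
def pressInt (x t : ℝ) : ℝ := ∫ r in (0:ℝ)..t, s.press x r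

@[fun_prop]
theorem continuous_pressInt {X : Type*} [TopologicalSpace X] {f g : X → ℝ} (hf : Continuous f)
    (hg : Continuous g) : Continuous fun z => s.pressInt (f z) (g z) := by
  unfold pressInt
  fun_prop

theorem hasDerivAt_pressInt (x t : ℝ) :
    HasDerivAt (fun r => s.pressInt x r) (s.press x t) t := by
  have c : Continuous fun r => s.press x r := by fun_prop
  exact intervalIntegral.integral_hasDerivAt_right (c.intervalIntegrable _ _)
      (c.stronglyMeasurableAtFilter _ _) c.continuousAt

@[fun_prop]
theorem continuous_viscPrim_v {X : Type*} [TopologicalSpace X] {f g : X → ℝ} (hf : Continuous f)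
    (hg : Continuous g) : Continuous fun z => viscPrim α (s.v (f z) (g z)) := by
  unfold viscPrim
  fun_prop

/-- The effective volume potential. -/
def volPot (x t : ℝ) : ℝ := viscPrim α (s.v x t) - viscPrim α (s.v x 0) - s.pressInt x t

/-- Representation of the specific volume. -/
theorem volPot_sub {a x t : ℝ} (ht : t ∈ Icc (0:ℝ) T) :
    s.volPot x t - s.volPot a t = (∫ y in a..x, s.u y t) - ∫ y in a..x, s.u y 0 := by
  have cs : ∀ x, Continuous fun t => visc α (s.v x t) * s.ux x t / s.v x t
      - (s.θ x t / s.v x t + (s.b₁ x t ^ 2 + s.b₂ x t ^ 2) / 2) := fun x => by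
    unfold visc; fun_prop
  have key : ∀ x, ∫ r in (0:ℝ)..t, (visc α (s.v x r) * s.ux x r / s.v x r
      - (s.θ x r / s.v x r + (s.b₁ x r ^ 2 + s.b₂ x r ^ 2) / 2)) = s.volPot x t := fun x => by
    rw [integral_eq_sub_of_within (f := fun r => viscPrim α (s.v x r) - s.pressInt x r)
      (by fun_prop) (cs x) _ ht]
    · unfold volPot
      have : s.pressInt x 0 = 0 := by simp [pressInt]
      simp only [this]
      ring
    · intro r hr
      refine HasDerivWithinAt.congr_deriv
        (((hasDerivAt_viscPrim (s.v_pos x r)).comp_hasDerivWithinAt r (s.time_v x r hr)).sub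
          (s.hasDerivAt_pressInt x r).hasDerivWithinAt) ?_
      unfold press S
      ring
  rw [integral_sub_integral_zero s.cont_u s.cont_ut s.time_u ht, ← key, ← key,
    ← intervalIntegral.integral_sub ((cs x).intervalIntegrable _ _)
      ((cs a).intervalIntegrable _ _)]
  congr 1
  ext r
  rw [intervalIntegral.integral_eq_sub_of_hasDerivAt (fun y _ => s.momentum y r)]
  exact Continuous.intervalIntegrable (by fun_prop) _ _

variable {K δ : ℝ} {s}

/-- Bound of the multiplicative error in the representation of the volume. -/
def volErr (α K δ : ℝ) : ℝ := Real.exp (K + |viscPrim α δ| + (4 * entBound K δ + 1))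

theorem InitialBound.integral_abs_u_le (h : s.InitialBound K δ) (hα : 0 ≤ α) (hT : 0 < T)
    (hK : 0 < K) (hδ : 0 < δ) {a x t : ℝ} (hx : x ∈ Icc a (a + 1)) (ht : t ∈ Icc (0:ℝ) T) :
    |∫ y in a..x, s.u y t| ≤ 2 * entBound K δ + 1 / 2 := by
  have h1 : ∫ y in a..x, (s.u y t ^ 2 / 2) ≤ 2 * entBound K δ := by
    refine h.entropy_le_of_le hα hT hK hδ hx.1 ht (by fun_prop) fun y => ?_
    have := (s.energy_parts y t).2.2
    have := mul_nonneg (s.v_pos y t).le (s.S_nonneg y t)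
    nlinarith [sq_nonneg (s.w₁ y t), sq_nonneg (s.w₂ y t)]
  refine (intervalIntegral.abs_integral_le_integral_abs hx.1).trans ?_
  have h2 : ∫ y in a..x, |s.u y t| ≤ ∫ y in a..x, (s.u y t ^ 2 / 2 + 1 / 2) :=
    integral_mono_of_continuous hx.1 (by fun_prop) (by fun_prop) fun y _ => by
      nlinarith [sq_nonneg (|s.u y t| - 1), sq_abs (s.u y t)]
  rw [integral_add_of_continuous (by fun_prop) (by fun_prop),
    intervalIntegral.integral_const, smul_eq_mul] at h2
  linarith [hx.2]

theorem InitialBound.exp_volPot (h : s.InitialBound K δ) (hα : 0 ≤ α) (hT : 0 < T)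
    (hK : 0 < K) (hδ : 0 < δ) {a x t : ℝ} (hx : x ∈ Icc a (a + 1)) (ht : t ∈ Icc (0:ℝ) T) :
    Real.exp (s.pressInt x t) ≤
        volErr α K δ * Real.exp (-s.volPot a t) * Real.exp (viscPrim α (s.v x t)) ∧
      Real.exp (-s.volPot a t) * Real.exp (viscPrim α (s.v x t)) ≤
        volErr α K δ * Real.exp (s.pressInt x t) := by
  have h1 := abs_le.1 (h.integral_abs_u_le hα hT hK hδ hx ht)
  have h2 := abs_le.1 (h.integral_abs_u_le hα hT hK hδ hx ⟨le_rfl, hT.le⟩)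
  have h3 := s.volPot_sub (a := a) (x := x) ht
  have h4 := viscPrim_mono hα hδ (h.v_ge x)
  have h5 : viscPrim α (s.v x 0) ≤ K := by
    have := Real.log_le_sub_one_of_pos (s.v_pos x 0)
    have := Real.rpow_nonneg (s.v_pos x 0).le (-α)
    have := h.v_le x
    unfold viscPrim
    linarith
  have h6 := neg_abs_le (viscPrim α δ)
  have h7 := abs_nonneg (viscPrim α δ)
  have h8 : s.volPot x t = viscPrim α (s.v x t) - viscPrim α (s.v x 0) - s.pressInt x t := rfl
  unfold volErr
  rw [← Real.exp_add, ← Real.exp_add, ← Real.exp_add, ← Real.exp_add]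
  constructor <;> apply Real.exp_le_exp.2 <;> linarith [h1.1, h1.2, h2.1, h2.2]

theorem InitialBound.integral_v_le (h : s.InitialBound K δ) (hα : 0 ≤ α) (hT : 0 < T)
    (hK : 0 < K) (hδ : 0 < δ) {a t : ℝ} (ht : t ∈ Icc (0:ℝ) T) :
    ∫ y in a..(a + 1), s.v y t ≤ 4 * entBound K δ + 2 := by
  have h1 := h.entropy_le_of_le hα hT hK hδ (by linarith : a ≤ a + 1) ht
    (f := fun y => 1 / 2 * s.v y t - 1) (by fun_prop) fun y => by
      linarith [(s.energy_parts y t).2.1, le_two_mul_ent (s.v_pos y t)]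
  rw [intervalIntegral.integral_sub (Continuous.intervalIntegrable (by fun_prop) _ _)
    (Continuous.intervalIntegrable (by fun_prop) _ _), intervalIntegral.integral_const_mul,
    intervalIntegral.integral_const, smul_eq_mul] at h1
  linarith

theorem InitialBound.integral_θ_le (h : s.InitialBound K δ) (hα : 0 ≤ α) (hT : 0 < T)
    (hK : 0 < K) (hδ : 0 < δ) {a t : ℝ} (ht : t ∈ Icc (0:ℝ) T) :
    ∫ y in a..(a + 1), s.θ y t ≤ 4 * entBound K δ + 2 := by
  have h1 := h.entropy_le_of_le hα hT hK hδ (by linarith : a ≤ a + 1) ht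
    (f := fun y => 1 / 2 * s.θ y t - 1) (by fun_prop) fun y => by
      linarith [(s.energy_parts y t).1, le_two_mul_ent (s.θ_pos y t)]
  rw [intervalIntegral.integral_sub (Continuous.intervalIntegrable (by fun_prop) _ _)
    (Continuous.intervalIntegrable (by fun_prop) _ _), intervalIntegral.integral_const_mul,
    intervalIntegral.integral_const, smul_eq_mul] at h1
  linarith

theorem InitialBound.integral_vS_le (h : s.InitialBound K δ) (hα : 0 ≤ α) (hT : 0 < T)
    (hK : 0 < K) (hδ : 0 < δ) {a b t : ℝ} (hab : a ≤ b) (ht : t ∈ Icc (0:ℝ) T) :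
    ∫ y in a..b, s.v y t * s.S y t ≤ 4 * entBound K δ := by
  have h1 := h.entropy_le_of_le hα hT hK hδ hab ht
    (f := fun y => 1 / 2 * (s.v y t * s.S y t)) (by fun_prop) fun y => by
      linarith [(s.energy_parts y t).2.2, sq_nonneg (s.u y t), sq_nonneg (s.w₁ y t),
        sq_nonneg (s.w₂ y t)]
  rw [intervalIntegral.integral_const_mul] at h1
  linarith

/-- The weight `exp (-volPot)` is bounded above and below. -/
theorem InitialBound.exp_neg_volPot (h : s.InitialBound K δ) (hα : 0 ≤ α) (hT : 0 < T)
    (hK : 0 < K) (hδ : 0 < δ) {a t : ℝ} (ht : t ∈ Icc (0:ℝ) T) :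
    1 ≤ volErr α K δ * (4 * entBound K δ + 2) * Real.exp (-s.volPot a t) ∧
    Real.exp (viscPrim α (Real.exp (-1 - 4 * entBound K δ))) * Real.exp (-s.volPot a t) ≤
      2 * volErr α K δ * Real.exp (volErr α K δ * (6 * entBound K δ + 2) * (2 * volErr α K δ
        / Real.exp (viscPrim α (Real.exp (-1 - 4 * entBound K δ)))) * T) := by
  have hE := one_le_entBound hK hδ
  set E := entBound K δ with hEd
  have hV : 0 < volErr α K δ := Real.exp_pos _
  set V := volErr α K δ with hVd
  set ℓ := Real.exp (viscPrim α (Real.exp (-1 - 4 * E))) with hℓ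
  have hℓ0 : 0 < ℓ := Real.exp_pos _
  have hI : a ≤ a + 1 := by linarith
  have hZc : ∀ t ∈ Icc (0:ℝ) T, ℓ * Real.exp (-s.volPot a t) ≤
      2 * V * ∫ x in a..(a + 1), Real.exp (s.pressInt x t) := by
    intro t ht
    have hZ := Real.exp_pos (-s.volPot a t)
    set Z := Real.exp (-s.volPot a t)
    have h1 : ∫ x in a..(a + 1), Z * (ℓ * (1 - 1 / (4 * E) * (s.v x t - 1 - Real.log (s.v x t))))
        ≤ ∫ x in a..(a + 1), V * Real.exp (s.pressInt x t) := by
      refine integral_mono_of_continuous hI (by fun_prop) (by fun_prop) fun x hx => ?_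
      exact (mul_le_mul_of_nonneg_left (exp_viscPrim_ge hα (by linarith) (s.v_pos x t))
        hZ.le).trans (h.exp_volPot hα hT hK hδ hx ht).2
    have h2 := h.entropy_le_of_le hα hT hK hδ hI ht
      (f := fun y => s.v y t - 1 - Real.log (s.v y t)) (by fun_prop) fun y =>
        (s.energy_parts y t).2.1
    rw [intervalIntegral.integral_const_mul, intervalIntegral.integral_const_mul,
      intervalIntegral.integral_const_mul,
      intervalIntegral.integral_sub (Continuous.intervalIntegrable (by fun_prop) _ _)
      (Continuous.intervalIntegrable (by fun_prop) _ _), intervalIntegral.integral_const_mul,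
      intervalIntegral.integral_const, smul_eq_mul] at h1
    have h3 : 1 / 2 ≤ (a + 1 - a) * 1 - 1 / (4 * E) *
        ∫ y in a..(a + 1), (s.v y t - 1 - Real.log (s.v y t)) := by
      have : 1 / (4 * E) * ∫ y in a..(a + 1), (s.v y t - 1 - Real.log (s.v y t))
          ≤ 1 / (4 * E) * (2 * E) := by gcongr
      have e : 1 / (4 * E) * (2 * E) = 1 / 2 := by field_simp; norm_num
      linarith
    have h4 := mul_le_mul_of_nonneg_left h3 (mul_pos hZ hℓ0).le
    nlinarith
  have hψ : ∀ t ∈ Icc (0:ℝ) T, ∫ x in a..(a + 1), s.press x t * Real.exp (s.pressInt x t) ≤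
      V * (6 * E + 2) * Real.exp (-s.volPot a t) := by
    intro t ht
    have hZ := Real.exp_pos (-s.volPot a t)
    set Z := Real.exp (-s.volPot a t)
    have h1 : ∫ x in a..(a + 1), s.press x t * Real.exp (s.pressInt x t) ≤
        ∫ x in a..(a + 1), V * Z * (s.θ x t + 1 / 2 * (s.v x t * s.S x t)) := by
      refine integral_mono_of_continuous hI (by fun_prop) (by fun_prop) fun x hx => ?_
      have hv := s.v_pos x t
      have e : s.θ x t + 1 / 2 * (s.v x t * s.S x t) = s.press x t * s.v x t := by
        unfold press; field_simp
      rw [e]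
      calc s.press x t * Real.exp (s.pressInt x t)
          ≤ s.press x t * (V * Z * Real.exp (viscPrim α (s.v x t))) :=
            mul_le_mul_of_nonneg_left (h.exp_volPot hα hT hK hδ hx ht).1 (s.press_nonneg x t)
        _ ≤ s.press x t * (V * Z * s.v x t) := by
            have := s.press_nonneg x t
            gcongr
            exact exp_viscPrim_le hv
        _ = _ := by ring
    rw [intervalIntegral.integral_const_mul, integral_add_of_continuous (by fun_prop)
      (by fun_prop), intervalIntegral.integral_const_mul] at h1
    have h2 := h.integral_θ_le hα hT hK hδ (a := a) ht
    have h3 := h.integral_vS_le hα hT hK hδ hI ht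
    calc _ ≤ _ := h1
      _ ≤ V * Z * (6 * E + 2) :=
          mul_le_mul_of_nonneg_left (by linarith) (by positivity)
      _ = _ := by ring
  have hΦ : ∀ t ∈ Icc (0:ℝ) T, ∫ x in a..(a + 1), Real.exp (s.pressInt x t) =
      1 + ∫ r in (0:ℝ)..t, ∫ x in a..(a + 1), s.press x r * Real.exp (s.pressInt x r) := by
    intro t ht
    rw [← integral_sub_integral_zero (f := fun x t => Real.exp (s.pressInt x t))
      (ft := fun x t => s.press x t * Real.exp (s.pressInt x t)) (T := T)
      (by unfold Function.uncurry; fun_prop) (by unfold Function.uncurry; fun_prop) _ ht]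
    · simp [pressInt]
    · intro x t _
      refine HasDerivWithinAt.congr_deriv (s.hasDerivAt_pressInt x t).exp.hasDerivWithinAt ?_
      ring
  constructor
  · have hZ := Real.exp_pos (-s.volPot a t)
    set Z := Real.exp (-s.volPot a t)
    have h1 : ∫ x in a..(a + 1), (1:ℝ) ≤ ∫ x in a..(a + 1), V * Z * s.v x t := by
      refine integral_mono_of_continuous hI (by fun_prop) (by fun_prop) fun x hx => ?_
      have h2 : 0 ≤ s.pressInt x t :=
        intervalIntegral.integral_nonneg ht.1 fun r _ => s.press_nonneg x r
      refine (Real.one_le_exp h2).trans ((h.exp_volPot hα hT hK hδ hx ht).1.trans ?_)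
      gcongr
      exact exp_viscPrim_le (s.v_pos x t)
    rw [intervalIntegral.integral_const_mul, intervalIntegral.integral_const, smul_eq_mul] at h1
    have h2 := h.integral_v_le hα hT hK hδ (a := a) ht
    have h3 := mul_le_mul_of_nonneg_left h2 (mul_pos hV hZ).le
    linarith
  · have hg := gronwall_integral (k := V * (6 * E + 2) * (2 * V / ℓ)) (c := 1)
      (Φ := fun t => ∫ x in a..(a + 1), Real.exp (s.pressInt x t)) (by fun_prop) hΦ
      (fun t ht => (hψ t ht).trans ?_) ht
    · refine (hZc t ht).trans (mul_le_mul_of_nonneg_left (hg.trans ?_) (by positivity))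
      rw [one_mul]
      apply Real.exp_le_exp.2
      exact mul_le_mul_of_nonneg_left ht.2 (by positivity)
    · have h1 := hZc t ht
      rw [mul_assoc (V * (6 * E + 2))]
      refine mul_le_mul_of_nonneg_left ?_ (by positivity)
      rw [div_mul_eq_mul_div, le_div_iff₀ hℓ0]
      linarith

/-- Bounds of the specific volume; the upper bound depends on the time integral of the pressure. -/
theorem volume_bounds {T : ℝ} (β : ℝ) (hα : 0 ≤ α) (hT : 0 < T) (hK : 0 < K) (hδ : 0 < δ) :
    ∃ m > 0, ∃ C > 0, ∀ s : MHDFlow α β T, s.InitialBound K δ → ∀ x, ∀ t ∈ Icc (0:ℝ) T,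
      m ≤ s.v x t ∧ s.v x t ≤ 1 + C * Real.exp (s.pressInt x t) := by
  have hE := one_le_entBound hK hδ
  have hV : 0 < volErr α K δ := Real.exp_pos _
  have hℓ0 := Real.exp_pos (viscPrim α (Real.exp (-1 - 4 * entBound K δ)))
  set ℓ := Real.exp (viscPrim α (Real.exp (-1 - 4 * entBound K δ)))
  set W := 2 * volErr α K δ * Real.exp (volErr α K δ * (6 * entBound K δ + 2) *
    (2 * volErr α K δ / ℓ) * T)
  have hW : 0 < W := by positivity
  refine ⟨ℓ / (volErr α K δ * W), by positivity, Real.exp 1 * (volErr α K δ *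
    (4 * entBound K δ + 2) * volErr α K δ), by positivity, fun s h x t ht => ?_⟩
  obtain ⟨h1, h2⟩ := h.exp_neg_volPot hα hT hK hδ (a := x) ht
  obtain ⟨h3, h4⟩ := h.exp_volPot hα hT hK hδ (a := x) (x := x) ⟨le_rfl, by linarith⟩ ht
  have hZ := Real.exp_pos (-s.volPot x t)
  set Z := Real.exp (-s.volPot x t)
  have hv := s.v_pos x t
  constructor
  · have h5 : 0 ≤ s.pressInt x t :=
      intervalIntegral.integral_nonneg ht.1 fun r _ => s.press_nonneg x r
    have h6 : 1 ≤ volErr α K δ * Z * s.v x t := by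
      refine (Real.one_le_exp h5).trans (h3.trans ?_)
      gcongr
      exact exp_viscPrim_le hv
    rw [div_le_iff₀ (by positivity)]
    have h7 := mul_le_mul_of_nonneg_left h6 hℓ0.le
    have h8 := mul_le_mul_of_nonneg_left h2 (mul_pos hV hv).le
    linarith
  · have hP := Real.exp_pos (s.pressInt x t)
    have hC : 0 < volErr α K δ * (4 * entBound K δ + 2) := by positivity
    rcases le_or_gt 1 (s.v x t) with h5 | h5
    · have h6 := le_exp_mul_exp_viscPrim hα h5
      have h7 : Real.exp (viscPrim α (s.v x t)) ≤ volErr α K δ * (4 * entBound K δ + 2) *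
          (volErr α K δ * Real.exp (s.pressInt x t)) := by
        have hN := Real.exp_pos (viscPrim α (s.v x t))
        calc _ ≤ volErr α K δ * (4 * entBound K δ + 2) * Z * Real.exp (viscPrim α (s.v x t)) :=
              le_mul_of_one_le_left hN.le h1
          _ = volErr α K δ * (4 * entBound K δ + 2) * (Z * Real.exp (viscPrim α (s.v x t))) := by
              ring
          _ ≤ _ := mul_le_mul_of_nonneg_left h4 hC.le
      have h8 := mul_le_mul_of_nonneg_left h7 (Real.exp_pos 1).le
      linarith
    · have : 0 < Real.exp 1 * (volErr α K δ * (4 * entBound K δ + 2) * volErr α K δ)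
        * Real.exp (s.pressInt x t) := by positivity
      linarith

end MHDFlow

theorem sq_sub_one_le_ent {z : ℝ} (hz : 0 < z) : (z - 1) ^ 2 ≤ 2 * (z + 1) * ent z := by
  have hr := Real.sqrt_pos.2 hz
  have h := Real.log_le_sub_one_of_pos hr
  rw [Real.log_sqrt hz.le] at h
  have hs := Real.sq_sqrt hz.le
  set r := Real.sqrt z
  have h1 : (r - 1) ^ 2 ≤ ent z := by unfold ent; nlinarith
  calc (z - 1) ^ 2 = (r + 1) ^ 2 * (r - 1) ^ 2 := by rw [← hs]; ring
    _ ≤ (2 * (z + 1)) * (r - 1) ^ 2 := by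
        apply mul_le_mul_of_nonneg_right _ (sq_nonneg _)
        nlinarith [sq_nonneg (r - 1)]
    _ ≤ _ := mul_le_mul_of_nonneg_left h1 (by positivity)

/-- Pointwise bound for the remainder in the weighted energy estimate. -/
theorem rpow_mul_sq_le_ent {p z : ℝ} (hp0 : 0 ≤ p) (hp1 : p ≤ 1) (hz : 0 < z) :
    z ^ p * (z * z ^ (-p) - 1) ^ 2 ≤ 4 * ent z * (1 + z ^ (1 - p)) := by
  have h0 := sq_sub_one_le_ent hz
  have he := ent_nonneg hz
  have hP := Real.rpow_pos_of_pos hz p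
  have hN := Real.rpow_pos_of_pos hz (-p)
  have hPN : z ^ p * z ^ (-p) = 1 := by rw [← Real.rpow_add hz]; simp
  have hq : z ^ (1 - p) = z * z ^ (-p) := by
    rw [sub_eq_add_neg, Real.rpow_add hz, Real.rpow_one]
  rw [hq]
  have hzN : 0 < z * z ^ (-p) := by positivity
  rcases le_or_gt 1 z with h | h
  · have hN1 : z ^ (-p) ≤ 1 := Real.rpow_le_one_of_one_le_of_nonpos h (neg_nonpos.2 hp0)
    have hone : 1 ≤ z * z ^ (-p) := by
      rw [← hq]; exact Real.one_le_rpow h (by linarith)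
    have h1 : (z * z ^ (-p) - 1) ^ 2 ≤ ((z - 1) * z ^ (-p)) ^ 2 := by
      apply pow_le_pow_left₀ (by linarith)
      nlinarith
    calc z ^ p * (z * z ^ (-p) - 1) ^ 2 ≤ z ^ p * ((z - 1) * z ^ (-p)) ^ 2 :=
          mul_le_mul_of_nonneg_left h1 hP.le
      _ = (z ^ p * z ^ (-p)) * ((z - 1) ^ 2 * z ^ (-p)) := by ring
      _ = (z - 1) ^ 2 * z ^ (-p) := by rw [hPN, one_mul]
      _ ≤ (2 * (z + 1) * ent z) * z ^ (-p) := mul_le_mul_of_nonneg_right h0 hN.le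
      _ ≤ (4 * z * ent z) * z ^ (-p) :=
          mul_le_mul_of_nonneg_right (mul_le_mul_of_nonneg_right (by linarith) he) hN.le
      _ ≤ _ := by nlinarith
  · have hP1 : z ^ p ≤ 1 := Real.rpow_le_one hz.le h.le hp0
    have h1 : z ≤ z * z ^ (-p) := by
      have : 1 ≤ z ^ (-p) := Real.one_le_rpow_of_pos_of_le_one_of_nonpos hz h.le (by linarith)
      nlinarith
    have h2 : z * z ^ (-p) ≤ 1 := by
      rw [← hq]; exact Real.rpow_le_one hz.le h.le (by linarith)
    calc z ^ p * (z * z ^ (-p) - 1) ^ 2 ≤ 1 * (z * z ^ (-p) - 1) ^ 2 :=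
          mul_le_mul_of_nonneg_right hP1 (sq_nonneg _)
      _ ≤ (z - 1) ^ 2 := by nlinarith
      _ ≤ 4 * ent z := by nlinarith
      _ ≤ _ := by nlinarith

theorem rpow_interpolation {β q ε z : ℝ} (hβ : 0 < β) (hq : 0 ≤ q) (hε : 0 < ε) (hz : 0 < z) :
    z ^ q ≤ (1 / ε) ^ (q / β) + ε * z ^ (β + q) := by
  have h1 : 0 < (1 / ε) ^ (q / β) := Real.rpow_pos_of_pos (by positivity) _
  have h2 := Real.rpow_pos_of_pos hz q
  have h3 := Real.rpow_pos_of_pos hz β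
  rw [Real.rpow_add hz]
  rcases le_or_gt (z ^ β) (1 / ε) with h | h
  · have : z ^ q ≤ (1 / ε) ^ (q / β) := by
      calc z ^ q = (z ^ β) ^ (q / β) := by
            rw [← Real.rpow_mul hz.le]; congr 1; field_simp
        _ ≤ _ := Real.rpow_le_rpow h3.le h (by positivity)
    have : 0 < ε * (z ^ β * z ^ q) := by positivity
    linarith
  · rw [div_lt_iff₀ hε] at h
    nlinarith

namespace MHDFlow

variable {α β T K δ : ℝ} {s : MHDFlow α β T}

theorem le_diss (hα : 0 ≤ α) {p : ℝ} (x t : ℝ) :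
    p * (s.θ x t ^ ((β + 1 - p) / 2 - 1) * |s.θx x t|) ^ 2 / s.v x t ≤ s.diss p x t := by
  have hv := s.v_pos x t
  have hθ := s.θ_pos x t
  have : 0 ≤ s.θ x t ^ (-p) * s.D x t := by
    have := s.one_le_visc hα x t
    have : 0 ≤ visc α (s.v x t) := by linarith
    unfold D
    positivity
  have e : (s.θ x t ^ ((β + 1 - p) / 2 - 1)) ^ 2 = s.θ x t ^ (-p - 1) * s.θ x t ^ β := by
    rw [sq, ← Real.rpow_add hθ, ← Real.rpow_add hθ]
    congr 1
    ring
  rw [mul_pow, e, sq_abs]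
  unfold diss
  have e2 : p * (s.θ x t ^ (-p - 1) * s.θ x t ^ β * s.θx x t ^ 2) / s.v x t
    = p * (s.θ x t ^ (-p - 1) * s.θ x t ^ β) * s.θx x t ^ 2 / s.v x t := by ring
  rw [e2]
  linarith

/-- Pointwise control of the temperature by the weighted dissipation. -/
theorem InitialBound.rpow_θ_le (h : s.InitialBound K δ) (hα : 0 ≤ α) (hβ : 0 < β) (hT : 0 < T)
    (hK : 0 < K) (hδ : 0 < δ) {p : ℝ} (hp : 0 < p) (hp1 : p < 1) {x t : ℝ}
    (ht : t ∈ Icc (0:ℝ) T) :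
    s.θ x t ^ (β + 1 - p) ≤ 2 * (4 * entBound K δ + 2) ^ (β + 1 - p) +
      2 * ((β + 1 - p) / 2) ^ 2 * (4 * entBound K δ + 2) / p *
        ∫ y in x..(x + 1), s.diss p y t := by
  have hE := one_le_entBound hK hδ
  set C := 4 * entBound K δ + 2 with hC
  have hC0 : 0 < C := by linarith
  set q := (β + 1 - p) / 2 with hq
  have hq0 : 0 < q := by rw [hq]; linarith
  have hx1 : x ≤ x + 1 := by linarith
  obtain ⟨y, hy, hmin⟩ := (isCompact_Icc (a := x) (b := x + 1)).exists_isMinOn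
    ⟨x, le_rfl, hx1⟩ (f := fun y => s.θ y t) (Continuous.continuousOn (by fun_prop))
  have hyC : s.θ y t ≤ C := by
    have h1 : ∫ z in x..(x + 1), s.θ y t ≤ ∫ z in x..(x + 1), s.θ z t :=
      integral_mono_of_continuous hx1 (by fun_prop) (by fun_prop) fun z hz => hmin hz
    rw [intervalIntegral.integral_const, smul_eq_mul] at h1
    have h2 := h.integral_θ_le hα hT hK hδ (a := x) ht
    linarith
  have hθx := s.θ_pos x t
  have hθy := s.θ_pos y t
  have cg : Continuous fun z => s.θ z t ^ (q - 1) * |s.θx z t| := by fun_prop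
  have hgn : ∀ z, 0 ≤ s.θ z t ^ (q - 1) * |s.θx z t| := fun z => by
    have := s.θ_pos z t
    positivity
  set J := ∫ z in x..(x + 1), s.θ z t ^ (q - 1) * |s.θx z t| with hJ
  have hJ0 : 0 ≤ J := intervalIntegral.integral_nonneg hx1 fun z _ => hgn z
  set I := ∫ y in x..(x + 1), s.diss p y t with hI
  have hI0 : 0 ≤ I := intervalIntegral.integral_nonneg hx1 fun z _ => s.diss_nonneg hα hp.le z t
  have h1 : s.θ x t ^ q ≤ C ^ q + q * J := by
    have e : ∫ z in x..y, s.θx z t * q * s.θ z t ^ (q - 1) = s.θ y t ^ q - s.θ x t ^ q :=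
      intervalIntegral.integral_eq_sub_of_hasDerivAt (fun z _ =>
        (s.deriv_θ z t).rpow_const (p := q) (Or.inl (s.θ_pos z t).ne'))
        (Continuous.intervalIntegrable (by fun_prop) _ _)
    have h2 : ∫ z in x..y, -(s.θx z t * q * s.θ z t ^ (q - 1)) ≤
        ∫ z in x..y, q * (s.θ z t ^ (q - 1) * |s.θx z t|) :=
      integral_mono_of_continuous hy.1 (by fun_prop) (by fun_prop) fun z _ => by
        have h3 := mul_nonneg hq0.le (Real.rpow_nonneg (s.θ_pos z t).le (q - 1))
        nlinarith [neg_abs_le (s.θx z t)]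
    have h3 : ∫ z in x..y, (s.θ z t ^ (q - 1) * |s.θx z t|) ≤ J :=
      integral_mono_interval_of_continuous le_rfl hy.1 hy.2 cg hgn
    have h4 := Real.rpow_le_rpow hθy.le hyC hq0.le
    rw [intervalIntegral.integral_neg, e, intervalIntegral.integral_const_mul] at h2
    nlinarith
  have h2 : J ^ 2 ≤ C * (I / p) := by
    rcases hJ0.eq_or_lt with h0 | h0
    · have : 0 ≤ C * (I / p) := by positivity
      rw [← h0]; simpa using this
    have h3 : J ≤ ∫ z in x..(x + 1), (J / C / 2 * s.v z t + C / J / 2 * (1 / p * s.diss p z t)) := by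
      refine integral_mono_of_continuous hx1 cg (by fun_prop) fun z _ => ?_
      have hv := s.v_pos z t
      have h4 := le_diss (s := s) hα (p := p) z t
      rw [← hq] at h4
      have hg := hgn z
      set g := s.θ z t ^ (q - 1) * |s.θx z t|
      have h5 : g ^ 2 / s.v z t ≤ 1 / p * s.diss p z t := by
        rw [div_mul_eq_mul_div, one_mul, le_div_iff₀ hp]
        calc _ = p * g ^ 2 / s.v z t := by ring
          _ ≤ _ := h4
      have h6 := mul_le_mul_of_nonneg_left h5 (by positivity : 0 ≤ C / J / 2)
      have h7 : J / C / 2 * s.v z t + C / J / 2 * (g ^ 2 / s.v z t) - g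
          = (J * s.v z t - C * g) ^ 2 / (2 * C * J * s.v z t) := by
        field_simp; ring
      have h8 : 0 ≤ (J * s.v z t - C * g) ^ 2 / (2 * C * J * s.v z t) := by positivity
      linarith
    rw [integral_add_of_continuous (by fun_prop) (by fun_prop),
      intervalIntegral.integral_const_mul, intervalIntegral.integral_const_mul,
      intervalIntegral.integral_const_mul] at h3
    have h4 := h.integral_v_le hα hT hK hδ (a := x) ht
    have h5 := mul_le_mul_of_nonneg_left h4 (by positivity : 0 ≤ J / C / 2)
    rw [← hC] at h5
    have h6 : J ≤ C / J * (1 / p * I) := by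
      have : J / C / 2 * C = J / 2 := by field_simp
      linarith
    rw [div_mul_eq_mul_div, le_div_iff₀ h0] at h6
    calc J ^ 2 = J * J := sq J
      _ ≤ _ := h6
      _ = _ := by ring
  have e1 : ∀ z : ℝ, 0 < z → z ^ (β + 1 - p) = (z ^ q) ^ 2 := fun z hz => by
    rw [sq, ← Real.rpow_add hz]; congr 1; rw [hq]; ring
  rw [e1 _ hθx, e1 _ hC0]
  have h3 : (s.θ x t ^ q) ^ 2 ≤ (C ^ q + q * J) ^ 2 :=
    pow_le_pow_left₀ (Real.rpow_nonneg hθx.le q) h1 2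
  have h4 := mul_le_mul_of_nonneg_left h2 (sq_nonneg q)
  have e2 : 2 * q ^ 2 * C / p * I = 2 * (q ^ 2 * (C * (I / p))) := by ring
  rw [e2]
  nlinarith [sq_nonneg (C ^ q - q * J)]

/-- The weighted dissipation is bounded in space-time. -/
theorem diss_bound {T : ℝ} (hα : 0 ≤ α) (hβ : 0 < β) (hT : 0 < T) (hK : 0 < K) (hδ : 0 < δ)
    {p : ℝ} (hp : 0 < p) (hp1 : p < 1) :
    ∃ C > 0, ∀ s : MHDFlow α β T, s.InitialBound K δ → ∀ R, 0 ≤ R →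
      ∫ t in (0:ℝ)..T, ∫ x in (-R)..R, s.diss p x t ≤ C := by
  obtain ⟨m, hm, Cv, hCv, hmv⟩ := volume_bounds β hα hT hK hδ
  have hE := one_le_entBound hK hδ
  set E := entBound K δ with hEd
  set A := 2 * (4 * E + 2) ^ (β + 1 - p) + 2 ^ (β + 1 - p)
  set B := 2 * ((β + 1 - p) / 2) ^ 2 * (4 * E + 2) / p
  have hA : 0 < A := by positivity
  have hB : 0 < B := by
    have : 0 < (β + 1 - p) / 2 := by linarith
    positivity
  set ε := m / (64 * E * B)
  have hε : 0 < ε := by positivity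
  set Cε := (1 / ε) ^ ((1 - p) / β)
  have hCε : 0 < Cε := by positivity
  set Cr := 4 * E / m * (1 + Cε + ε * A)
  have hCr : 0 < Cr := by positivity
  refine ⟨16 * ((1 / δ + 1 + K) * K ^ 2 + Cr * T + 1), by positivity, fun s h R hR => ?_⟩
  refine (s.energy_estimate hα hT hp (G := thermal p) (fun z hz => hasDerivAt_thermal hp1 hz)
    (fun z hz => thermal_nonneg hp.le hp1 hz) hCr.le
    (fun R hR => h.energy_le hK hδ (fun z hz => hasDerivAt_thermal hp1 hz)
      (fun z hz => thermal_le_ent hp1 hz) hR) ?_ hR).2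
  obtain ⟨M, hM⟩ := s.far 1 one_pos
  refine ⟨2 * (|M| + 1), fun L hL t ht => ?_⟩
  have hL0 : 0 < L := by linarith [abs_nonneg M]
  set Dt := ∫ x in (-L)..L, cutoff L x * s.diss p x t
  have hDt : 0 ≤ Dt := intervalIntegral.integral_nonneg (by linarith) fun x _ =>
    mul_nonneg (cutoff_nonneg L x) (s.diss_nonneg hα hp.le x t)
  have hY : ∀ x, s.θ x t ^ (β + 1 - p) ≤ A + 2 * B * Dt := by
    intro x
    rcases le_or_gt |M| |x| with hx | hx
    · have h1 := abs_lt.1 (hM x t ((le_abs_self M).trans hx)).1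
      have h2 : s.θ x t ^ (β + 1 - p) ≤ 2 ^ (β + 1 - p) :=
        Real.rpow_le_rpow (s.θ_pos x t).le (by linarith) (by linarith)
      have h3 : 0 < 2 * (4 * E + 2) ^ (β + 1 - p) := by positivity
      have h4 : 0 ≤ 2 * B * Dt := by positivity
      linarith
    · have h1 := h.rpow_θ_le hα hβ hT hK hδ hp hp1 (x := x) ht
      have h2 : ∫ y in x..(x + 1), s.diss p y t ≤ 2 * Dt := by
        have hx' := abs_lt.1 hx
        refine (integral_mono_interval_of_continuous (f := fun y => s.diss p y t)
          (c := -(|M| + 1)) (d := |M| + 1) (by linarith) (by linarith) (by linarith)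
          (by fun_prop) fun y => s.diss_nonneg hα hp.le y t).trans ?_
        exact integral_le_two_mul_cutoff (f := fun x => s.diss p x t) (by positivity) hL0 hL
          (by fun_prop) fun x => s.diss_nonneg hα hp.le x t
      have h3 := mul_le_mul_of_nonneg_left h2 hB.le
      have h4 : (0:ℝ) < 2 ^ (β + 1 - p) := by positivity
      linarith
  have cent : Continuous fun x => ent (s.θ x t) := by
    unfold ent
    exact ((by fun_prop : Continuous fun x => s.θ x t).sub continuous_const).sub
      (Continuous.log (by fun_prop) fun x => (s.θ_pos x t).ne')
  have h1 : ∫ x in (-L)..L, cutoff L x * s.rem p x t ≤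
      ∫ x in (-L)..L, 2 / m * (1 + Cε + ε * (A + 2 * B * Dt)) * ent (s.θ x t) := by
    refine integral_mono_of_continuous (by linarith) (by fun_prop) (by fun_prop) fun x hx => ?_
    have hθ := s.θ_pos x t
    have hv := s.v_pos x t
    have he := ent_nonneg hθ
    refine (mul_le_of_le_one_left (s.rem_nonneg p x t) (cutoff_le_one hL0 hx)).trans ?_
    have h2 := rpow_mul_sq_le_ent hp.le hp1.le hθ
    have h3 : s.θ x t ^ (1 - p) ≤ Cε + ε * (A + 2 * B * Dt) := by
      refine (rpow_interpolation hβ (by linarith) hε hθ).trans ?_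
      have := hY x
      rw [show β + (1 - p) = β + 1 - p by ring]
      gcongr
    unfold rem
    rw [mul_assoc (1 / 2 : ℝ), div_eq_mul_inv]
    have h4 : (s.v x t)⁻¹ ≤ m⁻¹ := inv_anti₀ hm (hmv s h x t ht).1
    calc 1 / 2 * (s.θ x t ^ p * (s.θ x t * s.θ x t ^ (-p) - 1) ^ 2) * (s.v x t)⁻¹
        ≤ 1 / 2 * (4 * ent (s.θ x t) * (1 + (Cε + ε * (A + 2 * B * Dt)))) * m⁻¹ := by
          apply mul_le_mul _ h4 (by positivity) (by positivity)
          apply mul_le_mul_of_nonneg_left (h2.trans _) (by norm_num)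
          apply mul_le_mul_of_nonneg_left _ (by positivity)
          linarith
      _ = _ := by ring
  rw [intervalIntegral.integral_const_mul] at h1
  have h2 := h.entropy_le_of_le hα hT hK hδ (by linarith : -L ≤ L) ht cent
    fun x => (s.energy_parts x t).1
  have h3 := mul_le_mul_of_nonneg_left h2
    (by positivity : 0 ≤ 2 / m * (1 + Cε + ε * (A + 2 * B * Dt)))
  have h4 : 2 / m * (1 + Cε + ε * (A + 2 * B * Dt)) * (2 * E)
      = Cr + 8 * E * B / m * ε * Dt := by
    simp only [Cr]; ring
  have h5 : 8 * E * B / m * ε = 1 / 8 := by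
    simp only [ε]
    field_simp
    norm_num
  rw [h4, h5] at h3
  linarith

end MHDFlow

theorem rpow_le_one_add_rpow {z a b : ℝ} (hz : 0 < z) (ha : 0 ≤ a) (hab : a ≤ b) :
    z ^ a ≤ 1 + z ^ b := by
  have hb := Real.rpow_pos_of_pos hz b
  rcases le_or_gt 1 z with h | h
  · linarith [Real.rpow_le_rpow_of_exponent_le h hab]
  · linarith [Real.rpow_le_one hz.le h.le ha]

namespace MHDFlow

variable {α β T K δ : ℝ} {s : MHDFlow α β T}

/-- The spatial derivative of the squared norm of the magnetic field. -/
def Sx (s : MHDFlow α β T) (x t : ℝ) : ℝ := 2 * (s.b₁ x t * s.b₁x x t + s.b₂ x t * s.b₂x x t)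

@[fun_prop]
theorem continuous_Sx (s : MHDFlow α β T) {X : Type*} [TopologicalSpace X] {f g : X → ℝ}
    (hf : Continuous f) (hg : Continuous g) : Continuous fun z => s.Sx (f z) (g z) := by
  unfold Sx
  fun_prop

theorem hasDerivAt_S (s : MHDFlow α β T) (x t : ℝ) :
    HasDerivAt (fun y => s.S y t) (s.Sx x t) x := by
  refine (((s.deriv_b₁ x t).pow 2).add ((s.deriv_b₂ x t).pow 2)).congr_deriv ?_
  unfold Sx
  simp
  ring

theorem abs_Sx_le (hα : 0 ≤ α) {p : ℝ} (hp : 0 ≤ p) (x t : ℝ) :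
    |s.Sx x t| ≤ s.diss p x t + s.v x t * s.S x t * s.θ x t ^ p := by
  have hv := s.v_pos x t
  have hθ := s.θ_pos x t
  have hP := Real.rpow_pos_of_pos hθ p
  have h1 : (s.b₁x x t ^ 2 + s.b₂x x t ^ 2) / (s.v x t * s.θ x t ^ p) ≤ s.diss p x t := by
    have h2 : (s.b₁x x t ^ 2 + s.b₂x x t ^ 2) / s.v x t ≤ s.D x t := by
      have := s.one_le_visc hα x t
      have : 0 ≤ visc α (s.v x t) := by linarith
      unfold D
      refine div_le_div_of_nonneg_right ?_ hv.le
      have : 0 ≤ visc α (s.v x t) * s.ux x t ^ 2 + (s.w₁x x t ^ 2 + s.w₂x x t ^ 2) := by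
        positivity
      linarith
    have h3 := mul_le_mul_of_nonneg_left h2 (Real.rpow_pos_of_pos hθ (-p)).le
    have h4 : 0 ≤ p * (s.θ x t ^ (-p - 1) * s.θ x t ^ β) * s.θx x t ^ 2 / s.v x t := by
      positivity
    have e : (s.b₁x x t ^ 2 + s.b₂x x t ^ 2) / (s.v x t * s.θ x t ^ p) =
        s.θ x t ^ (-p) * ((s.b₁x x t ^ 2 + s.b₂x x t ^ 2) / s.v x t) := by
      rw [Real.rpow_neg hθ.le]; field_simp
    unfold diss
    linarith
  refine le_trans ?_ (add_le_add_left h1 _)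
  set a := s.v x t * s.θ x t ^ p
  have ha : 0 < a := by positivity
  have e1 : s.v x t * s.S x t * s.θ x t ^ p = a * s.S x t := by simp only [a]; ring
  rw [e1, abs_le]
  unfold Sx S
  have h5 : (s.b₁x x t ^ 2 + s.b₂x x t ^ 2) / a + a * (s.b₁ x t ^ 2 + s.b₂ x t ^ 2) -
      2 * (s.b₁ x t * s.b₁x x t + s.b₂ x t * s.b₂x x t)
      = ((s.b₁x x t - a * s.b₁ x t) ^ 2 + (s.b₂x x t - a * s.b₂ x t) ^ 2) / a := by
    field_simp; ring
  have h6 : (s.b₁x x t ^ 2 + s.b₂x x t ^ 2) / a + a * (s.b₁ x t ^ 2 + s.b₂ x t ^ 2) +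
      2 * (s.b₁ x t * s.b₁x x t + s.b₂ x t * s.b₂x x t)
      = ((s.b₁x x t + a * s.b₁ x t) ^ 2 + (s.b₂x x t + a * s.b₂ x t) ^ 2) / a := by
    field_simp; ring
  have h7 : 0 ≤ ((s.b₁x x t - a * s.b₁ x t) ^ 2 + (s.b₂x x t - a * s.b₂ x t) ^ 2) / a := by
    positivity
  have h8 : 0 ≤ ((s.b₁x x t + a * s.b₁ x t) ^ 2 + (s.b₂x x t + a * s.b₂ x t) ^ 2) / a := by
    positivity
  constructor <;> linarith

/-- The time integral of the pressure is bounded. -/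
theorem pressInt_bound {T : ℝ} (hα : 0 ≤ α) (hβ : 0 < β) (hT : 0 < T) (hK : 0 < K) (hδ : 0 < δ) :
    ∃ C > 0, ∀ s : MHDFlow α β T, s.InitialBound K δ → ∀ x, ∀ t ∈ Icc (0:ℝ) T,
      s.pressInt x t ≤ C := by
  obtain ⟨m, hm, Cv, hCv, hmv⟩ := volume_bounds β hα hT hK hδ
  set p := min β 1 / 2
  have hp : 0 < p := half_pos (lt_min hβ one_pos)
  have hp1 : p < 1 := by
    have := min_le_right β 1
    simp only [p]; linarith
  have hpβ : p ≤ β := by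
    have := min_le_left β 1
    simp only [p]; linarith [lt_min hβ one_pos]
  obtain ⟨Cd, hCd, hd⟩ := diss_bound (β := β) hα hβ hT hK hδ hp hp1
  have hE := one_le_entBound hK hδ
  set E := entBound K δ with hEd
  set A := 2 * (4 * E + 2) ^ (β + 1 - p)
  set B := 2 * ((β + 1 - p) / 2) ^ 2 * (4 * E + 2) / p
  have hA : 0 < A := by positivity
  have hB : 0 ≤ B := by positivity
  set c₀ := (1 + A) / m + (2 + (1 + A) * (4 * E)) / 2
  set c₁ := B / m + (1 + B * (4 * E)) / 2
  have hc₀ : 0 < c₀ := by positivity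
  have hc₁ : 0 < c₁ := by positivity
  refine ⟨c₀ * T + c₁ * Cd, by positivity, fun s h x t ht => ?_⟩
  obtain ⟨M, hM⟩ := s.far 1 one_pos
  set R := |M| + |x| + 1
  have hM0 := abs_nonneg M
  have hx0 := abs_nonneg x
  have hR0 : 0 < R := by positivity
  have hxR : x ≤ R := by linarith [le_abs_self x]
  have hRx : -R ≤ x := by linarith [neg_abs_le x]
  have key : ∀ r ∈ Icc (0:ℝ) T,
      s.press x r ≤ c₀ + c₁ * ∫ y in (-(R + 1))..(R + 1), s.diss p y r := by
    intro r hr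
    have hdn := fun y => s.diss_nonneg hα hp.le y r
    set Dr := ∫ y in (-(R + 1))..(R + 1), s.diss p y r
    have hY : ∀ y ∈ Icc (-R) R, s.θ y r ^ (β + 1 - p) ≤ A + B * Dr := by
      intro y hy
      refine (h.rpow_θ_le hα hβ hT hK hδ hp hp1 (x := y) hr).trans ?_
      have h2 : ∫ z in y..(y + 1), s.diss p z r ≤ Dr :=
        integral_mono_interval_of_continuous (f := fun y => s.diss p y r)
          (by linarith [hy.1]) (by linarith) (by linarith [hy.2]) (by fun_prop) hdn
      have h3 := mul_le_mul_of_nonneg_left h2 hB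
      linarith
    have hDr : 0 ≤ Dr := intervalIntegral.integral_nonneg (by linarith) fun y _ => hdn y
    have hv := s.v_pos x r
    have hS : s.S x r ≤ 2 + Dr + (1 + (A + B * Dr)) * (4 * E) := by
      have e : ∫ y in x..R, s.Sx y r = s.S R r - s.S x r :=
        intervalIntegral.integral_eq_sub_of_hasDerivAt (fun y _ => s.hasDerivAt_S y r)
          (Continuous.intervalIntegrable (by fun_prop) _ _)
      have h1 : ∫ y in x..R, -s.Sx y r ≤ ∫ y in x..R,
          (s.diss p y r + (1 + (A + B * Dr)) * (s.v y r * s.S y r)) := by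
        refine integral_mono_of_continuous hxR (by fun_prop) (by fun_prop) fun y hy => ?_
        have h2 := s.abs_Sx_le hα hp.le y r
        have h3 := hY y ⟨by linarith [hy.1], hy.2⟩
        have h4 := rpow_le_one_add_rpow (s.θ_pos y r) hp.le (by linarith : p ≤ β + 1 - p)
        have h5 := mul_le_mul_of_nonneg_left (h4.trans (add_le_add_right h3 1))
          (mul_nonneg (s.v_pos y r).le (s.S_nonneg y r))
        linarith [neg_abs_le (s.Sx y r)]
      rw [intervalIntegral.integral_neg, e, integral_add_of_continuous (by fun_prop) (by fun_prop),
        intervalIntegral.integral_const_mul] at h1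
      have h2 : ∫ y in x..R, s.diss p y r ≤ Dr :=
        integral_mono_interval_of_continuous (f := fun y => s.diss p y r)
          (by linarith) (by linarith) (by linarith) (by fun_prop) hdn
      have h3 := mul_le_mul_of_nonneg_left (h.integral_vS_le hα hT hK hδ hxR hr)
        (by positivity : 0 ≤ 1 + (A + B * Dr))
      have h4 : s.S R r ≤ 2 := by
        have h5 := hM R r (by rw [abs_of_pos hR0]; linarith [le_abs_self M])
        have h6 := (sq_lt_one_iff_abs_lt_one _).2 h5.2.2.2.2.1
        have h7 := (sq_lt_one_iff_abs_lt_one _).2 h5.2.2.2.2.2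
        unfold S
        linarith
      linarith
    have hθ : s.θ x r / s.v x r ≤ (1 + (A + B * Dr)) / m := by
      have h1 := rpow_le_one_add_rpow (s.θ_pos x r) zero_le_one (by linarith : 1 ≤ β + 1 - p)
      rw [Real.rpow_one] at h1
      have h2 := hY x ⟨hRx, hxR⟩
      exact div_le_div₀ (by positivity) (by linarith) hm (hmv s h x r hr).1
    unfold press
    calc _ ≤ (1 + (A + B * Dr)) / m + (2 + Dr + (1 + (A + B * Dr)) * (4 * E)) / 2 := by linarith
      _ = _ := by simp only [c₀, c₁]; ring
  have h1 : s.pressInt x t ≤ ∫ r in (0:ℝ)..T, s.press x r :=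
    integral_mono_interval_of_continuous (f := fun r => s.press x r) le_rfl ht.1 ht.2
      (by fun_prop) fun r => s.press_nonneg x r
  have h2 : ∫ r in (0:ℝ)..T, s.press x r ≤
      ∫ r in (0:ℝ)..T, (c₀ + c₁ * ∫ y in (-(R + 1))..(R + 1), s.diss p y r) :=
    integral_mono_of_continuous hT.le (by fun_prop) (by fun_prop) key
  rw [integral_add_of_continuous (by fun_prop) (by fun_prop), intervalIntegral.integral_const,
    intervalIntegral.integral_const_mul, smul_eq_mul, sub_zero] at h2
  have h3 := mul_le_mul_of_nonneg_left (hd s h (R + 1) (by positivity)) hc₁.le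
  linarith

/-- Two-sided bounds of the specific volume. -/
theorem volume_two_sided {T : ℝ} (hα : 0 ≤ α) (hβ : 0 < β) (hT : 0 < T) (hK : 0 < K)
    (hδ : 0 < δ) :
    ∃ m > 0, ∃ V > 0, ∀ s : MHDFlow α β T, s.InitialBound K δ → ∀ x, ∀ t ∈ Icc (0:ℝ) T,
      m ≤ s.v x t ∧ s.v x t ≤ V := by
  obtain ⟨m, hm, Cv, hCv, hmv⟩ := volume_bounds β hα hT hK hδ
  obtain ⟨Cp, hCp, hp⟩ := pressInt_bound hα hβ hT hK hδ
  refine ⟨m, hm, 1 + Cv * Real.exp Cp, by positivity, fun s h x t ht => ?_⟩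
  refine ⟨(hmv s h x t ht).1, (hmv s h x t ht).2.trans ?_⟩
  have := Real.exp_le_exp.2 (hp s h x t ht)
  gcongr

end MHDFlow

theorem Bdd.pow {f : ℝ → ℝ → ℝ} (hf : Bdd f) (n : ℕ) : Bdd fun x t => f x t ^ n := by
  obtain ⟨B, hB⟩ := hf
  refine ⟨B ^ n, fun x t => ?_⟩
  rw [abs_pow]
  exact pow_le_pow_left₀ (abs_nonneg _) (hB x t) n

namespace MHDFlow

variable {α β T K δ : ℝ}

/-- The dissipation rate of the moment `v * S ^ (k + 2)`. -/
def magDiss (s : MHDFlow α β T) (k : ℕ) (x t : ℝ) : ℝ :=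
  2 * ((k:ℝ) + 2) * s.S x t ^ (k + 1) * (s.b₁x x t ^ 2 + s.b₂x x t ^ 2) / s.v x t

/-- The remainder in the estimate of the moment `v * S ^ (k + 2)`. -/
def magRem (s : MHDFlow α β T) (k : ℕ) (x t : ℝ) : ℝ :=
  8 * ((k:ℝ) + 2) ^ 3 * s.v x t *
    (s.u x t ^ 2 * s.S x t ^ (k + 2) + (s.w₁ x t ^ 2 + s.w₂ x t ^ 2) * s.S x t ^ (k + 1))

@[fun_prop]
theorem continuous_magDiss (s : MHDFlow α β T) (k : ℕ) {X : Type*} [TopologicalSpace X]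
    {f g : X → ℝ} (hf : Continuous f) (hg : Continuous g) :
    Continuous fun z => s.magDiss k (f z) (g z) := by
  unfold magDiss
  fun_prop

@[fun_prop]
theorem continuous_magRem (s : MHDFlow α β T) (k : ℕ) {X : Type*} [TopologicalSpace X]
    {f g : X → ℝ} (hf : Continuous f) (hg : Continuous g) :
    Continuous fun z => s.magRem k (f z) (g z) := by
  unfold magRem
  fun_prop

theorem magDiss_nonneg (s : MHDFlow α β T) (k : ℕ) (x t : ℝ) : 0 ≤ s.magDiss k x t := by
  have := s.v_pos x t
  have := s.S_nonneg x t
  unfold magDiss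
  positivity

theorem magRem_nonneg (s : MHDFlow α β T) (k : ℕ) (x t : ℝ) : 0 ≤ s.magRem k x t := by
  have := s.v_pos x t
  have := s.S_nonneg x t
  unfold magRem
  positivity

theorem velocity_term_le {n v u b₁ b₂ c₁ c₂ : ℝ} (hn : 1 ≤ n) (hv : 0 < v) :
    2 * n * (2 * n - 1) * (u * (b₁ * c₁ + b₂ * c₂)) ≤
      n / 2 * ((c₁ ^ 2 + c₂ ^ 2) / v) + 8 * n ^ 3 * v * (u ^ 2 * (b₁ ^ 2 + b₂ ^ 2)) := by
  have e : n / 2 * ((c₁ ^ 2 + c₂ ^ 2) / v) + 8 * n ^ 3 * v * (u ^ 2 * (b₁ ^ 2 + b₂ ^ 2))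
      - 2 * n * (2 * n - 1) * (u * (b₁ * c₁ + b₂ * c₂))
      = n / (2 * v) * ((c₁ - 2 * (2 * n - 1) * v * u * b₁) ^ 2
        + (c₂ - 2 * (2 * n - 1) * v * u * b₂) ^ 2)
        + 2 * n * v * u ^ 2 * ((4 * n ^ 2 - (2 * n - 1) ^ 2) * (b₁ ^ 2 + b₂ ^ 2)) := by
    field_simp; ring
  have h1 : 0 ≤ 4 * n ^ 2 - (2 * n - 1) ^ 2 := by nlinarith
  have : 0 ≤ n := by linarith
  have : 0 ≤ n / (2 * v) * ((c₁ - 2 * (2 * n - 1) * v * u * b₁) ^ 2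
        + (c₂ - 2 * (2 * n - 1) * v * u * b₂) ^ 2)
        + 2 * n * v * u ^ 2 * ((4 * n ^ 2 - (2 * n - 1) ^ 2) * (b₁ ^ 2 + b₂ ^ 2)) := by
    positivity
  linarith

theorem transverse_term_le {n v P Q P' Q' : ℝ} (hn : 1 ≤ n) (hv : 0 < v) :
    -(2 * n * (2 * n - 1) * (P * Q) + 2 * n * (P' * Q')) ≤
      n / 2 * ((P ^ 2 + P' ^ 2) / v) + 8 * n ^ 3 * v * (Q ^ 2 + Q' ^ 2) := by
  have e : n / 2 * ((P ^ 2 + P' ^ 2) / v) + 8 * n ^ 3 * v * (Q ^ 2 + Q' ^ 2)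
      + (2 * n * (2 * n - 1) * (P * Q) + 2 * n * (P' * Q'))
      = n / (2 * v) * ((P + 2 * (2 * n - 1) * v * Q) ^ 2 + (P' + 2 * v * Q') ^ 2)
        + 2 * n * v * ((4 * n ^ 2 - (2 * n - 1) ^ 2) * Q ^ 2 + (4 * n ^ 2 - 1) * Q' ^ 2) := by
    field_simp; ring
  have h1 : 0 ≤ 4 * n ^ 2 - (2 * n - 1) ^ 2 := by nlinarith
  have h2 : 0 ≤ 4 * n ^ 2 - 1 := by nlinarith
  have : 0 ≤ n := by linarith
  have : 0 ≤ n / (2 * v) * ((P + 2 * (2 * n - 1) * v * Q) ^ 2 + (P' + 2 * v * Q') ^ 2)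
        + 2 * n * v * ((4 * n ^ 2 - (2 * n - 1) ^ 2) * Q ^ 2 + (4 * n ^ 2 - 1) * Q' ^ 2) := by
    positivity
  linarith

/-- Estimate of a moment of the magnetic field. -/
theorem moment_estimate (s : MHDFlow α β T) (hT : 0 < T) (k : ℕ) {E₀ Cr : ℝ}
    (hCr : 0 ≤ Cr) (hE₀ : ∀ R, 0 ≤ R → ∫ x in (-R)..R, s.v x 0 * s.S x 0 ^ (k + 2) ≤ E₀)
    (hr : ∃ L₀, ∀ L ≥ L₀, ∀ t ∈ Icc (0:ℝ) T,
      ∫ x in (-L)..L, cutoff L x * s.magRem k x t ≤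
        Cr + 1 / 8 * ∫ x in (-L)..L, cutoff L x * s.magDiss k x t)
    {R : ℝ} (hR : 0 ≤ R) :
    ∀ t ∈ Icc (0:ℝ) T, ∫ x in (-R)..R, s.v x t * s.S x t ^ (k + 2) ≤ 2 * (E₀ + Cr * T + 1) := by
  set n : ℝ := (k:ℝ) + 2 with hn
  have hn2 : 2 ≤ n := by have : (0:ℝ) ≤ k := by positivity
                         linarith
  refine (energy_bound hT (η := fun x t => s.v x t * s.S x t ^ (k + 2))
    (ηt := fun x t => s.ux x t * s.S x t ^ (k + 2) + n * s.v x t * s.S x t ^ (k + 1) *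
      (2 * (s.b₁ x t * s.b₁t x t + s.b₂ x t * s.b₂t x t)))
    (F := fun x t => (1 - 2 * n) * (s.u x t * s.S x t ^ (k + 2))
      + 2 * n * (s.S x t ^ (k + 1) * (s.b₁ x t * s.w₁ x t + s.b₂ x t * s.w₂ x t))
      + 2 * n * (s.S x t ^ (k + 1) * (s.b₁ x t * (s.b₁x x t / s.v x t)
        + s.b₂ x t * (s.b₂x x t / s.v x t))))
    (A := fun x t => (1 - 2 * n) * (s.u x t * s.S x t ^ (k + 2))
      + 2 * n * (s.S x t ^ (k + 1) * (s.b₁ x t * s.w₁ x t + s.b₂ x t * s.w₂ x t)))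
    (d := s.magDiss k) (r := s.magRem k)
    (q := fun x t => (1 - 2 * n) * (u s x t * (n * s.S x t ^ (k + 1) * s.Sx x t))
      + 2 * n * ((n - 1) * s.S x t ^ k * s.Sx x t * (s.b₁ x t * s.w₁ x t + s.b₂ x t * s.w₂ x t)
        + s.S x t ^ (k + 1) * (s.b₁x x t * s.w₁ x t + s.b₂x x t * s.w₂ x t))
      + 2 * n * ((n - 1) * s.S x t ^ k * s.Sx x t * (s.b₁ x t * s.b₁x x t + s.b₂ x t * s.b₂x x t)
        + s.S x t ^ (k + 1) * (s.b₁x x t ^ 2 + s.b₂x x t ^ 2)) / s.v x t)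
    ?_ ?_ ?_ ?_ ?_ ?_ ?_ ?_ ?_ ?_ ?_ ?_ ?_ hCr hE₀ hr hR).1
  · unfold Function.uncurry; fun_prop
  · unfold Function.uncurry; fun_prop
  · unfold Function.uncurry; fun_prop
  · unfold Function.uncurry; fun_prop
  · unfold Function.uncurry; fun_prop
  · intro x t ht
    have h1 := ((s.time_b₁ x t ht).pow 2).add ((s.time_b₂ x t ht).pow 2)
    refine HasDerivWithinAt.congr_deriv ((s.time_v x t ht).mul (h1.pow (k + 2))) ?_
    simp only [Pi.add_apply, Pi.pow_apply, S, hn]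
    push_cast
    ring
  · intro x t
    have hv := s.v_pos x t
    have hS := s.hasDerivAt_S x t
    have h1 := ((s.deriv_u x t).mul (hS.pow (k + 2))).const_mul (1 - 2 * n)
    have h2 := ((hS.pow (k + 1)).mul (((s.deriv_b₁ x t).mul (s.deriv_w₁ x t)).add
      ((s.deriv_b₂ x t).mul (s.deriv_w₂ x t)))).const_mul (2 * n)
    have h3 := ((hS.pow (k + 1)).mul (((s.deriv_b₁ x t).mul (s.flux_b₁ x t)).add
      ((s.deriv_b₂ x t).mul (s.flux_b₂ x t)))).const_mul (2 * n)
    refine HasDerivAt.congr_deriv ((h1.add h2).add h3) ?_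
    simp only [Pi.add_apply, Pi.pow_apply, Pi.mul_apply, hn]
    push_cast
    have e : s.S x t ^ (k + 2) = s.S x t ^ (k + 1) * (s.b₁ x t ^ 2 + s.b₂ x t ^ 2) := by
      rw [pow_succ]; rfl
    rw [e]
    field_simp
    ring
  · intro x t
    have hv := s.v_pos x t
    have hS := s.S_nonneg x t
    have hZ : 0 ≤ s.S x t ^ k := by positivity
    have h1 := mul_le_mul_of_nonneg_left (velocity_term_le (n := n) (v := s.v x t) (u := s.u x t)
      (b₁ := s.b₁ x t) (b₂ := s.b₂ x t) (c₁ := s.b₁x x t) (c₂ := s.b₂x x t) (by linarith) hv)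
      (mul_nonneg hZ hS)
    have h2 := mul_le_mul_of_nonneg_left (transverse_term_le (n := n) (v := s.v x t)
      (P := s.b₁ x t * s.b₁x x t + s.b₂ x t * s.b₂x x t)
      (Q := s.b₁ x t * s.w₁ x t + s.b₂ x t * s.w₂ x t)
      (P' := s.b₁ x t * s.b₂x x t - s.b₂ x t * s.b₁x x t)
      (Q' := s.b₁ x t * s.w₂ x t - s.b₂ x t * s.w₁ x t) (by linarith) hv) hZ
    have h3 : 0 ≤ 2 * n * ((n - 1) * s.S x t ^ k *
        (2 * (s.b₁ x t * s.b₁x x t + s.b₂ x t * s.b₂x x t) ^ 2)) / s.v x t := by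
      have : 0 ≤ n - 1 := by linarith
      positivity
    refine le_of_sub_nonneg (le_of_le_of_eq
      (add_nonneg h3 (add_nonneg (sub_nonneg.2 h1) (sub_nonneg.2 h2))) ?_)
    simp only [magDiss, magRem, Sx, pow_succ, ← hn]
    generalize s.S x t ^ k = Z at *
    unfold S
    field_simp
    ring
  · intro x t
    have := s.v_pos x t
    have := s.S_nonneg x t
    positivity
  · exact s.magDiss_nonneg k
  · obtain ⟨B, hB⟩ := (((s.bdd_S).pow (k + 2)).mul s.bdd_inv_v).mul (bdd_const (2 * n))
    refine ⟨B, fun x t => ?_⟩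
    have hv := s.v_pos x t
    have hS := s.S_nonneg x t
    have h1 := mul_le_mul_of_nonneg_right ((le_abs_self _).trans (hB x t)) (s.magDiss_nonneg k x t)
    refine le_trans (le_of_eq_of_le ?_ (?_ : 4 * n ^ 2 * (s.S x t ^ (k + 1)) ^ 2 * (s.v x t)⁻¹ ^ 2 *
      (s.b₁ x t * s.b₁x x t + s.b₂ x t * s.b₂x x t) ^ 2 ≤
      4 * n ^ 2 * (s.S x t ^ (k + 1)) ^ 2 * (s.v x t)⁻¹ ^ 2 *
      (s.S x t * (s.b₁x x t ^ 2 + s.b₂x x t ^ 2)))) (le_of_eq_of_le ?_ h1)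
    · field_simp; ring
    · refine mul_le_mul_of_nonneg_left ?_ (by positivity)
      unfold S
      nlinarith [sq_nonneg (s.b₁ x t * s.b₂x x t - s.b₂ x t * s.b₁x x t)]
    · unfold magDiss
      rw [← hn]
      ring
  · exact ((bdd_const _).mul (s.bdd_u.mul (s.bdd_S.pow _))).add ((bdd_const _).mul
      ((s.bdd_S.pow _).mul ((s.bdd_b₁.mul s.bdd_w₁).add (s.bdd_b₂.mul s.bdd_w₂))))
  · have h1 := (s.decays_u.mul_bdd ((bdd_const (1 - 2 * n)).mul (s.bdd_S.pow (k + 2))))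
    have h2 := ((s.decays_b₁.mul_bdd s.bdd_w₁).add (s.decays_b₂.mul_bdd s.bdd_w₂)).mul_bdd
      ((bdd_const (2 * n)).mul (s.bdd_S.pow (k + 1)))
    refine (h1.add h2).mono fun x t => le_of_eq ?_
    congr 1
    ring

end MHDFlow

namespace MHDFlow

variable {α β T K δ : ℝ} {s : MHDFlow α β T}

/-- Pointwise bound of a power of the magnetic field by the dissipation and a lower moment. -/
theorem pow_S_le {a y M D t : ℝ} {m k : ℕ} (hk : 2 * m = k + 2) (ha : 0 < a)
    (hM : 0 ≤ M) (hfar : ∀ x, M ≤ |x| → s.S x t ≤ 1)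
    (hD : ∫ x in (-M)..M, s.magDiss k x t ≤ D)
    (hy : ∫ x in (-M)..M, s.v x t * s.S x t ^ m ≤ y) (x : ℝ) :
    s.S x t ^ (k + 2) ≤ 2 + 2 * a * D + ((k:ℝ) + 2) ^ 2 * y ^ 2 / (4 * a ^ 2) := by
  set n : ℝ := (k:ℝ) + 2 with hn
  have hn0 : 0 < n := by positivity
  have hMM : -M ≤ M := by linarith
  have hdn := fun y => s.magDiss_nonneg k y t
  have hvS : ∀ x, 0 ≤ s.v x t * s.S x t ^ m := fun x => by
    have := s.v_pos x t
    have := s.S_nonneg x t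
    positivity
  have hD0 : 0 ≤ D := (intervalIntegral.integral_nonneg hMM fun y _ => hdn y).trans hD
  have hY : 2 ≤ 2 + 2 * a * D + n ^ 2 * y ^ 2 / (4 * a ^ 2) := by
    have : 0 ≤ 2 * a * D + n ^ 2 * y ^ 2 / (4 * a ^ 2) := by positivity
    linarith
  rcases le_or_gt M |x| with hx | hx
  · have := pow_le_one₀ (n := k + 2) (s.S_nonneg x t) (hfar x hx)
    linarith
  obtain ⟨z, hz, hmax⟩ := (isCompact_Icc (a := -M) (b := M)).exists_isMaxOn
    ⟨M, hMM, le_rfl⟩ (f := fun y => s.S y t) (Continuous.continuousOn (by fun_prop))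
  have hxz : s.S x t ≤ s.S z t := hmax ⟨(abs_lt.1 hx).1.le, (abs_lt.1 hx).2.le⟩
  refine (pow_le_pow_left₀ (s.S_nonneg x t) hxz _).trans ?_
  have hQ := s.S_nonneg z t
  set Q := s.S z t with hQd
  have e : ∫ x in z..M, ((k + 2 : ℕ):ℝ) * s.S x t ^ (k + 1) * s.Sx x t
      = s.S M t ^ (k + 2) - Q ^ (k + 2) :=
    intervalIntegral.integral_eq_sub_of_hasDerivAt (fun x _ => (s.hasDerivAt_S x t).pow (k + 2))
      (Continuous.intervalIntegrable (by fun_prop) _ _)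
  have h1 : ∫ x in z..M, -(((k + 2 : ℕ):ℝ) * s.S x t ^ (k + 1) * s.Sx x t) ≤
      ∫ x in z..M, (a * s.magDiss k x t + n / (2 * a) * Q ^ m * (s.v x t * s.S x t ^ m)) := by
    refine integral_mono_of_continuous hz.2 (by fun_prop) (by fun_prop) fun x hx => ?_
    have hv := s.v_pos x t
    have hS := s.S_nonneg x t
    have hle : s.S x t ≤ Q := hmax ⟨hz.1.trans hx.1, hx.2⟩
    have h2 : s.S x t ^ (k + 2) ≤ Q ^ m * s.S x t ^ m := by
      rw [← hk, two_mul, pow_add]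
      gcongr
    have h3 := mul_le_mul_of_nonneg_left h2 (by positivity : 0 ≤ n / (2 * a) * s.v x t)
    have h4 : a * s.magDiss k x t + n / (2 * a) * s.v x t * s.S x t ^ (k + 2)
        + ((k + 2 : ℕ):ℝ) * s.S x t ^ (k + 1) * s.Sx x t
        = n * s.S x t ^ (k + 1) * (2 * a / s.v x t *
          ((s.b₁x x t + s.v x t * s.b₁ x t / (2 * a)) ^ 2
            + (s.b₂x x t + s.v x t * s.b₂ x t / (2 * a)) ^ 2)) := by
      rw [pow_succ _ (k + 1)]
      unfold magDiss Sx
      push_cast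
      rw [← hn]
      generalize s.S x t ^ (k + 1) = Z
      unfold S
      field_simp
      ring
    have h5 : 0 ≤ n * s.S x t ^ (k + 1) * (2 * a / s.v x t *
          ((s.b₁x x t + s.v x t * s.b₁ x t / (2 * a)) ^ 2
            + (s.b₂x x t + s.v x t * s.b₂ x t / (2 * a)) ^ 2)) := by positivity
    linarith
  rw [intervalIntegral.integral_neg, e, integral_add_of_continuous (by fun_prop) (by fun_prop),
    intervalIntegral.integral_const_mul, intervalIntegral.integral_const_mul] at h1
  have h2 : ∫ x in z..M, s.magDiss k x t ≤ D :=
    (integral_mono_interval_of_continuous (f := fun y => s.magDiss k y t) hz.1 hz.2 le_rfl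
      (by fun_prop) hdn).trans hD
  have h3 : ∫ x in z..M, s.v x t * s.S x t ^ m ≤ y :=
    (integral_mono_interval_of_continuous (f := fun y => s.v y t * s.S y t ^ m) hz.1 hz.2 le_rfl
      (by fun_prop) hvS).trans hy
  have h4 := mul_le_mul_of_nonneg_left h2 ha.le
  have h5 := mul_le_mul_of_nonneg_left h3 (by positivity : 0 ≤ n / (2 * a) * Q ^ m)
  have h6 : s.S M t ^ (k + 2) ≤ 1 :=
    pow_le_one₀ (s.S_nonneg M t) (hfar M (le_abs_self M))
  have h7 : Q ^ (k + 2) = (Q ^ m) ^ 2 := by rw [← hk, mul_comm, pow_mul]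
  have h8 : n ^ 2 * y ^ 2 / (4 * a ^ 2) = (n / (2 * a) * y) ^ 2 := by
    field_simp; ring
  rw [h8]
  rw [h7] at h1 ⊢
  nlinarith [sq_nonneg (Q ^ m - n / (2 * a) * y)]

theorem InitialBound.initial_moment_le (h : s.InitialBound K δ) (hK : 0 < K) (n : ℕ) {R : ℝ}
    (hR : 0 ≤ R) :
    ∫ x in (-R)..R, s.v x 0 * s.S x 0 ^ (n + 1) ≤ (1 + K) * (K ^ 2) ^ (n + 1) := by
  have hRR : -R ≤ R := by linarith
  have h1 : ∫ x in (-R)..R, s.v x 0 * s.S x 0 ^ (n + 1) ≤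
      ∫ x in (-R)..R, (1 + K) * (K ^ 2) ^ n * ((s.v x 0 - 1) ^ 2 + s.u x 0 ^ 2
        + (s.θ x 0 - 1) ^ 2 + s.S x 0 + (s.w₁ x 0 ^ 2 + s.w₂ x 0 ^ 2)) := by
    refine integral_mono_of_continuous hRR (by fun_prop) (by fun_prop) fun x _ => ?_
    have hS := s.S_nonneg x 0
    have hv := s.v_pos x 0
    have h2 : s.S x 0 ≤ (s.v x 0 - 1) ^ 2 + s.u x 0 ^ 2
        + (s.θ x 0 - 1) ^ 2 + s.S x 0 + (s.w₁ x 0 ^ 2 + s.w₂ x 0 ^ 2) := by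
      nlinarith [sq_nonneg (s.v x 0 - 1), sq_nonneg (s.u x 0), sq_nonneg (s.θ x 0 - 1),
        sq_nonneg (s.w₁ x 0), sq_nonneg (s.w₂ x 0)]
    calc s.v x 0 * s.S x 0 ^ (n + 1) = s.v x 0 * s.S x 0 ^ n * s.S x 0 := by ring
      _ ≤ (1 + K) * (K ^ 2) ^ n * s.S x 0 := by
          have := h.v_le x
          have := pow_le_pow_left₀ hS (h.S_le x) n
          gcongr
      _ ≤ _ := mul_le_mul_of_nonneg_left h2 (by positivity)
  rw [intervalIntegral.integral_const_mul] at h1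
  refine (h1.trans (mul_le_mul_of_nonneg_left (h.integral_le R hR) (by positivity))).trans
    (le_of_eq (by ring))

/-- Control of a moment of the magnetic field by the moment of half the order. -/
theorem moment_step {T : ℝ} (hα : 0 ≤ α) (hβ : 0 < β) (hT : 0 < T) (hK : 0 < K) (hδ : 0 < δ) :
    ∃ c ≥ 1, ∀ s : MHDFlow α β T, s.InitialBound K δ → ∀ m : ℕ, 1 ≤ m → ∀ y : ℝ, 1 ≤ y →
      (K ^ 2) ^ m ≤ y →
      (∀ R, 0 ≤ R → ∀ t ∈ Icc (0:ℝ) T, ∫ x in (-R)..R, s.v x t * s.S x t ^ m ≤ y) →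
      ∀ R, 0 ≤ R → ∀ t ∈ Icc (0:ℝ) T,
        ∫ x in (-R)..R, s.v x t * s.S x t ^ (2 * m) ≤ c * ((2 * m : ℕ):ℝ) ^ 11 * y ^ 2 := by
  obtain ⟨m₀, hm₀, V, hV, hvV⟩ := volume_two_sided (β := β) hα hβ hT hK hδ
  have hE := one_le_entBound hK hδ
  set E := entBound K δ with hEd
  refine ⟨2 * ((1 + K) + 32 * V * E * (3 + 2 ^ 18 * V ^ 2 * E ^ 2) * T + 1), ?_,
    fun s h m hm y hy hKy hmom => ?_⟩
  · have : 0 ≤ 32 * V * E * (3 + 2 ^ 18 * V ^ 2 * E ^ 2) * T := by positivity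
    linarith
  obtain ⟨k, hk⟩ : ∃ k, 2 * m = k + 2 := ⟨2 * m - 2, by omega⟩
  rw [hk]
  set n : ℝ := (k:ℝ) + 2 with hn
  have hn1 : 1 ≤ n := by
    have : (0:ℝ) ≤ k := by positivity
    linarith
  have hn0 : 0 < n := by linarith
  have hcast : ((k + 2 : ℕ):ℝ) = n := by push_cast; rw [hn]
  rw [hcast]
  set Cr := 32 * n ^ 3 * V * E * (3 + 2 ^ 18 * n ^ 8 * V ^ 2 * E ^ 2 * y ^ 2)
  have hCr : 0 ≤ Cr := by positivity
  intro R hR t ht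
  refine (s.moment_estimate hT k (E₀ := (1 + K) * y ^ 2) (Cr := Cr) hCr ?_ ?_ hR t ht).trans ?_
  · intro R hR
    refine (h.initial_moment_le hK (k + 1) hR).trans ?_
    refine mul_le_mul_of_nonneg_left ?_ (by positivity)
    calc (K ^ 2) ^ (k + 1 + 1) = ((K ^ 2) ^ m) ^ 2 := by rw [← pow_mul (K ^ 2) m 2, mul_comm m 2, hk]
      _ ≤ _ := pow_le_pow_left₀ (by positivity) hKy 2
  · obtain ⟨M', hM'⟩ := s.decays_S 1 one_pos
    set M := |M'| + 1
    have hM : 0 < M := by positivity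
    refine ⟨2 * M, fun L hL t ht => ?_⟩
    have hL0 : 0 < L := by linarith
    set Dt := ∫ x in (-L)..L, cutoff L x * s.magDiss k x t
    set a := 1 / (1024 * n ^ 3 * V * E) with had
    have ha : 0 < a := by positivity
    have hY := pow_S_le (s := s) (t := t) (D := 2 * Dt) (y := y) hk ha hM.le
      (fun x hx => (le_abs_self _).trans (hM' x t (by linarith [le_abs_self M'])))
      (integral_le_two_mul_cutoff (f := fun x => s.magDiss k x t) hM.le hL0 hL
        (by fun_prop) fun x => s.magDiss_nonneg k x t) (hmom M hM.le t ht)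
    rw [← hn] at hY
    set Y := 2 + 2 * a * (2 * Dt) + n ^ 2 * y ^ 2 / (4 * a ^ 2) with hYd
    have hY0 : 0 ≤ Y := (pow_nonneg (s.S_nonneg 0 t) _).trans (hY 0)
    have h1 : ∫ x in (-L)..L, cutoff L x * s.magRem k x t ≤ ∫ x in (-L)..L,
        16 * n ^ 3 * V * (1 + Y) * ((s.u x t ^ 2 + (s.w₁ x t ^ 2 + s.w₂ x t ^ 2)) / 2) := by
      refine integral_mono_of_continuous (by linarith) (by fun_prop) (by fun_prop) fun x hx => ?_
      refine (mul_le_of_le_one_left (s.magRem_nonneg k x t) (cutoff_le_one hL0 hx)).trans ?_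
      have hS := s.S_nonneg x t
      have hv := s.v_pos x t
      have h2 : s.S x t ^ (k + 2) ≤ 1 + Y := by linarith [hY x]
      have h3 : s.S x t ^ (k + 1) ≤ 1 + Y := by
        rcases le_or_gt 1 (s.S x t) with h4 | h4
        · exact (pow_le_pow_right₀ h4 (by omega)).trans h2
        · linarith [pow_le_one₀ (n := k + 1) hS h4.le]
      unfold magRem
      rw [← hn]
      calc _ ≤ 8 * n ^ 3 * V * (s.u x t ^ 2 * (1 + Y) +
            (s.w₁ x t ^ 2 + s.w₂ x t ^ 2) * (1 + Y)) := by
            have := (hvV s h x t ht).2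
            gcongr
        _ = _ := by ring
    rw [intervalIntegral.integral_const_mul] at h1
    have h2 := h.entropy_le_of_le (f := fun x => (s.u x t ^ 2 + (s.w₁ x t ^ 2 + s.w₂ x t ^ 2)) / 2)
      hα hT hK hδ (by linarith : -L ≤ L) ht (by fun_prop) fun x => by
        have := (s.energy_parts x t).2.2
        have := mul_nonneg (s.v_pos x t).le (s.S_nonneg x t)
        linarith
    have h3 := mul_le_mul_of_nonneg_left h2 (by positivity : 0 ≤ 16 * n ^ 3 * V * (1 + Y))
    refine (h1.trans h3).trans (le_of_eq ?_)
    rw [hYd, had, ← hEd]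
    simp only [Cr]
    field_simp
    ring
  · have hn8 : 1 ≤ n ^ 8 := one_le_pow₀ hn1
    have hn11 : 1 ≤ n ^ 11 := one_le_pow₀ hn1
    have hy2 : 1 ≤ y ^ 2 := one_le_pow₀ hy
    have h1 : 1 ≤ n ^ 11 * y ^ 2 := one_le_mul_of_one_le_of_one_le hn11 hy2
    have h2 : 3 + 2 ^ 18 * n ^ 8 * V ^ 2 * E ^ 2 * y ^ 2 ≤
        (3 + 2 ^ 18 * V ^ 2 * E ^ 2) * (n ^ 8 * y ^ 2) := by
      have := one_le_mul_of_one_le_of_one_le hn8 hy2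
      nlinarith
    have h3 : Cr * T ≤ 32 * V * E * (3 + 2 ^ 18 * V ^ 2 * E ^ 2) * T * (n ^ 11 * y ^ 2) := by
      have := mul_le_mul_of_nonneg_left h2 (by positivity : 0 ≤ 32 * n ^ 3 * V * E * T)
      calc _ = 32 * n ^ 3 * V * E * T * (3 + 2 ^ 18 * n ^ 8 * V ^ 2 * E ^ 2 * y ^ 2) := by
            simp only [Cr]; ring
        _ ≤ _ := this
        _ = _ := by ring
    have h4 : (1 + K) * y ^ 2 ≤ (1 + K) * (n ^ 11 * y ^ 2) :=
      mul_le_mul_of_nonneg_left (le_mul_of_one_le_left (by positivity) hn11) (by positivity)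
    linarith

end MHDFlow

namespace MHDFlow

variable {α β K δ : ℝ}

/-- Bounds of the dyadic moments of the magnetic field, of geometric growth. -/
theorem dyadic_moment_bound {T : ℝ} (hα : 0 ≤ α) (hβ : 0 < β) (hT : 0 < T) (hK : 0 < K)
    (hδ : 0 < δ) :
    ∃ Λ > 0, ∀ s : MHDFlow α β T, s.InitialBound K δ → ∀ k : ℕ, ∀ R, 0 ≤ R →
      ∀ t ∈ Icc (0:ℝ) T, ∫ x in (-R)..R, s.v x t * s.S x t ^ (2 ^ k) ≤ Λ ^ (2 ^ k) := by
  obtain ⟨c, hc, hstep⟩ := moment_step (β := β) hα hβ hT hK hδ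
  have hE := one_le_entBound hK hδ
  set E := entBound K δ with hEd
  set Λ := c * 4 ^ 11 * (4 * E + K ^ 2)
  have hΛ : 0 < Λ := by positivity
  refine ⟨Λ, hΛ, fun s h => ?_⟩
  set M : ℕ → ℝ := fun k => Λ ^ (2 ^ k) / (c * (4 * 2 ^ k) ^ 11) with hM
  have hM0 : M 0 = 4 * E + K ^ 2 := by
    simp only [hM, Λ]
    norm_num
    field_simp
  have hMs : ∀ k, M (k + 1) = c * ((2 * 2 ^ k : ℕ):ℝ) ^ 11 * M k ^ 2 := fun k => by
    simp only [hM]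
    push_cast
    rw [pow_succ 2 k, pow_mul, pow_succ (2:ℝ) k]
    field_simp
    ring
  have hle : ∀ k, M k ^ 2 ≤ M (k + 1) := fun k => by
    rw [hMs]
    refine le_mul_of_one_le_left (sq_nonneg _) (one_le_mul_of_one_le_of_one_le hc ?_)
    refine one_le_pow₀ ?_
    exact_mod_cast Nat.mul_pos two_pos (pow_pos two_pos k)
  have key : ∀ k, 1 ≤ M k ∧ (K ^ 2) ^ (2 ^ k) ≤ M k ∧ ∀ R, 0 ≤ R → ∀ t ∈ Icc (0:ℝ) T,
      ∫ x in (-R)..R, s.v x t * s.S x t ^ (2 ^ k) ≤ M k := by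
    intro k
    induction k with
    | zero =>
      rw [hM0]
      refine ⟨by nlinarith [sq_nonneg K], by simp; linarith, fun R hR t ht => ?_⟩
      have := h.integral_vS_le hα hT hK hδ (by linarith : -R ≤ R) ht
      simp only [pow_zero, pow_one]
      linarith [sq_nonneg K]
    | succ k ih =>
      obtain ⟨h1, h2, h3⟩ := ih
      refine ⟨(one_le_pow₀ h1).trans (hle k), ?_, ?_⟩
      · refine le_trans ?_ (hle k)
        rw [pow_succ 2 k, pow_mul]
        exact pow_le_pow_left₀ (by positivity) h2 2
      · intro R hR t ht
        rw [hMs, pow_succ' 2 k]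
        exact hstep s h (2 ^ k) (Nat.one_le_two_pow) (M k) h1 h2 h3 R hR t ht
  intro k R hR t ht
  refine ((key k).2.2 R hR t ht).trans (div_le_self (by positivity) ?_)
  refine one_le_mul_of_one_le_of_one_le hc (one_le_pow₀ ?_)
  have : (1:ℝ) ≤ 2 ^ k := one_le_pow₀ (by norm_num)
  linarith

/-- Uniform bound of the magnetic field. -/
theorem S_bound {T : ℝ} (hα : 0 ≤ α) (hβ : 0 < β) (hT : 0 < T) (hK : 0 < K) (hδ : 0 < δ) :
    ∃ C > 0, ∀ s : MHDFlow α β T, s.InitialBound K δ → ∀ x, ∀ t ∈ Icc (0:ℝ) T, s.S x t ≤ C := by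
  obtain ⟨m, hm, V, hV, hmV⟩ := volume_two_sided (β := β) hα hβ hT hK hδ
  obtain ⟨Λ, hΛ, hmom⟩ := dyadic_moment_bound (β := β) hα hβ hT hK hδ
  refine ⟨Λ, hΛ, fun s h x t ht => ?_⟩
  by_contra! hx
  set Λ' := (Λ + s.S x t) / 2
  have hΛ' : Λ < Λ' := by simp only [Λ']; linarith
  have hx' : Λ' < s.S x t := by simp only [Λ']; linarith
  have hΛ'0 : 0 < Λ' := hΛ.trans hΛ'
  have hcont : Continuous fun y => s.S y t := by fun_prop
  obtain ⟨ε, hε, hball⟩ := Metric.mem_nhds_iff.1 (hcont.continuousAt.eventually_mem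
    (Ioi_mem_nhds hx'))
  have hlow : ∀ y ∈ Icc x (x + ε / 2), Λ' ≤ s.S y t := fun y hy => by
    refine le_of_lt (hball ?_)
    rw [Metric.mem_ball, Real.dist_eq, abs_lt]
    constructor <;> linarith [hy.1, hy.2]
  have hR : 0 ≤ |x| + ε := by positivity
  have key : ∀ k : ℕ, (Λ' / Λ) ^ (2 ^ k) ≤ 1 / (m * (ε / 2)) := by
    intro k
    have h1 : ∫ y in x..(x + ε / 2), m * Λ' ^ (2 ^ k) ≤
        ∫ y in x..(x + ε / 2), s.v y t * s.S y t ^ (2 ^ k) := by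
      refine integral_mono_of_continuous (by linarith) (by fun_prop) (by fun_prop) fun y hy => ?_
      have := (hmV s h y t ht).1
      have := hlow y hy
      have := s.v_pos y t
      gcongr
    have h2 : ∫ y in x..(x + ε / 2), s.v y t * s.S y t ^ (2 ^ k) ≤
        ∫ y in (-(|x| + ε))..(|x| + ε), s.v y t * s.S y t ^ (2 ^ k) :=
      integral_mono_interval_of_continuous (f := fun y => s.v y t * s.S y t ^ (2 ^ k))
        (by linarith [neg_abs_le x]) (by linarith) (by linarith [le_abs_self x]) (by fun_prop)
        fun y => by
          have := s.v_pos y t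
          have := s.S_nonneg y t
          positivity
    have h3 := h1.trans (h2.trans (hmom s h k _ hR t ht))
    rw [intervalIntegral.integral_const, smul_eq_mul] at h3
    rw [div_pow, div_le_div_iff₀ (by positivity) (by positivity)]
    linarith
  obtain ⟨n, hn⟩ := pow_unbounded_of_one_lt (1 / (m * (ε / 2))) ((one_lt_div hΛ).2 hΛ')
  have h1 := pow_le_pow_right₀ ((one_lt_div hΛ).2 hΛ').le (Nat.lt_two_pow_self (n := n)).le
  linarith [key n]

end MHDFlow

theorem le_integral_of_neg_deriv_le {F F' g : ℝ → ℝ} {I : ℝ} (hF : ∀ x, HasDerivAt F (F' x) x)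
    (hF' : Continuous F') (hg : Continuous g) (hg0 : ∀ x, 0 ≤ g x) (hgi : Integrable g)
    (hle : ∀ x, -F' x ≤ g x) (hlim : ∀ ε > 0, ∃ M, ∀ x, M ≤ |x| → F x ≤ ε)
    (hI : ∫ x, g x ≤ I) (x : ℝ) : F x ≤ I := by
  refine le_of_forall_pos_le_add fun ε hε => ?_
  obtain ⟨M, hM⟩ := hlim ε hε
  set R := max x M with hR
  have hxR : x ≤ R := le_max_left _ _
  have h1 : ∫ y in x..R, F' y = F R - F x :=
    intervalIntegral.integral_eq_sub_of_hasDerivAt (fun y _ => hF y) (hF'.intervalIntegrable _ _)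
  have h2 : ∫ y in x..R, -F' y ≤ ∫ y in x..R, g y :=
    intervalIntegral.integral_mono_on hxR (hF'.neg.intervalIntegrable _ _)
      (hg.intervalIntegrable _ _) fun y _ => hle y
  have h3 : ∫ y in x..R, g y ≤ ∫ y, g y := by
    rw [intervalIntegral.integral_of_le hxR]
    exact setIntegral_le_integral hgi (Eventually.of_forall hg0)
  rw [intervalIntegral.integral_neg, h1] at h2
  have h4 := hM R ((le_max_right _ _).trans (le_abs_self _))
  linarith

theorem HasDerivWithinAt.prod_fst {f : ℝ → ℝ × ℝ} {f' : ℝ × ℝ} {s : Set ℝ} {x : ℝ}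
    (h : HasDerivWithinAt f f' s x) : HasDerivWithinAt (fun y => (f y).1) f'.1 s x :=
  hasFDerivAt_fst.comp_hasDerivWithinAt (f := f) x h

theorem HasDerivWithinAt.prod_snd {f : ℝ → ℝ × ℝ} {f' : ℝ × ℝ} {s : Set ℝ} {x : ℝ}
    (h : HasDerivWithinAt f f' s x) : HasDerivWithinAt (fun y => (f y).2) f'.2 s x :=
  hasFDerivAt_snd.comp_hasDerivWithinAt (f := f) x h

theorem HasDerivAt.prod_fst {f : ℝ → ℝ × ℝ} {f' : ℝ × ℝ} {x : ℝ}
    (h : HasDerivAt f f' x) : HasDerivAt (fun y => (f y).1) f'.1 x :=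
  hasFDerivAt_fst.comp_hasDerivAt (f := f) x h

theorem HasDerivAt.prod_snd {f : ℝ → ℝ × ℝ} {f' : ℝ × ℝ} {x : ℝ}
    (h : HasDerivAt f f' x) : HasDerivAt (fun y => (f y).2) f'.2 x :=
  hasFDerivAt_snd.comp_hasDerivAt (f := f) x h

/-- Clamping of a time to the interval `[0, T]`. -/
def clamp (T t : ℝ) : ℝ := max 0 (min t T)

theorem clamp_mem {T : ℝ} (hT : 0 < T) (t : ℝ) : clamp T t ∈ Icc 0 T :=
  ⟨le_max_left _ _, max_le hT.le (min_le_right _ _)⟩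

theorem clamp_of_mem {T t : ℝ} (ht : t ∈ Icc 0 T) : clamp T t = t := by
  rw [clamp, min_eq_left ht.2, max_eq_right ht.1]

theorem continuous_uncurry_clamp {E : Type*} [TopologicalSpace E] {T : ℝ} (hT : 0 < T)
    {F : ℝ → ℝ → E} (h : ContinuousOn (fun p : ℝ × ℝ => F p.1 p.2) (univ ×ˢ Icc 0 T)) :
    Continuous (Function.uncurry fun x t => F x (clamp T t)) :=
  h.comp_continuous (f := fun p : ℝ × ℝ => (p.1, clamp T p.2)) (by unfold clamp; fun_prop)
    fun p => ⟨mem_univ _, clamp_mem hT p.2⟩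

theorem abs_fst_le_sqrt_sq2 (p : ℝ × ℝ) : |p.1| ≤ Real.sqrt (sq2 p) :=
  Real.abs_le_sqrt (by unfold sq2; nlinarith [sq_nonneg p.2])

theorem abs_snd_le_sqrt_sq2 (p : ℝ × ℝ) : |p.2| ≤ Real.sqrt (sq2 p) :=
  Real.abs_le_sqrt (by unfold sq2; nlinarith [sq_nonneg p.1])

theorem sq2_nonneg (p : ℝ × ℝ) : 0 ≤ sq2 p := by unfold sq2; positivity

namespace IsClassicalSolution

variable {α β T : ℝ} {v u θ : ℝ → ℝ → ℝ} {w b : ℝ → ℝ → ℝ × ℝ} {t : ℝ}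

theorem deriv_v (h : IsClassicalSolution α β T v u θ w b)
    (x : ℝ) (ht : t ∈ Icc 0 T) :
    HasDerivAt (fun y => v y t) (pdx v x t) x :=
  (h.diff_x x t ht).1.hasDerivAt

theorem deriv_u (h : IsClassicalSolution α β T v u θ w b)
    (x : ℝ) (ht : t ∈ Icc 0 T) :
    HasDerivAt (fun y => u y t) (pdx u x t) x :=
  (h.diff_x x t ht).2.1.hasDerivAt

theorem deriv_θ (h : IsClassicalSolution α β T v u θ w b)
    (x : ℝ) (ht : t ∈ Icc 0 T) :
    HasDerivAt (fun y => θ y t) (pdx θ x t) x :=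
  (h.diff_x x t ht).2.2.1.hasDerivAt

theorem deriv_w (h : IsClassicalSolution α β T v u θ w b)
    (x : ℝ) (ht : t ∈ Icc 0 T) :
    HasDerivAt (fun y => w y t) (pdx w x t) x :=
  (h.diff_x x t ht).2.2.2.1.hasDerivAt

theorem deriv_b (h : IsClassicalSolution α β T v u θ w b)
    (x : ℝ) (ht : t ∈ Icc 0 T) :
    HasDerivAt (fun y => b y t) (pdx b x t) x :=
  (h.diff_x x t ht).2.2.2.2.hasDerivAt

theorem time_v (h : IsClassicalSolution α β T v u θ w b) (x : ℝ) (ht : t ∈ Icc 0 T) :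
    HasDerivWithinAt (fun s => v x s) (pdx u x t) (Icc 0 T) t := by
  rw [← h.eq_mass x t ht]
  exact (h.diff_t x t ht).1.hasDerivWithinAt

theorem time_b (h : IsClassicalSolution α β T v u θ w b) (x : ℝ) (ht : t ∈ Icc 0 T) :
    HasDerivWithinAt (fun s => b x s) (pdt T b x t) (Icc 0 T) t :=
  (h.diff_t x t ht).2.2.2.2.hasDerivWithinAt

theorem deriv_momentum (h : IsClassicalSolution α β T v u θ w b) (x : ℝ) (ht : t ∈ Icc 0 T) :
    HasDerivAt (fun y => visc α (v y t) * pdx u y t / v y t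
      - (θ y t / v y t + ((b y t).1 ^ 2 + (b y t).2 ^ 2) / 2)) (pdt T u x t) x := by
  have hv := (h.v_pos x t ht).ne'
  have h1 : DifferentiableAt ℝ (fun y => visc α (v y t) * pdx u y t / v y t) x := by
    refine DifferentiableAt.div (DifferentiableAt.mul ?_ (h.diff_xx x t ht).1)
      (h.diff_x x t ht).1 hv
    unfold visc
    exact (((h.diff_x x t ht).1.rpow_const (Or.inl hv)).const_mul _).const_add _
  have h2 : DifferentiableAt ℝ (fun y => θ y t / v y t + sq2 (b y t) / 2) x := by
    refine DifferentiableAt.add ((h.diff_x x t ht).2.2.1.div (h.diff_x x t ht).1 hv) ?_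
    unfold sq2
    have h3 := (h.deriv_b x ht).prod_fst.differentiableAt
    have h4 := (h.deriv_b x ht).prod_snd.differentiableAt
    exact ((h3.pow 2).add (h4.pow 2)).div_const _
  refine (h1.hasDerivAt.sub h2.hasDerivAt).congr_deriv ?_
  have := h.eq_mom x t ht
  unfold pdx at this ⊢
  linarith

theorem deriv_flux_w (h : IsClassicalSolution α β T v u θ w b) (x : ℝ) (ht : t ∈ Icc 0 T) :
    HasDerivAt (fun y => (v y t)⁻¹ • pdx w y t) (pdt T w x t - pdx b x t) x := by
  rw [h.eq_w x t ht]
  exact (((h.diff_x x t ht).1.inv (h.v_pos x t ht).ne').smul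
    (h.diff_xx x t ht).2.2.1).hasDerivAt

theorem deriv_flux_b (h : IsClassicalSolution α β T v u θ w b)
    (hT : 0 < T) (x : ℝ) (ht : t ∈ Icc 0 T) :
    HasDerivAt (fun y => (v y t)⁻¹ • pdx b y t)
      (v x t • pdt T b x t + pdx u x t • b x t - pdx w x t) x := by
  have h1 := ((h.time_v x ht).smul (h.time_b x ht)).derivWithin (uniqueDiffOn_Icc hT t ht)
  have h2 : pdt T (fun y s => v y s • b y s) x t
      = v x t • pdt T b x t + pdx u x t • b x t := h1
  rw [← h2, h.eq_b x t ht]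
  exact (((h.diff_x x t ht).1.inv (h.v_pos x t ht).ne').smul
    (h.diff_xx x t ht).2.2.2).hasDerivAt

theorem deriv_heat (h : IsClassicalSolution α β T v u θ w b) (x : ℝ) (ht : t ∈ Icc 0 T) :
    HasDerivAt (fun y => θ y t ^ β * pdx θ y t / v y t)
      (pdt T θ x t + θ x t / v x t * pdx u x t
        - (visc α (v x t) * pdx u x t ^ 2 + sq2 (pdx w x t) + sq2 (pdx b x t)) / v x t) x := by
  have h1 : DifferentiableAt ℝ (fun y => θ y t ^ β * pdx θ y t / v y t) x :=
    (((h.diff_x x t ht).2.2.1.rpow_const (Or.inl (h.θ_pos x t ht).ne')).mul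
      (h.diff_xx x t ht).2.1).div (h.diff_x x t ht).1 (h.v_pos x t ht).ne'
  refine h1.hasDerivAt.congr_deriv ?_
  rw [h.eq_temp x t ht, add_sub_cancel_right]
  rfl

theorem lower_bound (h : IsClassicalSolution α β T v u θ w b)
    (hT : 0 < T) : ∃ m > 0, ∀ x, ∀ t ∈ Icc 0 T, m ≤ v x t ∧ m ≤ θ x t := by
  obtain ⟨M, hM⟩ := h.farfield (1 / 2) (by norm_num)
  have hc : IsCompact (Icc (-|M|) |M| ×ˢ Icc 0 T) := isCompact_Icc.prod isCompact_Icc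
  have hsub : Icc (-|M|) |M| ×ˢ Icc 0 T ⊆ univ ×ˢ Icc 0 T :=
    prod_mono_left (subset_univ _)
  have hne : (Icc (-|M|) |M| ×ˢ Icc 0 T).Nonempty :=
    ⟨(0, 0), ⟨by simp, by simp⟩, ⟨le_rfl, hT.le⟩⟩
  have hmin : ContinuousOn (fun p : ℝ × ℝ => min (v p.1 p.2) (θ p.1 p.2))
      (Icc (-|M|) |M| ×ˢ Icc 0 T) :=
    (ContinuousOn.inf h.cont.fst h.cont.snd.snd.fst).mono hsub
  obtain ⟨p, hp, hpm⟩ := hc.exists_isMinOn hne hmin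
  refine ⟨min (min (v p.1 p.2) (θ p.1 p.2)) (1 / 2), lt_min (lt_min (h.v_pos _ _ hp.2)
    (h.θ_pos _ _ hp.2)) (by norm_num), fun x t ht => ?_⟩
  rcases le_total M |x| with hx | hx
  · obtain ⟨h1, -, h2, -⟩ := hM x t ht hx
    have e := min_le_right (min (v p.1 p.2) (θ p.1 p.2)) (1 / 2)
    constructor <;> linarith [(abs_lt.1 h1).1, (abs_lt.1 h2).1]
  · have hq : (x, t) ∈ Icc (-|M|) |M| ×ˢ Icc 0 T := ⟨abs_le.1 (hx.trans (le_abs_self _)), ht⟩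
    have h1 : min (v p.1 p.2) (θ p.1 p.2) ≤ min (v x t) (θ x t) := hpm hq
    have h2 := (min_le_left _ (1 / 2)).trans h1
    exact ⟨h2.trans (min_le_left _ _), h2.trans (min_le_right _ _)⟩

theorem upper_bound (h : IsClassicalSolution α β T v u θ w b)
    : ∃ B, ∀ x, ∀ t ∈ Icc 0 T, v x t ≤ B ∧ θ x t ≤ B ∧ |u x t| ≤ B ∧
    |(w x t).1| ≤ B ∧ |(w x t).2| ≤ B ∧ |(b x t).1| ≤ B ∧ |(b x t).2| ≤ B := by
  obtain ⟨M, hM⟩ := h.farfield 1 one_pos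
  have hc : IsCompact (Icc (-|M|) |M| ×ˢ Icc 0 T) := isCompact_Icc.prod isCompact_Icc
  have hsub : Icc (-|M|) |M| ×ˢ Icc 0 T ⊆ univ ×ˢ Icc 0 T :=
    prod_mono_left (subset_univ _)
  obtain ⟨B, hB⟩ := hc.exists_bound_of_continuousOn (h.cont.mono hsub)
  refine ⟨max B 2, fun x t ht => ?_⟩
  rcases le_total M |x| with hx | hx
  · obtain ⟨h1, h2, h3, h4, h5⟩ := hM x t ht hx
    have e := le_max_right B 2
    have := abs_fst_le_sqrt_sq2 (b x t)
    have := abs_snd_le_sqrt_sq2 (b x t)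
    have := abs_fst_le_sqrt_sq2 (w x t)
    have := abs_snd_le_sqrt_sq2 (w x t)
    refine ⟨?_, ?_, ?_, ?_, ?_, ?_, ?_⟩ <;> linarith [(abs_lt.1 h1).2, (abs_lt.1 h3).2]
  · have h1 := (hB (x, t) ⟨abs_le.1 (hx.trans (le_abs_self _)), ht⟩).trans (le_max_left B 2)
    simp only [Prod.norm_def, sup_le_iff, Real.norm_eq_abs] at h1
    obtain ⟨h1, h2, h3, ⟨h4, h5⟩, h6, h7⟩ := h1
    exact ⟨(le_abs_self _).trans h1, (le_abs_self _).trans h3, h2, h4, h5, h6, h7⟩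

/-- The flow obtained by freezing a classical solution outside `[0, T]`. -/
def toFlow (h : IsClassicalSolution α β T v u θ w b) (hT : 0 < T) : MHDFlow α β T where
  v x t := v x (clamp T t)
  u x t := u x (clamp T t)
  θ x t := θ x (clamp T t)
  w₁ x t := (w x (clamp T t)).1
  w₂ x t := (w x (clamp T t)).2
  b₁ x t := (b x (clamp T t)).1
  b₂ x t := (b x (clamp T t)).2
  ux x t := pdx u x (clamp T t)
  θx x t := pdx θ x (clamp T t)
  w₁x x t := (pdx w x (clamp T t)).1
  w₂x x t := (pdx w x (clamp T t)).2
  b₁x x t := (pdx b x (clamp T t)).1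
  b₂x x t := (pdx b x (clamp T t)).2
  ut x t := pdt T u x (clamp T t)
  θt x t := pdt T θ x (clamp T t)
  w₁t x t := (pdt T w x (clamp T t)).1
  w₂t x t := (pdt T w x (clamp T t)).2
  b₁t x t := (pdt T b x (clamp T t)).1
  b₂t x t := (pdt T b x (clamp T t)).2
  cont_v := continuous_uncurry_clamp hT h.cont.fst
  cont_u := continuous_uncurry_clamp hT h.cont.snd.fst
  cont_θ := continuous_uncurry_clamp hT h.cont.snd.snd.fst
  cont_w₁ := (continuous_uncurry_clamp hT h.cont.snd.snd.snd.fst).fst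
  cont_w₂ := (continuous_uncurry_clamp hT h.cont.snd.snd.snd.fst).snd
  cont_b₁ := (continuous_uncurry_clamp hT h.cont.snd.snd.snd.snd).fst
  cont_b₂ := (continuous_uncurry_clamp hT h.cont.snd.snd.snd.snd).snd
  cont_ux := continuous_uncurry_clamp hT h.cont_dx.snd.fst
  cont_θx := continuous_uncurry_clamp hT h.cont_dx.snd.snd.fst
  cont_w₁x := continuous_uncurry_clamp hT (F := fun x t => (pdx w x t).1)
    h.cont_dx.snd.snd.snd.fst.fst
  cont_w₂x := continuous_uncurry_clamp hT (F := fun x t => (pdx w x t).2)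
    h.cont_dx.snd.snd.snd.fst.snd
  cont_b₁x := continuous_uncurry_clamp hT (F := fun x t => (pdx b x t).1)
    h.cont_dx.snd.snd.snd.snd.fst
  cont_b₂x := continuous_uncurry_clamp hT (F := fun x t => (pdx b x t).2)
    h.cont_dx.snd.snd.snd.snd.snd
  cont_ut := continuous_uncurry_clamp hT h.cont_dt.snd.fst
  cont_θt := continuous_uncurry_clamp hT h.cont_dt.snd.snd.fst
  cont_w₁t := continuous_uncurry_clamp hT (F := fun x t => (pdt T w x t).1)
    h.cont_dt.snd.snd.snd.fst.fst
  cont_w₂t := continuous_uncurry_clamp hT (F := fun x t => (pdt T w x t).2)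
    h.cont_dt.snd.snd.snd.fst.snd
  cont_b₁t := continuous_uncurry_clamp hT (F := fun x t => (pdt T b x t).1)
    h.cont_dt.snd.snd.snd.snd.fst
  cont_b₂t := continuous_uncurry_clamp hT (F := fun x t => (pdt T b x t).2)
    h.cont_dt.snd.snd.snd.snd.snd
  deriv_u x t := h.deriv_u x (clamp_mem hT t)
  deriv_θ x t := h.deriv_θ x (clamp_mem hT t)
  deriv_w₁ x t := (h.deriv_w x (clamp_mem hT t)).prod_fst
  deriv_w₂ x t := (h.deriv_w x (clamp_mem hT t)).prod_snd
  deriv_b₁ x t := (h.deriv_b x (clamp_mem hT t)).prod_fst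
  deriv_b₂ x t := (h.deriv_b x (clamp_mem hT t)).prod_snd
  time_v x t ht := by
    rw [clamp_of_mem ht]
    exact (h.time_v x ht).congr (fun s hs => by rw [clamp_of_mem hs]) (by rw [clamp_of_mem ht])
  time_u x t ht := by
    rw [clamp_of_mem ht]
    exact (h.diff_t x t ht).2.1.hasDerivWithinAt.congr (fun s hs => by rw [clamp_of_mem hs])
      (by rw [clamp_of_mem ht])
  time_θ x t ht := by
    rw [clamp_of_mem ht]
    exact (h.diff_t x t ht).2.2.1.hasDerivWithinAt.congr (fun s hs => by rw [clamp_of_mem hs])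
      (by rw [clamp_of_mem ht])
  time_w₁ x t ht := by
    rw [clamp_of_mem ht]
    exact (h.diff_t x t ht).2.2.2.1.hasDerivWithinAt.prod_fst.congr
      (fun s hs => by rw [clamp_of_mem hs]) (by rw [clamp_of_mem ht])
  time_w₂ x t ht := by
    rw [clamp_of_mem ht]
    exact (h.diff_t x t ht).2.2.2.1.hasDerivWithinAt.prod_snd.congr
      (fun s hs => by rw [clamp_of_mem hs]) (by rw [clamp_of_mem ht])
  time_b₁ x t ht := by
    rw [clamp_of_mem ht]
    exact (h.time_b x ht).prod_fst.congr
      (fun s hs => by rw [clamp_of_mem hs]) (by rw [clamp_of_mem ht])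
  time_b₂ x t ht := by
    rw [clamp_of_mem ht]
    exact (h.time_b x ht).prod_snd.congr
      (fun s hs => by rw [clamp_of_mem hs]) (by rw [clamp_of_mem ht])
  momentum x t := h.deriv_momentum x (clamp_mem hT t)
  flux_w₁ x t := (h.deriv_flux_w x (clamp_mem hT t)).prod_fst.congr_of_eventuallyEq
    (Eventually.of_forall fun y => div_eq_inv_mul _ _)
  flux_w₂ x t := (h.deriv_flux_w x (clamp_mem hT t)).prod_snd.congr_of_eventuallyEq
    (Eventually.of_forall fun y => div_eq_inv_mul _ _)
  flux_b₁ x t := ((h.deriv_flux_b hT x (clamp_mem hT t)).prod_fst.congr_of_eventuallyEq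
    (Eventually.of_forall fun y => div_eq_inv_mul _ _)).congr_deriv (by simp; ring)
  flux_b₂ x t := ((h.deriv_flux_b hT x (clamp_mem hT t)).prod_snd.congr_of_eventuallyEq
    (Eventually.of_forall fun y => div_eq_inv_mul _ _)).congr_deriv (by simp; ring)
  heat x t := h.deriv_heat x (clamp_mem hT t)
  lower := by
    obtain ⟨m, hm, hl⟩ := h.lower_bound hT
    exact ⟨m, hm, fun x t => hl x _ (clamp_mem hT t)⟩
  upper := by
    obtain ⟨B, hB⟩ := h.upper_bound
    exact ⟨B, fun x t => hB x _ (clamp_mem hT t)⟩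
  far ε hε := by
    obtain ⟨M, hM⟩ := h.farfield ε hε
    refine ⟨M, fun x t hx => ?_⟩
    obtain ⟨-, h2, h3, h4, h5⟩ := hM x _ (clamp_mem hT t) hx
    exact ⟨h3, h2, (abs_fst_le_sqrt_sq2 _).trans_lt h5, (abs_snd_le_sqrt_sq2 _).trans_lt h5,
      (abs_fst_le_sqrt_sq2 _).trans_lt h4, (abs_snd_le_sqrt_sq2 _).trans_lt h4⟩

theorem toFlow_S (h : IsClassicalSolution α β T v u θ w b) (hT : 0 < T) (x : ℝ) (ht : t ∈ Icc 0 T) :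
    (h.toFlow hT).S x t = sq2 (b x t) := by
  change (b x (clamp T t)).1 ^ 2 + (b x (clamp T t)).2 ^ 2 = _
  rw [clamp_of_mem ht, sq2]

theorem initialBound (h : IsClassicalSolution α β T v u θ w b)
    (hT : 0 < T) {K δ : ℝ} (hK : 0 < K) (ha : Admissible K δ v u θ w b) :
    (h.toFlow hT).InitialBound K δ := by
  obtain ⟨hle, hv, hθ⟩ := ha
  have h0 : (0:ℝ) ∈ Icc 0 T := ⟨le_rfl, hT.le⟩
  have hline : ∀ {E : Type} [TopologicalSpace E] {F : ℝ → ℝ → E},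
      ContinuousOn (fun p : ℝ × ℝ => F p.1 p.2) (univ ×ˢ Icc 0 T) →
      Continuous fun x => F x 0 := fun hF =>
    hF.comp_continuous (f := fun x : ℝ => (x, (0:ℝ))) (by fun_prop) fun x => ⟨mem_univ _, h0⟩
  have c1 := hline h.cont.fst
  have c2 := hline h.cont.snd.fst
  have c3 := hline h.cont.snd.snd.fst
  have c4 := hline h.cont.snd.snd.snd.fst
  have c5 := hline h.cont.snd.snd.snd.snd
  have d1 := hline (F := pdx v) h.cont_dx.fst
  have d2 := hline (F := pdx u) h.cont_dx.snd.fst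
  have d3 := hline (F := pdx θ) h.cont_dx.snd.snd.fst
  have d4 := hline (F := pdx w) h.cont_dx.snd.snd.snd.fst
  have d5 := hline (F := pdx b) h.cont_dx.snd.snd.snd.snd
  obtain ⟨i1, i2, i3, i4, i5, i6, i7, i8, i9, i10⟩ := h.sq_int 0 h0
  have hgi := ((((((((i1.add i2).add i3).add i4).add i5).add i6).add i7).add i8).add i9).add i10
  have hgc : Continuous fun x => ((v x 0 - 1) ^ 2 + (u x 0) ^ 2 + (θ x 0 - 1) ^ 2
      + sq2 (b x 0) + sq2 (w x 0) + (pdx v x 0) ^ 2 + (pdx u x 0) ^ 2 + (pdx θ x 0) ^ 2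
      + sq2 (pdx b x 0) + sq2 (pdx w x 0)) := by
    unfold sq2
    fun_prop
  have hg0 : ∀ x, 0 ≤ ((v x 0 - 1) ^ 2 + (u x 0) ^ 2 + (θ x 0 - 1) ^ 2
      + sq2 (b x 0) + sq2 (w x 0) + (pdx v x 0) ^ 2 + (pdx u x 0) ^ 2 + (pdx θ x 0) ^ 2
      + sq2 (pdx b x 0) + sq2 (pdx w x 0)) := fun x => by
    unfold sq2
    positivity
  constructor
  · intro R hR
    have e : ∀ x, ((h.toFlow hT).v x 0 - 1) ^ 2 + (h.toFlow hT).u x 0 ^ 2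
        + ((h.toFlow hT).θ x 0 - 1) ^ 2 + (h.toFlow hT).S x 0
        + ((h.toFlow hT).w₁ x 0 ^ 2 + (h.toFlow hT).w₂ x 0 ^ 2)
        = (v x 0 - 1) ^ 2 + (u x 0) ^ 2 + (θ x 0 - 1) ^ 2 + sq2 (b x 0) + sq2 (w x 0) := by
      intro x
      rw [h.toFlow_S hT x h0]
      simp only [toFlow, clamp_of_mem h0, sq2]
    simp_rw [e]
    refine le_trans ?_ hle
    rw [intervalIntegral.integral_of_le (by linarith)]
    refine (setIntegral_mono_on ((((i1.add i2).add i3).add i4).add i5).integrableOn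
      hgi.integrableOn measurableSet_Ioc fun x _ => ?_).trans
      (setIntegral_le_integral hgi (Eventually.of_forall hg0))
    have := sq2_nonneg (pdx b x 0)
    have := sq2_nonneg (pdx w x 0)
    simp only [Pi.add_apply]
    linarith [sq_nonneg (pdx v x 0), sq_nonneg (pdx u x 0), sq_nonneg (pdx θ x 0)]
  · intro x
    change δ ≤ v x (clamp T 0)
    rw [clamp_of_mem h0]
    exact hv x
  · intro x
    change δ ≤ θ x (clamp T 0)
    rw [clamp_of_mem h0]
    exact hθ x
  · intro x
    change v x (clamp T 0) ≤ _
    rw [clamp_of_mem h0]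
    have hsq : (v x 0 - 1) ^ 2 ≤ K ^ 2 := by
      refine le_integral_of_neg_deriv_le (F := fun x => (v x 0 - 1) ^ 2)
        (F' := fun x => 2 * (v x 0 - 1) * pdx v x 0)
        (fun x => (((h.deriv_v x h0).sub_const 1).pow 2).congr_deriv (by simp))
        (by fun_prop) hgc hg0 hgi (fun x => ?_) (fun ε hε => ?_) hle x
      · have := sq2_nonneg (b x 0)
        have := sq2_nonneg (w x 0)
        have := sq2_nonneg (pdx b x 0)
        have := sq2_nonneg (pdx w x 0)
        nlinarith [sq_nonneg (v x 0 - 1 + pdx v x 0), sq_nonneg (u x 0), sq_nonneg (θ x 0 - 1),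
          sq_nonneg (pdx u x 0), sq_nonneg (pdx θ x 0)]
      · obtain ⟨M, hM⟩ := h.farfield (Real.sqrt ε) (Real.sqrt_pos.2 hε)
        refine ⟨M, fun x hx => ?_⟩
        have h1 := (hM x 0 h0 hx).1
        rw [← sq_abs, ← Real.sq_sqrt hε.le]
        exact pow_le_pow_left₀ (abs_nonneg _) h1.le 2
    linarith [(abs_le_of_sq_le_sq' hsq hK.le).2]
  · intro x
    rw [h.toFlow_S hT x h0]
    refine le_integral_of_neg_deriv_le (F := fun x => sq2 (b x 0))
      (F' := fun x => 2 * (b x 0).1 * (pdx b x 0).1 + 2 * (b x 0).2 * (pdx b x 0).2)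
      (fun x => (((h.deriv_b x h0).prod_fst.pow 2).add
        ((h.deriv_b x h0).prod_snd.pow 2)).congr_deriv (by simp))
      (by fun_prop) hgc hg0 hgi (fun x => ?_) (fun ε hε => ?_) hle x
    · have := sq2_nonneg (w x 0)
      have := sq2_nonneg (pdx w x 0)
      have e : 0 ≤ sq2 (b x 0) + sq2 (pdx b x 0)
          + (2 * (b x 0).1 * (pdx b x 0).1 + 2 * (b x 0).2 * (pdx b x 0).2) := by
        unfold sq2
        nlinarith [sq_nonneg ((b x 0).1 + (pdx b x 0).1), sq_nonneg ((b x 0).2 + (pdx b x 0).2)]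
      linarith [sq_nonneg (v x 0 - 1), sq_nonneg (u x 0), sq_nonneg (θ x 0 - 1),
        sq_nonneg (pdx v x 0), sq_nonneg (pdx u x 0), sq_nonneg (pdx θ x 0)]
    · obtain ⟨M, hM⟩ := h.farfield (Real.sqrt ε) (Real.sqrt_pos.2 hε)
      refine ⟨M, fun x hx => ?_⟩
      have h1 := (hM x 0 h0 hx).2.2.2.1
      exact (Real.sqrt_le_sqrt_iff hε.le).1 h1.le

end IsClassicalSolution

/-- (2.31) of the paper: the transverse magnetic field is uniformly
bounded on `ℝ × [0,T]` by a constant depending only on `T, α, β, K, δ`. -/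
theorem b_uniform_bound (α β T K δ : ℝ) (hα : 0 ≤ α) (hβ : 0 < β) (hT : 0 < T)
    (hK : 0 < K) (hδ₀ : 0 < δ) (hδ₁ : δ ≤ 1) :
    ∃ C : ℝ, 0 < C ∧
      ∀ (v u θ : ℝ → ℝ → ℝ) (w b : ℝ → ℝ → ℝ × ℝ),
        IsClassicalSolution α β T v u θ w b → Admissible K δ v u θ w b →
        ∀ x : ℝ, ∀ t ∈ Icc (0:ℝ) T, Real.sqrt (sq2 (b x t)) ≤ C := by
  obtain ⟨C, hC, hS⟩ := MHDFlow.S_bound hα hβ hT hK hδ₀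
  refine ⟨Real.sqrt C, Real.sqrt_pos.2 hC, fun v u θ w b h ha x t ht => ?_⟩
  rw [← h.toFlow_S hT x ht]
  exact Real.sqrt_le_sqrt (hS _ (h.initialBound hT hK ha) x t ht)
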